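/- For every k-graph F with π_{k−2}(F) > 0, one has π_{k−2}(F) ≥ k^{−k}. -/

import Mathlib

open scoped Classical BigOperators

noncomputable section

/-- A family of finsets is `k`-uniform: every member has `k` elements. -/
def HGIsUniform (k : ℕ) {V : Type*} (G : Finset (Finset V)) : Prop :=
  ∀ e ∈ G, e.card = k

/-- `𝒦_k(G)`: the `k`-element subsets of `Fin n` all of whose `j`-element subsets are
edges of the `j`-graph `G`, i.e. the `k`-sets spanning a clique `K_k^{(j)}` in `G`. -/
def cliqueSet (k j n : ℕ) (G : Finset (Finset (Fin n))) : Finset (Finset (Fin n)) :=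
  (Finset.powersetCard k (Finset.univ : Finset (Fin n))).filter
    (fun e => ∀ s ∈ Finset.powersetCard j e, s ∈ G)

/-- A `k`-graph with edge set `E` on `Fin n` is `(d, μ, j)`-dense:
`|𝒦_k(G) ∩ E| ≥ d·|𝒦_k(G)| − μ·n^k` for every `j`-graph `G` on the vertex set. -/
def IsDense (k j n : ℕ) (d μ : ℝ) (E : Finset (Finset (Fin n))) : Prop :=
  ∀ G : Finset (Finset (Fin n)), HGIsUniform j G →
    d * ((cliqueSet k j n G).card : ℝ) - μ * (n : ℝ) ^ k
      ≤ (((cliqueSet k j n G) ∩ E).card : ℝ)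

/-- `E` contains no copy of the `k`-graph `F`. -/
def HGFree {f n : ℕ} (F : Finset (Finset (Fin f))) (E : Finset (Finset (Fin n))) : Prop :=
  ¬ ∃ g : Fin f → Fin n, Function.Injective g ∧ ∀ e ∈ F, e.image g ∈ E

/-- The uniform Turán density `π_j(F)` of a `k`-graph `F`: the supremum of `d ∈ [0,1]`
such that for every `μ > 0` and every `n₀` there is an `F`-free `(d,μ,j)`-dense
`k`-graph on at least `n₀` vertices. -/
def uniformTuranDensity (k j f : ℕ) (F : Finset (Finset (Fin f))) : ℝ :=
  sSup {d : ℝ | d ∈ Set.Icc (0 : ℝ) 1 ∧ ∀ μ : ℝ, 0 < μ → ∀ n₀ : ℕ, ∃ n : ℕ, n₀ ≤ n ∧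
    ∃ E : Finset (Finset (Fin n)), HGIsUniform k E ∧ HGFree F E ∧ IsDense k j n d μ E}

section concentration
open Finset

lemma exp_le_cosh_add_mul_sinh {x c : ℝ} (hc : 0 < c) (hx : |x| ≤ c) :
    Real.exp x ≤ Real.cosh c + x / c * Real.sinh c := by
  obtain ⟨h1, h2⟩ := abs_le.mp hx
  have ha : 0 ≤ (c + x) / (2 * c) := div_nonneg (by linarith) (by linarith)
  have hb : 0 ≤ (c - x) / (2 * c) := div_nonneg (by linarith) (by linarith)
  have key := convexOn_exp.2 (Set.mem_univ c) (Set.mem_univ (-c)) ha hb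
    (by field_simp; ring)
  simp only [smul_eq_mul] at key
  have e1 : (c + x) / (2 * c) * c + (c - x) / (2 * c) * -c = x := by field_simp; ring
  rw [e1] at key
  refine key.trans_eq ?_
  rw [Real.cosh_eq, Real.sinh_eq]
  field_simp
  ring

/-- Hoeffding's lemma for a finite uniform distribution, with a crude constant. -/
lemma sum_exp_le_of_abs_le {α : Type*} [Fintype α] (f : α → ℝ) {c : ℝ} (hc : 0 ≤ c)
    (hf : ∀ a, |f a| ≤ c) (h0 : ∑ a, f a = 0) :
    ∑ a, Real.exp (f a) ≤ Fintype.card α * Real.exp (c ^ 2 / 2) := by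
  rcases hc.eq_or_lt with rfl | hc
  · have : ∀ a, f a = 0 := fun a => abs_nonpos_iff.mp (hf a)
    simp [this]
  calc ∑ a, Real.exp (f a) ≤ ∑ a, (Real.cosh c + f a / c * Real.sinh c) :=
        sum_le_sum fun a _ => exp_le_cosh_add_mul_sinh hc (hf a)
    _ = Fintype.card α * Real.cosh c := by
        rw [sum_add_distrib, ← sum_mul, ← sum_div, h0]; simp
    _ ≤ _ := by gcongr; exact Real.cosh_le_exp_half_sq c

/-- Exponential moment bound for functions of independent uniform variables with bounded
differences, indexed by `Fin m`. -/
lemma sum_exp_le_of_bounded_differences_fin {α : Type*} [Fintype α] [Nonempty α] :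
    ∀ (m : ℕ) (f : (Fin m → α) → ℝ) (c : Fin m → ℝ), (∀ i, 0 ≤ c i) →
      (∀ i x a, |f (Function.update x i a) - f x| ≤ c i) → ∑ x, f x = 0 →
      ∑ x, Real.exp (f x) ≤ (Fintype.card α : ℝ) ^ m * Real.exp ((∑ i, c i ^ 2) / 2) := by
  intro m
  induction m with
  | zero =>
    intro f c _ _ h0
    simp only [univ_unique, sum_singleton] at h0 ⊢
    simp [h0]
  | succ m ih =>
    intro f c hc hf h0
    have hcard : (0 : ℝ) < Fintype.card α := by exact_mod_cast Fintype.card_pos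
    have split : ∀ g : (Fin (m + 1) → α) → ℝ, ∑ x, g x = ∑ a, ∑ b, g (Fin.cons a b) := by
      intro g
      rw [← (Fin.consEquiv fun _ => α).sum_comp, Fintype.sum_prod_type]
      rfl
    set q : ℝ := (Fintype.card α : ℝ) ^ m with hq
    have hqpos : 0 < q := by positivity
    have hqc : (Fintype.card (Fin m → α) : ℝ) = q := by simp [hq]
    let g : α → ℝ := fun a => (∑ b, f (Fin.cons a b)) / q
    have hg0 : ∑ a, g a = 0 := by
      simp only [g]
      rw [← sum_div, ← split, h0, zero_div]
    have hosc : ∀ a a', |g a - g a'| ≤ c 0 := by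
      intro a a'
      simp only [g]
      rw [← sub_div, ← sum_sub_distrib, abs_div, abs_of_pos hqpos, div_le_iff₀ hqpos]
      calc |∑ b, (f (Fin.cons a b) - f (Fin.cons a' b))|
          ≤ ∑ b, |f (Fin.cons a b) - f (Fin.cons a' b)| := abs_sum_le_sum_abs _ _
        _ ≤ ∑ _b : Fin m → α, c 0 := by
            refine sum_le_sum fun b _ => ?_
            have := hf 0 (Fin.cons a' b) a
            rwa [Fin.update_cons_zero] at this
        _ = c 0 * q := by rw [sum_const, card_univ, nsmul_eq_mul, hqc, mul_comm]
    have hgabs : ∀ a, |g a| ≤ c 0 := by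
      intro a
      have : (Fintype.card α : ℝ) * g a = ∑ a', (g a - g a') := by
        rw [sum_sub_distrib, hg0]; simp
      have h2 : (Fintype.card α : ℝ) * |g a| ≤ Fintype.card α * c 0 := by
        rw [← abs_of_pos hcard, ← abs_mul, abs_of_pos hcard, this]
        refine (abs_sum_le_sum_abs _ _).trans ((sum_le_sum fun a' _ => hosc a a').trans_eq ?_)
        simp
      exact le_of_mul_le_mul_left h2 hcard
    have inner : ∀ a, ∑ b, Real.exp (f (Fin.cons a b))
        ≤ q * Real.exp ((∑ i : Fin m, c i.succ ^ 2) / 2) * Real.exp (g a) := by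
      intro a
      have := ih (fun b => f (Fin.cons a b) - g a) (fun i => c i.succ) (fun i => hc _)
        (fun i x a' => by
          have := hf i.succ (Fin.cons a x) a'
          rw [← Fin.cons_update] at this
          simpa using this)
        (by
          rw [sum_sub_distrib, sum_const, card_univ, nsmul_eq_mul, hqc]
          simp only [g]
          field_simp
          simp)
      calc ∑ b, Real.exp (f (Fin.cons a b))
          = (∑ b, Real.exp (f (Fin.cons a b) - g a)) * Real.exp (g a) := by
            rw [sum_mul]
            refine sum_congr rfl fun b _ => ?_
            rw [← Real.exp_add]; congr 1; ring
        _ ≤ _ := by gcongr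
    rw [split]
    calc ∑ a, ∑ b, Real.exp (f (Fin.cons a b))
        ≤ ∑ a, q * Real.exp ((∑ i : Fin m, c i.succ ^ 2) / 2) * Real.exp (g a) :=
          sum_le_sum fun a _ => inner a
      _ = q * Real.exp ((∑ i : Fin m, c i.succ ^ 2) / 2) * ∑ a, Real.exp (g a) := by
          rw [mul_sum]
      _ ≤ q * Real.exp ((∑ i : Fin m, c i.succ ^ 2) / 2)
            * (Fintype.card α * Real.exp (c 0 ^ 2 / 2)) := by
          gcongr
          exact sum_exp_le_of_abs_le g (hc 0) hgabs hg0
      _ = _ := by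
          rw [Fin.sum_univ_succ, add_div, Real.exp_add, pow_succ]; ring

/-- Exponential moment bound for functions of independent uniform variables with bounded
differences. -/
lemma sum_exp_le_of_bounded_differences {ι α : Type*} [Fintype ι] [DecidableEq ι] [Fintype α]
    [Nonempty α] (f : (ι → α) → ℝ) (c : ι → ℝ) (hc : ∀ i, 0 ≤ c i)
    (hf : ∀ i x a, |f (Function.update x i a) - f x| ≤ c i) (h0 : ∑ x, f x = 0) :
    ∑ x, Real.exp (f x)
      ≤ (Fintype.card (ι → α) : ℝ) * Real.exp ((∑ i, c i ^ 2) / 2) := by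
  let e := Fintype.equivFin ι
  let E : (Fin (Fintype.card ι) → α) ≃ (ι → α) := e.symm.arrowCongr (Equiv.refl α)
  have hE : ∀ x, E x = x ∘ e := fun x => by ext; simp [E]
  have := sum_exp_le_of_bounded_differences_fin (α := α) (Fintype.card ι)
    (fun x => f (E x)) (fun i => c (e.symm i)) (fun i => hc _)
    (fun i x a => by
      have := hf (e.symm i) (E x) a
      convert this using 4
      ext j
      simp only [hE, Function.comp, Function.update_apply]
      simp [Equiv.eq_symm_apply])
    (by rw [E.sum_comp f]; exact h0)
  rw [E.sum_comp (fun x => Real.exp (f x)), e.symm.sum_comp (fun i => c i ^ 2)] at this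
  simpa using this

/-- The number of elements of `e` below `v`. -/
def rankIn {α : Type*} [LinearOrder α] (e : Finset α) (v : α) : ℕ :=
  #{u ∈ e | u < v}

/-- The finset `e` with its element of rank `j` removed. -/
def dropRank {α : Type*} [LinearOrder α] (e : Finset α) (j : ℕ) : Finset α :=
  {v ∈ e | rankIn e v ≠ j}

/-- The `k`-sets `e` such that, for every `j`, the subset of `e` missing the element of rank `j`
has colour `j`. -/
def layeredEdges {k n : ℕ} (c : Finset (Fin n) → Fin k) : Finset (Finset (Fin n)) :=
  {e ∈ powersetCard k univ | ∀ j : Fin k, c (dropRank e j) = j}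

section rank
variable {α : Type*} [LinearOrder α]

lemma rankIn_lt_rankIn {e : Finset α} {u v : α} (hu : u ∈ e) (h : u < v) :
    rankIn e u < rankIn e v := by
  refine card_lt_card ⟨fun w hw => ?_, fun hsub => ?_⟩
  · rw [mem_filter] at hw ⊢
    exact ⟨hw.1, hw.2.trans h⟩
  · have := hsub (mem_filter.mpr ⟨hu, h⟩)
    simp at this

lemma rankIn_injOn (e : Finset α) : Set.InjOn (rankIn e) e := by
  intro u hu v hv h
  rcases lt_trichotomy u v with hlt | heq | hlt
  · exact absurd h (rankIn_lt_rankIn hu hlt).ne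
  · exact heq
  · exact absurd h (rankIn_lt_rankIn hv hlt).ne'

lemma rankIn_lt_card {e : Finset α} {v : α} (hv : v ∈ e) : rankIn e v < #e :=
  card_lt_card ⟨filter_subset _ _, fun h => by simpa using h hv⟩

lemma exists_rankIn_eq {e : Finset α} {j : ℕ} (hj : j < #e) : ∃ v ∈ e, rankIn e v = j := by
  have himg : e.image (rankIn e) = range #e := by
    refine eq_of_subset_of_card_le (fun i hi => ?_) ?_
    · obtain ⟨v, hv, rfl⟩ := mem_image.mp hi
      exact mem_range.mpr (rankIn_lt_card hv)
    · rw [card_range, card_image_of_injOn (rankIn_injOn e)]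
  have : j ∈ e.image (rankIn e) := by rw [himg]; exact mem_range.mpr hj
  simpa using this

lemma dropRank_subset (e : Finset α) (j : ℕ) : dropRank e j ⊆ e := filter_subset _ _

lemma dropRank_eq_erase {e : Finset α} {v : α} (hv : v ∈ e) :
    dropRank e (rankIn e v) = e.erase v := by
  ext u
  simp only [dropRank, mem_filter, mem_erase]
  constructor
  · rintro ⟨hu, hne⟩
    exact ⟨fun h => hne (by rw [h]), hu⟩
  · rintro ⟨hne, hu⟩
    exact ⟨hu, fun h => hne (rankIn_injOn e hu hv h)⟩

lemma card_dropRank {e : Finset α} {j : ℕ} (hj : j < #e) : #(dropRank e j) = #e - 1 := by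
  obtain ⟨v, hv, rfl⟩ := exists_rankIn_eq hj
  rw [dropRank_eq_erase hv, card_erase_of_mem hv]

lemma dropRank_injOn {e : Finset α} {i j : ℕ} (hi : i < #e) (hj : j < #e)
    (h : dropRank e i = dropRank e j) : i = j := by
  obtain ⟨u, hu, rfl⟩ := exists_rankIn_eq hi
  obtain ⟨v, hv, rfl⟩ := exists_rankIn_eq hj
  rw [dropRank_eq_erase hu, dropRank_eq_erase hv] at h
  have : u = v := by
    by_contra hne
    have : u ∈ e.erase v := mem_erase.mpr ⟨hne, hu⟩
    rw [← h] at this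
    simp at this
  rw [this]

lemma rankIn_map {β : Type*} [LinearOrder β] (ι : α ↪o β) (e : Finset α) (v : α) :
    rankIn (e.map ι.toEmbedding) (ι v) = rankIn e v := by
  have : ({u ∈ e.map ι.toEmbedding | u < ι v} : Finset β)
      = ({u ∈ e | u < v} : Finset α).map ι.toEmbedding := by
    ext x
    simp only [mem_filter, mem_map]
    constructor
    · rintro ⟨⟨a, ha, rfl⟩, h⟩
      exact ⟨a, ⟨ha, by simpa using h⟩, rfl⟩
    · rintro ⟨a, ⟨ha, h⟩, rfl⟩
      exact ⟨⟨a, ha, rfl⟩, by simpa using h⟩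
  rw [rankIn, this, card_map, rankIn]

lemma dropRank_map {β : Type*} [LinearOrder β] (ι : α ↪o β) (e : Finset α) (j : ℕ) :
    dropRank (e.map ι.toEmbedding) j = (dropRank e j).map ι.toEmbedding := by
  ext x
  simp only [dropRank, mem_filter, mem_map]
  constructor
  · rintro ⟨⟨a, ha, rfl⟩, h⟩
    exact ⟨a, ⟨ha, by rwa [← rankIn_map ι]⟩, rfl⟩
  · rintro ⟨a, ⟨ha, h⟩, rfl⟩
    exact ⟨⟨a, ha, rfl⟩, by erw [rankIn_map ι]; exact h⟩

end rank

section construction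
variable {k n : ℕ}

lemma card_filter_layered (e : Finset (Fin n)) (he : #e = k) :
    (k : ℝ) ^ k * #{c : Finset (Fin n) → Fin k | ∀ j : Fin k, c (dropRank e j) = j}
      = Fintype.card (Finset (Fin n) → Fin k) := by
  let D : Finset (Finset (Fin n)) := univ.image fun j : Fin k => dropRank e j
  have hinj : Function.Injective fun j : Fin k => dropRank e j := fun i j h =>
    Fin.ext (dropRank_injOn (by rw [he]; exact i.2) (by rw [he]; exact j.2) h)
  have hD : #D = k := by rw [card_image_of_injective _ hinj]; simp
  let S : Finset (Fin n) → Finset (Fin k) := fun T => {a | ∀ j : Fin k, dropRank e j = T → a = j}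
  have hS : ({c : Finset (Fin n) → Fin k | ∀ j : Fin k, c (dropRank e j) = j} : Finset _)
      = Fintype.piFinset S := by
    ext c
    simp only [mem_filter, mem_univ, true_and, Fintype.mem_piFinset, S]
    exact ⟨fun h T j hj => hj ▸ h j, fun h j => h _ j rfl⟩
  have hcard : ∀ T, (#(S T) : ℝ) = if T ∈ D then 1 else k := by
    intro T
    split_ifs with hT
    · obtain ⟨j, -, rfl⟩ := mem_image.mp hT
      have : S (dropRank e j) = {j} := by
        ext a
        simp only [S, mem_filter, mem_univ, true_and, mem_singleton]
        exact ⟨fun h => h j rfl, fun h i hi => by rw [h]; exact (hinj hi).symm⟩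
      rw [this]; simp
    · have : S T = univ := by
        ext a
        simp only [S, mem_filter, mem_univ, true_and, iff_true]
        intro j hj
        exact absurd (mem_image.mpr ⟨j, mem_univ _, hj⟩) hT
      rw [this]; simp
  rw [hS, Fintype.card_piFinset]
  push_cast
  simp_rw [hcard]
  have h1 : ∏ T : Finset (Fin n), (if T ∈ D then (k : ℝ) else 1) = (k : ℝ) ^ k := by
    rw [prod_ite_mem]; simp [hD]
  nth_rw 1 [← h1]
  rw [← prod_mul_distrib]
  rw [prod_congr (g := fun _ => (k : ℝ)) rfl fun T _ => by split_ifs <;> simp]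
  simp

lemma sum_card_inter_layered (hk : 0 < k) (K : Finset (Finset (Fin n)))
    (hK : ∀ e ∈ K, #e = k) :
    ∑ c : Finset (Fin n) → Fin k, (#(K ∩ layeredEdges c) : ℝ)
      = ((k : ℝ) ^ k)⁻¹ * #K * Fintype.card (Finset (Fin n) → Fin k) := by
  have h1 : ∀ c : Finset (Fin n) → Fin k, (#(K ∩ layeredEdges c) : ℝ)
      = ∑ e ∈ K, if ∀ j : Fin k, c (dropRank e j) = j then (1 : ℝ) else 0 := by
    intro c
    rw [sum_boole]
    congr 2
    ext e
    simp only [layeredEdges, mem_inter, mem_filter, mem_powersetCard, subset_univ, true_and]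
    exact ⟨fun h => ⟨h.1, h.2.2⟩, fun h => ⟨h.1, hK e h.1, h.2⟩⟩
  simp_rw [h1]
  rw [sum_comm]
  have h2 : ∀ e ∈ K, ∑ c : Finset (Fin n) → Fin k,
      (if ∀ j : Fin k, c (dropRank e j) = j then (1 : ℝ) else 0)
        = ((k : ℝ) ^ k)⁻¹ * Fintype.card (Finset (Fin n) → Fin k) := by
    intro e he
    rw [sum_boole, ← card_filter_layered e (hK e he)]
    field_simp
  rw [sum_congr rfl h2, sum_const, nsmul_eq_mul]
  ring

/-- Changing the colour of one set `T` affects at most `n` edges, and none unless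
`T` has `k - 1` elements. -/
lemma abs_card_inter_layered_update (K : Finset (Finset (Fin n)))
    (T : Finset (Fin n)) (c : Finset (Fin n) → Fin k) (a : Fin k) :
    |(#(K ∩ layeredEdges (Function.update c T a)) : ℝ) - #(K ∩ layeredEdges c)|
      ≤ if #T = k - 1 then (n : ℝ) else 0 := by
  let N : Finset (Finset (Fin n)) := if #T = k - 1 then univ.image fun v => insert v T else ∅
  have hN : (#N : ℝ) ≤ if #T = k - 1 then (n : ℝ) else 0 := by
    simp only [N]
    split_ifs
    · have := card_image_le (s := (univ : Finset (Fin n))) (f := fun v => insert v T)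
      simp only [card_univ, Fintype.card_fin] at this
      exact_mod_cast this
    · simp
  have key : ∀ c c' : Finset (Fin n) → Fin k, (∀ S, S ≠ T → c S = c' S) →
      (#(K ∩ layeredEdges c) : ℝ) ≤ #(K ∩ layeredEdges c') + #N := by
    intro c c' hcc
    have hsub : K ∩ layeredEdges c ⊆ (K ∩ layeredEdges c') ∪ N := by
      intro e he
      simp only [layeredEdges, mem_inter, mem_filter, mem_powersetCard, subset_univ,
        true_and] at he
      obtain ⟨heK, hek, hec⟩ := he
      by_cases h : ∃ j : Fin k, dropRank e j = T
      · obtain ⟨j, hj⟩ := h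
        refine mem_union_right _ ?_
        have hje : (j : ℕ) < #e := by rw [hek]; exact j.2
        have hT : #T = k - 1 := by rw [← hj, card_dropRank hje, hek]
        obtain ⟨v, hv, hvj⟩ := exists_rankIn_eq hje
        simp only [N, hT, if_true, mem_image, mem_univ, true_and]
        refine ⟨v, ?_⟩
        rw [← hj, ← hvj, dropRank_eq_erase hv, insert_erase hv]
      · push Not at h
        refine mem_union_left _ ?_
        simp only [layeredEdges, mem_inter, mem_filter, mem_powersetCard, subset_univ, true_and]
        exact ⟨heK, hek, fun j => by rw [← hcc _ (h j)]; exact hec j⟩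
    calc (#(K ∩ layeredEdges c) : ℝ) ≤ #((K ∩ layeredEdges c') ∪ N) := by
          exact_mod_cast card_le_card hsub
      _ ≤ _ := by exact_mod_cast card_union_le _ _
  refine le_trans ?_ hN
  rw [abs_le]
  constructor
  · have := key c (Function.update c T a) (fun S hS => by simp [hS])
    linarith
  · have := key (Function.update c T a) c (fun S hS => by simp [hS])
    linarith

/-- Few colourings give few edges in a fixed family `K` of `k`-sets. -/
lemma card_sparse_layered_le (hk : 0 < k) (hn : 0 < n) (K : Finset (Finset (Fin n)))
    (hK : ∀ e ∈ K, #e = k) {μ : ℝ} (hμ : 0 < μ) :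
    (#{c : Finset (Fin n) → Fin k | (#(K ∩ layeredEdges c) : ℝ)
        < ((k : ℝ) ^ k)⁻¹ * #K - μ * (n : ℝ) ^ k} : ℝ)
      ≤ Fintype.card (Finset (Fin n) → Fin k)
        * Real.exp (- (μ ^ 2 * (n : ℝ) ^ (k - 1) / 2)) := by
  have : Nonempty (Fin k) := ⟨⟨0, hk⟩⟩
  have hnR : (0 : ℝ) < n := by exact_mod_cast hn
  set p : ℝ := ((k : ℝ) ^ k)⁻¹ * #K with hp
  set lam : ℝ := μ / n with hlam
  have hlampos : 0 < lam := by positivity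
  set Cc : ℝ := ((Fintype.card (Finset (Fin n) → Fin k) : ℕ) : ℝ) with hCc
  have hmgf := sum_exp_le_of_bounded_differences
    (fun c : Finset (Fin n) → Fin k => lam * (p - #(K ∩ layeredEdges c)))
    (fun T => lam * if #T = k - 1 then (n : ℝ) else 0)
    (fun T => by split_ifs <;> positivity)
    (fun T c a => by
      have := abs_card_inter_layered_update K T c a
      rw [← mul_sub, abs_mul, abs_of_pos hlampos]
      refine mul_le_mul_of_nonneg_left ?_ hlampos.le
      rw [sub_sub_sub_cancel_left, abs_sub_comm]
      exact this)
    (by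
      rw [← mul_sum, sum_sub_distrib, sum_card_inter_layered hk K hK, sum_const, card_univ,
        nsmul_eq_mul]
      rw [hp]; ring)
  have hsum : ∑ T : Finset (Fin n), (lam * if #T = k - 1 then (n : ℝ) else 0) ^ 2
      ≤ μ ^ 2 * (n : ℝ) ^ (k - 1) := by
    have : ∀ T : Finset (Fin n), (lam * if #T = k - 1 then (n : ℝ) else 0) ^ 2
        = if #T = k - 1 then μ ^ 2 else 0 := by
      intro T
      split_ifs
      · rw [hlam]; field_simp
      · simp
    simp_rw [this]
    rw [← sum_filter, sum_const, nsmul_eq_mul, mul_comm]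
    gcongr
    have h3 : ({T : Finset (Fin n) | #T = k - 1} : Finset _) = powersetCard (k - 1) univ := by
      ext; simp [mem_powersetCard]
    rw [h3, card_powersetCard, card_univ, Fintype.card_fin]
    exact_mod_cast Nat.choose_le_pow n (k - 1)
  set B := ({c : Finset (Fin n) → Fin k | (#(K ∩ layeredEdges c) : ℝ)
        < p - μ * (n : ℝ) ^ k} : Finset _) with hB
  have hpow : lam * (μ * (n : ℝ) ^ k) = μ ^ 2 * (n : ℝ) ^ (k - 1) := by
    obtain ⟨k', rfl⟩ := Nat.exists_eq_succ_of_ne_zero hk.ne'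
    rw [hlam, Nat.succ_sub_one, pow_succ]; field_simp
  have hmarkov : (#B : ℝ) * Real.exp (μ ^ 2 * (n : ℝ) ^ (k - 1))
      ≤ ∑ c : Finset (Fin n) → Fin k, Real.exp (lam * (p - #(K ∩ layeredEdges c))) := by
    rw [← nsmul_eq_mul, ← sum_const]
    refine (sum_le_sum fun c hc => ?_).trans
      (sum_le_sum_of_subset_of_nonneg (subset_univ B) fun _ _ _ => (Real.exp_pos _).le)
    rw [Real.exp_le_exp, ← hpow]
    refine mul_le_mul_of_nonneg_left ?_ hlampos.le
    have := (mem_filter.mp hc).2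
    linarith
  have hfin : (#B : ℝ) * Real.exp (μ ^ 2 * (n : ℝ) ^ (k - 1))
      ≤ Cc * Real.exp (μ ^ 2 * (n : ℝ) ^ (k - 1) / 2) := by
    refine hmarkov.trans (hmgf.trans ?_)
    gcongr
  have he : Real.exp (- (μ ^ 2 * (n : ℝ) ^ (k - 1) / 2))
      = Real.exp (μ ^ 2 * (n : ℝ) ^ (k - 1) / 2) / Real.exp (μ ^ 2 * (n : ℝ) ^ (k - 1)) := by
    rw [← Real.exp_sub]; congr 1; ring
  rw [he, ← mul_div_assoc, le_div_iff₀ (Real.exp_pos _)]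
  exact hfin

/-- For large `n` some colouring yields a dense hypergraph. -/
lemma exists_isDense_layered (hk : 2 ≤ k) {μ : ℝ} (hμ : 0 < μ) (n₀ : ℕ) :
    ∃ n, n₀ ≤ n ∧ ∃ c : Finset (Fin n) → Fin k,
      IsDense k (k - 2) n ((k : ℝ) ^ k)⁻¹ μ (layeredEdges c) := by
  obtain ⟨m, hm⟩ := exists_nat_gt (2 / μ ^ 2)
  refine ⟨max n₀ (m + 1), le_max_left _ _, ?_⟩
  set n := max n₀ (m + 1) with hn
  have hn0 : 0 < n := lt_of_lt_of_le (Nat.succ_pos m) (le_max_right _ _)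
  have hmn : (m : ℝ) ≤ n := by exact_mod_cast (Nat.le_succ m).trans (le_max_right n₀ (m + 1))
  by_contra hcon
  push Not at hcon
  let 𝒢 : Finset (Finset (Finset (Fin n))) := (powersetCard (k - 2) univ).powerset
  let Bad : Finset (Finset (Fin n)) → Finset (Finset (Fin n) → Fin k) := fun G =>
    {c | (#(cliqueSet k (k - 2) n G ∩ layeredEdges c) : ℝ)
        < ((k : ℝ) ^ k)⁻¹ * #(cliqueSet k (k - 2) n G) - μ * (n : ℝ) ^ k}
  have hcover : (univ : Finset (Finset (Fin n) → Fin k)) ⊆ 𝒢.biUnion Bad := by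
    intro c _
    have := hcon c
    rw [IsDense] at this
    push Not at this
    obtain ⟨G, hG, hlt⟩ := this
    refine mem_biUnion.mpr ⟨G, ?_, by simpa [Bad] using hlt⟩
    exact mem_powerset.mpr fun s hs => mem_powersetCard.mpr ⟨subset_univ _, hG s hs⟩
  set Cc : ℝ := ((Fintype.card (Finset (Fin n) → Fin k) : ℕ) : ℝ) with hCc
  have : Nonempty (Fin k) := ⟨⟨0, by omega⟩⟩
  have hCpos : 0 < Cc := by rw [hCc]; exact_mod_cast Fintype.card_pos
  have hle : Cc ≤ #𝒢 * (Cc * Real.exp (- (μ ^ 2 * (n : ℝ) ^ (k - 1) / 2))) := by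
    calc Cc = #(univ : Finset (Finset (Fin n) → Fin k)) := by rw [hCc, card_univ]
      _ ≤ #(𝒢.biUnion Bad) := by exact_mod_cast card_le_card hcover
      _ ≤ ∑ G ∈ 𝒢, (#(Bad G) : ℝ) := by exact_mod_cast card_biUnion_le
      _ ≤ ∑ G ∈ 𝒢, Cc * Real.exp (- (μ ^ 2 * (n : ℝ) ^ (k - 1) / 2)) := by
          refine sum_le_sum fun G _ => ?_
          refine card_sparse_layered_le (by omega) hn0 _ (fun e he => ?_) hμ
          exact (mem_powersetCard.mp (mem_filter.mp he).1).2
      _ = _ := by rw [sum_const, nsmul_eq_mul]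
  have hG : (#𝒢 : ℝ) ≤ Real.exp ((n : ℝ) ^ (k - 2)) := by
    have h1 : #𝒢 = 2 ^ (n.choose (k - 2)) := by
      simp only [𝒢, card_powerset, card_powersetCard, card_univ, Fintype.card_fin]
    have h2 : #𝒢 ≤ 2 ^ (n ^ (k - 2)) := by
      rw [h1]; exact Nat.pow_le_pow_right (by norm_num) (Nat.choose_le_pow n (k - 2))
    calc (#𝒢 : ℝ) ≤ (2 : ℝ) ^ (n ^ (k - 2)) := by exact_mod_cast h2
      _ ≤ (Real.exp 1) ^ (n ^ (k - 2)) := by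
          gcongr
          have := Real.add_one_le_exp (1 : ℝ)
          linarith
      _ = _ := by rw [← Real.exp_nat_mul]; simp
  have hlt : (#𝒢 : ℝ) * Real.exp (- (μ ^ 2 * (n : ℝ) ^ (k - 1) / 2)) < 1 := by
    calc (#𝒢 : ℝ) * Real.exp (- (μ ^ 2 * (n : ℝ) ^ (k - 1) / 2))
        ≤ Real.exp ((n : ℝ) ^ (k - 2)) * Real.exp (- (μ ^ 2 * (n : ℝ) ^ (k - 1) / 2)) := by
          gcongr
      _ = Real.exp ((n : ℝ) ^ (k - 2) - μ ^ 2 * (n : ℝ) ^ (k - 1) / 2) := by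
          rw [← Real.exp_add]; rfl
      _ < 1 := by
          rw [Real.exp_lt_one_iff]
          have h1 : (n : ℝ) ^ (k - 1) = n ^ (k - 2) * n := by
            rw [← pow_succ]; congr 1; omega
          rw [h1]
          have h2 : 2 < μ ^ 2 * n := by
            rw [div_lt_iff₀ (by positivity)] at hm
            nlinarith [sq_nonneg μ]
          have h3 : (0 : ℝ) < (n : ℝ) ^ (k - 2) := by positivity
          nlinarith
  nlinarith
end construction

end concentration

section sliceMeasures
open Finset MeasureTheory
open scoped ENNReal

/-- Ramsey's theorem for two colours on `r`-sets. -/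
theorem finset_ramsey (r : ℕ) : ∀ a b : ℕ, ∃ R : ℕ, ∀ (α : Type) (I : Finset α),
    R ≤ #I → ∀ χ : Finset α → Prop,
      (∃ J ⊆ I, #J = a ∧ ∀ e ∈ powersetCard r J, χ e) ∨
      (∃ J ⊆ I, #J = b ∧ ∀ e ∈ powersetCard r J, ¬ χ e) := by
  induction r with
  | zero =>
    intro a b
    refine ⟨max a b, fun α I hI χ => ?_⟩
    by_cases h : χ ∅
    · obtain ⟨J, hJ, hc⟩ := exists_subset_card_eq (le_trans (le_max_left a b) hI)
      exact Or.inl ⟨J, hJ, hc, fun e he => by simp at he; simpa [he] using h⟩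
    · obtain ⟨J, hJ, hc⟩ := exists_subset_card_eq (le_trans (le_max_right a b) hI)
      exact Or.inr ⟨J, hJ, hc, fun e he => by simp at he; simpa [he] using h⟩
  | succ r ih =>
    have insert_case : ∀ {α : Type} (I J A : Finset α) (v : α) (P : Finset α → Prop),
        v ∈ I → J ⊆ I.erase v → A ⊆ J → (∀ e ∈ powersetCard r J, P (insert v e)) →
        (∀ e ∈ powersetCard (r + 1) A, P e) →
        insert v A ⊆ I ∧ #(insert v A) = #A + 1 ∧
          ∀ e ∈ powersetCard (r + 1) (insert v A), P e := by
      intro α I J A v P hv hJ hA h1 h2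
      have hvA : v ∉ A := fun h => by simpa using hJ (hA h)
      refine ⟨insert_subset hv (hA.trans (hJ.trans (erase_subset _ _))),
        card_insert_of_notMem hvA, fun e he => ?_⟩
      rw [powersetCard_succ_insert hvA] at he
      rcases mem_union.mp he with he | he
      · exact h2 e he
      · obtain ⟨e', he', rfl⟩ := mem_image.mp he
        exact h1 e' (powersetCard_mono hA he')
    intro a
    induction a with
    | zero => exact fun b => ⟨0, fun α I _ χ => Or.inl ⟨∅, by simp, by simp, by simp⟩⟩
    | succ a iha =>
      intro b
      induction b with
      | zero => exact ⟨0, fun α I _ χ => Or.inr ⟨∅, by simp, by simp, by simp⟩⟩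
      | succ b ihb =>
        obtain ⟨R₁, hR₁⟩ := iha (b + 1)
        obtain ⟨R₂, hR₂⟩ := ihb
        obtain ⟨R, hR⟩ := ih R₁ R₂
        refine ⟨R + 1, fun α I hI χ => ?_⟩
        obtain ⟨v, hv⟩ : I.Nonempty := card_pos.mp (by omega)
        have hcard : R ≤ #(I.erase v) := by rw [card_erase_of_mem hv]; omega
        rcases hR α (I.erase v) hcard (fun e => χ (insert v e)) with
          ⟨J, hJ, hJc, hχ⟩ | ⟨J, hJ, hJc, hχ⟩
        · rcases hR₁ α J hJc.ge χ with ⟨A, hA, hAc, h⟩ | ⟨A, hA, hAc, h⟩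
          · obtain ⟨h1, h2, h3⟩ := insert_case I J A v χ hv hJ hA hχ h
            exact Or.inl ⟨_, h1, by rw [h2, hAc], h3⟩
          · exact Or.inr ⟨A, hA.trans (hJ.trans (erase_subset _ _)), hAc, h⟩
        · rcases hR₂ α J hJc.ge χ with ⟨A, hA, hAc, h⟩ | ⟨A, hA, hAc, h⟩
          · exact Or.inl ⟨A, hA.trans (hJ.trans (erase_subset _ _)), hAc, h⟩
          · obtain ⟨h1, h2, h3⟩ := insert_case I J A v (fun e => ¬ χ e) hv hJ hA hχ h
            exact Or.inr ⟨_, h1, by rw [h2, hAc], h3⟩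

section rank
variable {α : Type*} [LinearOrder α]

lemma rankIn_union {T Q : Finset α} (h : Disjoint T Q) (v : α) :
    rankIn (T ∪ Q) v = rankIn T v + rankIn Q v := by
  rw [rankIn, filter_union, card_union_of_disjoint (disjoint_filter_filter h)]
  rfl

lemma rankIn_mono (e : Finset α) {u v : α} (h : u ≤ v) : rankIn e u ≤ rankIn e v :=
  card_le_card fun _ hw => mem_filter.mpr
    ⟨(mem_filter.mp hw).1, (mem_filter.mp hw).2.trans_le h⟩

/-- If all of `Q` lies in the gap of `T` at rank `j`, then `Q` is recovered from `T ∪ Q` by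
looking at ranks. -/
lemma filter_rankIn_union {T Q : Finset α} {j : ℕ} (hd : Disjoint T Q)
    (hQ : ∀ v ∈ Q, rankIn T v = j) :
    ({v ∈ T ∪ Q | j ≤ rankIn (T ∪ Q) v ∧ rankIn (T ∪ Q) v < j + #Q} : Finset α) = Q := by
  ext v
  rw [mem_filter, mem_union, rankIn_union hd]
  constructor
  · rintro ⟨hv | hv, h1, h2⟩
    · exfalso
      by_cases hlt : rankIn T v < j
      · have : rankIn Q v = 0 := by
          refine card_eq_zero.mpr (filter_eq_empty_iff.mpr fun w hw hwv => ?_)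
          have := rankIn_mono T hwv.le
          rw [hQ w hw] at this
          omega
        omega
      · have : rankIn Q v = #Q := by
          rw [rankIn, filter_true_of_mem]
          intro w hw
          by_contra hwv
          have hvw : v < w := lt_of_le_of_ne (not_lt.mp hwv)
            fun h => disjoint_left.mp hd hv (h ▸ hw)
          have := rankIn_lt_rankIn hv hvw
          rw [hQ w hw] at this
          omega
        omega
    · exact hv
  · intro hv
    have := rankIn_lt_card hv
    have := hQ v hv
    exact ⟨Or.inr hv, by omega, by omega⟩

lemma rankIn_insert_self (T : Finset α) (v : α) : rankIn (insert v T) v = rankIn T v := by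
  rw [rankIn, filter_insert, if_neg (lt_irrefl v)]; rfl

lemma dropRank_insert {T : Finset α} {v : α} (hv : v ∉ T) :
    dropRank (insert v T) (rankIn T v) = T := by
  rw [← rankIn_insert_self, dropRank_eq_erase (mem_insert_self v T), erase_insert hv]

end rank

/-- If all `q`-fold intersections of events of measure at least `δ` are null, there are few
events. -/
lemma card_mul_le_of_inter_null {ι Ω : Type*} [MeasurableSpace Ω] (ν : Measure Ω)
    [IsProbabilityMeasure ν] (S : Finset ι) (B : ι → Set Ω) (hB : ∀ v, MeasurableSet (B v))
    {δ : ℝ≥0∞} (hδ : ∀ v ∈ S, δ ≤ ν (B v)) {q : ℕ}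
    (hnull : ∀ Q ∈ powersetCard q S, ν (⋂ v ∈ Q, B v) = 0) :
    (#S : ℝ≥0∞) * δ ≤ q := by
  have hae : ∀ᵐ x ∂ν, ∀ Q ∈ powersetCard q S, x ∉ ⋂ v ∈ Q, B v := by
    rw [Filter.eventually_all_finset]
    exact fun Q hQ => measure_eq_zero_iff_ae_notMem.mp (hnull Q hQ)
  calc (#S : ℝ≥0∞) * δ = ∑ _v ∈ S, δ := by rw [sum_const, nsmul_eq_mul]
    _ ≤ ∑ v ∈ S, ν (B v) := sum_le_sum hδ
    _ = ∑ v ∈ S, ∫⁻ x, (B v).indicator 1 x ∂ν := by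
        refine sum_congr rfl fun v _ => (lintegral_indicator_one (hB v)).symm
    _ = ∫⁻ x, ∑ v ∈ S, (B v).indicator 1 x ∂ν :=
        (lintegral_finsetSum _ fun v _ => measurable_one.indicator (hB v)).symm
    _ ≤ ∫⁻ _x, (q : ℝ≥0∞) ∂ν := by
        refine lintegral_mono_ae ?_
        filter_upwards [hae] with x hx
        have h1 : ∑ v ∈ S, (B v).indicator (1 : Ω → ℝ≥0∞) x = #{v ∈ S | x ∈ B v} := by
          rw [card_filter]
          push_cast
          refine sum_congr rfl fun v _ => ?_
          simp [Set.indicator_apply]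
        rw [h1]
        by_contra hcon
        have hq : q ≤ #{v ∈ S | x ∈ B v} := by
          have := not_le.mp hcon
          exact_mod_cast this.le
        obtain ⟨Q, hQ, hc⟩ := exists_subset_card_eq hq
        refine hx Q (mem_powersetCard.mpr ⟨hQ.trans (filter_subset _ _), hc⟩) ?_
        exact Set.mem_iInter₂.mpr fun v hv => (mem_filter.mp (hQ hv)).2
    _ = q := by simp

/-- Within a large homogeneous set `H`, a spaced subset all of whose `r`-subsets have at least
`q` elements of `H` in their gap at rank `j`. -/
lemma exists_spaced_subset {α : Type*} [LinearOrder α] (r j m q : ℕ) (hj : j ≤ r)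
    (H : Finset α) (hH : #H = (m + 1) * (q + 1)) :
    ∃ I' ⊆ H, #I' = m ∧ ∀ T ∈ powersetCard r I',
      q ≤ #{v ∈ H | v ∉ T ∧ rankIn T v = j} := by
  let h : Fin ((m + 1) * (q + 1)) ↪o α := H.orderEmbOfFin hH
  have hmem : ∀ i, h i ∈ H := fun i => orderEmbOfFin_mem H hH i
  have hidx : ∀ i s : ℕ, i < m → s ≤ q → i * (q + 1) + q + s < (m + 1) * (q + 1) := by
    intro i s hi hs
    have : (i + 1) * (q + 1) ≤ m * (q + 1) := Nat.mul_le_mul_right _ hi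
    nlinarith
  let g : Fin m → α := fun i => h ⟨i * (q + 1) + q, hidx i 0 i.2 (Nat.zero_le _)⟩
  have hginj : Function.Injective g := by
    intro a b hab
    have h1 := congrArg Fin.val (h.injective hab)
    simp only [Nat.add_right_cancel_iff] at h1
    exact Fin.ext (Nat.eq_of_mul_eq_mul_right (Nat.succ_pos q) h1)
  refine ⟨univ.image g, fun x hx => ?_, ?_, fun T hT => ?_⟩
  · obtain ⟨i, -, rfl⟩ := mem_image.mp hx
    exact hmem _
  · rw [card_image_of_injective _ hginj]; simp
  obtain ⟨hTI, hTc⟩ := mem_powersetCard.mp hT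
  have hTg : ∀ u ∈ T, ∃ i : Fin m, g i = u := fun u hu => by simpa using hTI hu
  -- it suffices to produce `q` consecutive elements of `H` in the gap
  suffices hs : ∃ b : ℕ, ∃ hb : ∀ s : Fin q, b + s < (m + 1) * (q + 1),
      ∀ s : Fin q, h ⟨b + s, hb s⟩ ∉ T ∧ rankIn T (h ⟨b + s, hb s⟩) = j by
    obtain ⟨b, hb, hs⟩ := hs
    calc q = #((univ : Finset (Fin q)).image fun s : Fin q => h ⟨b + s, hb s⟩) := by
          rw [card_image_of_injective]
          · simp
          · intro s t hst
            have h1 := congrArg Fin.val (h.injective hst)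
            exact Fin.ext (by simpa using h1)
      _ ≤ _ := by
          refine card_le_card fun x hx => ?_
          obtain ⟨s, -, rfl⟩ := mem_image.mp hx
          exact mem_filter.mpr ⟨hmem _, hs s⟩
  rcases Nat.eq_zero_or_pos j with rfl | hjpos
  · refine ⟨0, fun s => by have := s.2; nlinarith, fun s => ?_⟩
    have key : ∀ u ∈ T, h ⟨0 + s, by have := s.2; nlinarith⟩ < u := by
      intro u hu
      obtain ⟨i, rfl⟩ := hTg u hu
      refine h.strictMono (Fin.mk_lt_mk.mpr ?_)
      have := s.2
      nlinarith [Nat.zero_le (i * (q + 1))]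
    refine ⟨fun hT' => lt_irrefl _ (key _ hT'), ?_⟩
    exact card_eq_zero.mpr (filter_eq_empty_iff.mpr fun u hu => (key u hu).le.not_gt)
  · obtain ⟨t, ht, htr⟩ := exists_rankIn_eq (e := T) (j := j - 1) (by omega)
    obtain ⟨i, rfl⟩ := hTg t ht
    have hb : ∀ s : Fin q, i * (q + 1) + q + 1 + s < (m + 1) * (q + 1) := fun s => by
      have := hidx i (s + 1) i.2 (by omega)
      omega
    refine ⟨i * (q + 1) + q + 1, hb, fun s => ?_⟩
    have hle : ∀ i' : Fin m, g i' ≤ g i ∨ h ⟨i * (q + 1) + q + 1 + s, hb s⟩ < g i' := by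
      intro i'
      rcases le_or_gt i' i with hi | hi
      · left
        refine h.monotone (Fin.mk_le_mk.mpr ?_)
        have : (i' : ℕ) * (q + 1) ≤ i * (q + 1) := Nat.mul_le_mul_right _ hi
        omega
      · right
        refine h.strictMono (Fin.mk_lt_mk.mpr ?_)
        have : ((i : ℕ) + 1) * (q + 1) ≤ i' * (q + 1) := Nat.mul_le_mul_right _ hi
        have := s.2
        nlinarith
    have hlt : g i < h ⟨i * (q + 1) + q + 1 + s, hb s⟩ :=
      h.strictMono (Fin.mk_lt_mk.mpr (by omega))
    constructor
    · intro hmemT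
      obtain ⟨i', hi'⟩ := hTg _ hmemT
      rcases hle i' with h1 | h1
      · exact absurd (hi' ▸ h1) (not_le.mpr hlt)
      · exact absurd hi' h1.ne'
    · have : ({u ∈ T | u < h ⟨i * (q + 1) + q + 1 + s, hb s⟩} : Finset α)
          = insert (g i) ({u ∈ T | u < g i} : Finset α) := by
        ext u
        simp only [mem_filter, mem_insert]
        constructor
        · rintro ⟨hu, h1⟩
          obtain ⟨i', rfl⟩ := hTg u hu
          rcases hle i' with h2 | h2
          · exact h2.eq_or_lt.imp id fun h3 => ⟨hu, h3⟩
          · exact absurd h1 h2.not_gt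
        · rintro (rfl | ⟨hu, h1⟩)
          · exact ⟨ht, hlt⟩
          · exact ⟨hu, h1.trans hlt⟩
      have hcard : #{u ∈ T | u < g i} = j - 1 := htr
      rw [rankIn, this, card_insert_of_notMem (by simp), hcard]
      omega

/-- A set of `r + L` elements contains an `r`-set with at least `L` elements in its gap at
rank `j`. -/
lemma exists_wide_gap {α : Type*} [LinearOrder α] (r j L : ℕ) (hj : j ≤ r)
    (H : Finset α) (hH : #H = r + L) :
    ∃ T ∈ powersetCard r H, #{v ∈ H | v ∉ T ∧ rankIn T v = j} = L := by
  let S : Finset α := {v ∈ H | j ≤ rankIn H v ∧ rankIn H v < j + L}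
  have himg : H.image (rankIn H) = range (r + L) := by
    refine eq_of_subset_of_card_le (fun i hi => ?_) ?_
    · obtain ⟨v, hv, rfl⟩ := mem_image.mp hi
      exact mem_range.mpr (hH ▸ rankIn_lt_card hv)
    · rw [card_range, card_image_of_injOn (rankIn_injOn H), hH]
  have hcount : ∀ (p : ℕ → Prop) [DecidablePred p], #{v ∈ H | p (rankIn H v)}
      = #{i ∈ range (r + L) | p i} := by
    intro p _
    rw [← himg, filter_image, card_image_of_injOn]
    exact (rankIn_injOn H).mono (filter_subset _ _)
  have hS : #S = L := by
    rw [show #S = _ from hcount fun i => j ≤ i ∧ i < j + L]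
    have : ({i ∈ range (r + L) | j ≤ i ∧ i < j + L} : Finset ℕ) = Ico j (j + L) := by
      ext i; simp only [mem_filter, mem_range, mem_Ico]; omega
    rw [this]; simp
  refine ⟨H \ S, mem_powersetCard.mpr ⟨sdiff_subset, ?_⟩, ?_⟩
  · rw [card_sdiff_of_subset (filter_subset _ _), hS, hH]; omega
  · have : ({v ∈ H | v ∉ H \ S ∧ rankIn (H \ S) v = j} : Finset α) = S := by
      ext v
      simp only [mem_filter, mem_sdiff, not_and, not_not]
      constructor
      · rintro ⟨hv, h, -⟩
        exact h hv
      · intro hv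
        have hvH : v ∈ H := (mem_filter.mp hv).1
        refine ⟨hvH, fun _ => hv, ?_⟩
        have h2 := (mem_filter.mp hv).2
        have : ({u ∈ H \ S | u < v} : Finset α) = {u ∈ H | rankIn H u < j} := by
          ext u
          simp only [mem_filter, mem_sdiff, S, not_and, not_lt]
          constructor
          · rintro ⟨⟨hu, h3⟩, h4⟩
            refine ⟨hu, ?_⟩
            by_contra h5
            have := rankIn_lt_rankIn hu h4
            have := h3 hu (not_lt.mp h5)
            omega
          · rintro ⟨hu, h3⟩
            refine ⟨⟨hu, fun _ h4 => by omega⟩, ?_⟩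
            by_contra h5
            have := rankIn_mono H (not_lt.mp h5)
            omega
        rw [rankIn, this, hcount fun i => i < j]
        have : ({i ∈ range (r + L) | i < j} : Finset ℕ) = range j := by
          ext i; simp only [mem_filter, mem_range]; omega
        rw [this]; simp
    rw [this, hS]

/-- Given events `B e` of measure bounded below, indexed by `(r + 1)`-sets, on spaces indexed by
their subsets missing the element of rank `j`, there is a large index set on which all
events living on a common space intersect in positive measure. -/
lemma exists_inter_pos (r j m : ℕ) (hj : j ≤ r) {δ : ℝ≥0∞} (hδ : δ ≠ 0) :
    ∃ M : ℕ, ∀ (R : ℕ) (I : Finset (Fin R)), M ≤ #I →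
      ∀ (Ω : Type) [MeasurableSpace Ω] (ν : Finset (Fin R) → Measure Ω)
        [∀ T, IsProbabilityMeasure (ν T)] (B : Finset (Fin R) → Set Ω),
        (∀ e, MeasurableSet (B e)) →
        (∀ e ∈ powersetCard (r + 1) I, δ ≤ ν (dropRank e j) (B e)) →
        ∃ I' ⊆ I, #I' = m ∧ ∀ T ∈ powersetCard r I',
          0 < ν T (⋂ e ∈ ({e ∈ powersetCard (r + 1) I' | dropRank e j = T} : Finset _), B e) := by
  obtain ⟨L, hL⟩ := ENNReal.exists_nat_mul_gt hδ (ENNReal.natCast_ne_top m)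
  obtain ⟨M, hM⟩ := finset_ramsey (r + m) ((m + 1) * (m + 1)) (r + L)
  refine ⟨M, fun R I hI Ω _ ν _ B hB hδB => ?_⟩
  let mid : Finset (Fin R) → Finset (Fin R) := fun J =>
    {v ∈ J | j ≤ rankIn J v ∧ rankIn J v < j + m}
  have hmid : ∀ T Q : Finset (Fin R), #Q = m → (∀ v ∈ Q, v ∉ T ∧ rankIn T v = j) →
      mid (T ∪ Q) = Q ∧ (T ∪ Q) \ Q = T := by
    intro T Q hQ h
    have hd : Disjoint T Q := disjoint_right.mpr fun v hv => (h v hv).1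
    refine ⟨?_, union_sdiff_cancel_right hd⟩
    have := filter_rankIn_union hd fun v hv => (h v hv).2
    rwa [hQ] at this
  let χ : Finset (Fin R) → Prop := fun J =>
    0 < ν (J \ mid J) (⋂ v ∈ mid J, B (insert v (J \ mid J)))
  rcases hM (Fin R) I hI χ with ⟨H, hHI, hHc, hχ⟩ | ⟨H, hHI, hHc, hχ⟩
  · obtain ⟨I', hI'H, hI'c, hgap⟩ := exists_spaced_subset r j m m hj H hHc
    refine ⟨I', hI'H.trans hHI, hI'c, fun T hT => ?_⟩
    obtain ⟨hTI, hTc⟩ := mem_powersetCard.mp hT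
    let W : Finset (Fin R) := {v ∈ I' | v ∉ T ∧ rankIn T v = j}
    obtain ⟨Q, hWQ, hQ, hQc⟩ := exists_subsuperset_card_eq
      (s := W) (t := {v ∈ H | v ∉ T ∧ rankIn T v = j}) (n := m)
      (fun v hv => mem_filter.mpr ⟨hI'H (mem_filter.mp hv).1, (mem_filter.mp hv).2⟩)
      ((card_le_card (filter_subset _ _)).trans hI'c.le) (hgap T hT)
    obtain ⟨h1, h2⟩ := hmid T Q hQc fun v hv => (mem_filter.mp (hQ hv)).2
    have hpos := hχ (T ∪ Q) (mem_powersetCard.mpr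
      ⟨union_subset (hTI.trans hI'H) (hQ.trans (filter_subset _ _)), by
        rw [card_union_of_disjoint, hTc, hQc]
        exact disjoint_right.mpr fun v hv => (mem_filter.mp (hQ hv)).2.1⟩)
    simp only [χ, h1, h2] at hpos
    refine hpos.trans_le (measure_mono fun x hx => ?_)
    refine Set.mem_iInter₂.mpr fun e he => ?_
    obtain ⟨he, hdrop⟩ := mem_filter.mp he
    obtain ⟨heI, hec⟩ := mem_powersetCard.mp he
    obtain ⟨v, hv, hvj⟩ := exists_rankIn_eq (e := e) (j := j) (by omega)
    have hTe : T = e.erase v := by rw [← hdrop, ← hvj, dropRank_eq_erase hv]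
    have hins : insert v T = e := by rw [hTe, insert_erase hv]
    have hvQ : v ∈ Q := hWQ (mem_filter.mpr ⟨heI hv, by rw [hTe]; simp, by
      rw [← rankIn_insert_self, hins, hvj]⟩)
    have := Set.mem_iInter₂.mp hx v hvQ
    rwa [hins] at this
  · exfalso
    obtain ⟨T, hT, hgap⟩ := exists_wide_gap r j L hj H hHc
    obtain ⟨hTH, hTc⟩ := mem_powersetCard.mp hT
    set S : Finset (Fin R) := {v ∈ H | v ∉ T ∧ rankIn T v = j} with hS
    have := card_mul_le_of_inter_null (ν T) S (fun v => B (insert v T)) (fun v => hB _)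
      (δ := δ) (q := m)
      (fun v hv => by
        obtain ⟨hvH, hvT, hvj⟩ := mem_filter.mp hv
        have := hδB (insert v T) (mem_powersetCard.mpr
          ⟨insert_subset (hHI hvH) (hTH.trans hHI), by rw [card_insert_of_notMem hvT, hTc]⟩)
        rwa [← hvj, dropRank_insert hvT] at this)
      (fun Q hQ => by
        obtain ⟨hQS, hQc⟩ := mem_powersetCard.mp hQ
        obtain ⟨h1, h2⟩ := hmid T Q hQc fun v hv => (mem_filter.mp (hQS hv)).2
        have hneg := hχ (T ∪ Q) (mem_powersetCard.mpr
          ⟨union_subset hTH (hQS.trans (filter_subset _ _)), by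
            rw [card_union_of_disjoint, hTc, hQc]
            exact disjoint_right.mpr fun v hv => (mem_filter.mp (hQS hv)).2.1⟩)
        simpa only [χ, h1, h2, not_lt, nonpos_iff_eq_zero] using hneg)
    rw [hgap] at this
    exact absurd hL (not_lt.mpr this)

section slices
variable {n : ℕ} {Ω : Type*} [MeasurableSpace Ω]

lemma measurable_fin_cons :
    Measurable fun p : Ω × (Fin n → Ω) => (Fin.cons p.1 p.2 : Fin (n + 1) → Ω) := by
  refine measurable_pi_iff.mpr fun i => ?_
  refine Fin.cases ?_ (fun i => ?_) i
  · simpa using measurable_fst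
  · simpa using measurable_pi_iff.mp measurable_snd i

lemma measurable_pi_slice (μ : Fin n → Measure Ω) [∀ i, IsProbabilityMeasure (μ i)]
    {A : Set (Fin (n + 1) → Ω)} (hA : MeasurableSet A) :
    Measurable fun y => Measure.pi μ {z | (Fin.cons y z : Fin (n + 1) → Ω) ∈ A} :=
  measurable_measure_prodMk_left (measurable_fin_cons hA)

lemma pi_succ_apply (μ : Fin (n + 1) → Measure Ω) [∀ i, IsProbabilityMeasure (μ i)]
    {A : Set (Fin (n + 1) → Ω)} (hA : MeasurableSet A) :
    Measure.pi μ A = ∫⁻ y, Measure.pi (fun i : Fin n => μ i.succ)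
      {z | (Fin.cons y z : Fin (n + 1) → Ω) ∈ A} ∂μ 0 := by
  have h := (measurePreserving_piFinSuccAbove μ 0).symm
  rw [← h.measure_preimage hA.nullMeasurableSet, Measure.prod_apply (h.measurable hA)]
  refine lintegral_congr fun y => ?_
  congr 1
  ext z
  simp [MeasurableEquiv.piFinSuccAbove, Fin.insertNthEquiv]

end slices

/-- Independent copies `ζ i` of a product space can, with positive probability, be fed into the
events `A e` simultaneously for all `k`-subsets `e` of a large index set, the `i`-th
argument of `A e` being the coordinate of `ζ i` at `e` without its element of rank `pos i`. -/
lemma exists_copies_pos (r : ℕ) (N : ℕ) : ∀ (n : ℕ) (pos : Fin n → ℕ), (∀ i, pos i ≤ r) →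
    ∀ {δ : ℝ≥0∞}, δ ≠ 0 → ∃ M : ℕ, ∀ (R : ℕ) (I : Finset (Fin R)), M ≤ #I →
      ∀ (Ω : Type) [MeasurableSpace Ω] (ν : Finset (Fin R) → Measure Ω)
        [∀ T, IsProbabilityMeasure (ν T)] (A : Finset (Fin R) → Set (Fin n → Ω)),
        (∀ e, MeasurableSet (A e)) →
        (∀ e ∈ powersetCard (r + 1) I,
          δ ≤ Measure.pi (fun i => ν (dropRank e (pos i))) (A e)) →
        0 < Measure.pi (fun _ : Fin n => Measure.pi ν)
          {ζ | ∃ I' ∈ powersetCard N I, ∀ e ∈ powersetCard (r + 1) I',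
            (fun i => ζ i (dropRank e (pos i))) ∈ A e} := by
  intro n
  induction n with
  | zero =>
    intro pos _ δ hδ
    refine ⟨N, fun R I hI Ω _ ν _ A _ hAδ => ?_⟩
    obtain ⟨I', hI', hc⟩ := exists_subset_card_eq hI
    have : {ζ : Fin 0 → Finset (Fin R) → Ω | ∃ I' ∈ powersetCard N I,
        ∀ e ∈ powersetCard (r + 1) I', (fun i => ζ i (dropRank e (pos i))) ∈ A e}
          = Set.univ := by
      refine Set.eq_univ_of_forall fun ζ => ⟨I', mem_powersetCard.mpr ⟨hI', hc⟩, fun e he => ?_⟩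
      have hne : (A e).Nonempty := by
        refine nonempty_of_measure_ne_zero (μ := Measure.pi fun i => ν (dropRank e (pos i))) ?_
        have := hAδ e (powersetCard_mono hI' he)
        exact ((pos_iff_ne_zero.mpr hδ).trans_le this).ne'
      obtain ⟨x, hx⟩ := hne
      convert hx
    rw [this, measure_univ]
    exact one_pos
  | succ n ih =>
    intro pos hpos δ hδ
    have hδ2 : δ / 2 ≠ 0 := by simp [hδ]
    obtain ⟨M', hM'⟩ := ih (fun i => pos i.succ) (fun i => hpos _) hδ2
    obtain ⟨M, hM⟩ := exists_inter_pos r (pos 0) M' (hpos 0) hδ2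
    refine ⟨M, fun R I hI Ω _ ν _ A hA hAδ => ?_⟩
    let B : Finset (Fin R) → Set Ω := fun e =>
      {y | δ / 2 ≤ Measure.pi (fun i : Fin n => ν (dropRank e (pos i.succ)))
        {z | (Fin.cons y z : Fin (n + 1) → Ω) ∈ A e}}
    have hB : ∀ e, MeasurableSet (B e) := fun e =>
      measurableSet_le measurable_const (measurable_pi_slice _ (hA e))
    obtain ⟨I', hI'I, hI'c, hI'⟩ := hM R I hI Ω ν B hB fun e he => by
      have h1 := hAδ e he
      rw [pi_succ_apply _ (hA e)] at h1
      set φ : Ω → ℝ≥0∞ := fun y => Measure.pi (fun i : Fin n => ν (dropRank e (pos i.succ)))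
        {z | (Fin.cons y z : Fin (n + 1) → Ω) ∈ A e} with hφ
      have h2 : ∫⁻ y, φ y ∂ν (dropRank e (pos 0))
          ≤ ν (dropRank e (pos 0)) (B e) + δ / 2 := by
        calc ∫⁻ y, φ y ∂ν (dropRank e (pos 0))
            ≤ ∫⁻ y, ((B e).indicator 1 y + δ / 2) ∂ν (dropRank e (pos 0)) := by
              refine lintegral_mono fun y => ?_
              by_cases hy : y ∈ B e
              · rw [Set.indicator_of_mem hy]
                exact le_add_right prob_le_one
              · rw [Set.indicator_of_notMem hy, zero_add]
                exact (not_le.mp hy).le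
          _ = _ := by
              rw [lintegral_add_right _ measurable_const, lintegral_indicator_one (hB e)]
              simp
      have hδtop : δ / 2 ≠ ∞ := by
        refine (ENNReal.div_lt_top ?_ (by norm_num)).ne
        exact ((hAδ e he).trans prob_le_one).trans_lt ENNReal.one_lt_top |>.ne
      have h3 := h1.trans h2
      rw [← ENNReal.add_halves δ] at h3
      exact (ENNReal.add_le_add_iff_right hδtop).mp (by simpa using h3)
    set D : Set (Fin (n + 1) → Finset (Fin R) → Ω) := {ζ | ∃ I' ∈ powersetCard N I,
      ∀ e ∈ powersetCard (r + 1) I', (fun i => ζ i (dropRank e (pos i))) ∈ A e} with hD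
    have hDm : MeasurableSet D := by
      have : D = ⋃ I' ∈ powersetCard N I, ⋂ e ∈ powersetCard (r + 1) I',
          (fun (ζ : Fin (n + 1) → Finset (Fin R) → Ω) i => ζ i (dropRank e (pos i))) ⁻¹' A e := by
        ext ζ; simp [hD]
      rw [this]
      refine Finset.measurableSet_biUnion _ fun I' _ => Finset.measurableSet_biInter _
        fun e _ => ?_
      refine measurableSet_preimage (measurable_pi_iff.mpr fun i => ?_) (hA e)
      exact (measurable_pi_apply _).comp (measurable_pi_apply i)
    let G : Set (Finset (Fin R) → Ω) := Set.univ.pi fun T =>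
      if T ∈ powersetCard r I' then
        ⋂ e ∈ ({e ∈ powersetCard (r + 1) I' | dropRank e (pos 0) = T} : Finset _), B e
      else Set.univ
    have hG : 0 < Measure.pi ν G := by
      rw [Measure.pi_pi]
      refine pos_iff_ne_zero.mpr (prod_ne_zero_iff.mpr fun T _ => ?_)
      split_ifs with hT
      · exact (hI' T hT).ne'
      · simp
    have hslice : ∀ y ∈ G, Measure.pi (fun _ : Fin n => Measure.pi ν)
        {z | (Fin.cons y z : Fin (n + 1) → Finset (Fin R) → Ω) ∈ D} ≠ 0 := by
      intro y hy
      have := hM' R I' hI'c.ge Ω ν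
        (fun e => {z | (Fin.cons (y (dropRank e (pos 0))) z : Fin (n + 1) → Ω) ∈ A e})
        (fun e => (measurable_fin_cons.comp measurable_prodMk_left) (hA e))
        (fun e he => by
          have hT : dropRank e (pos 0) ∈ powersetCard r I' := by
            obtain ⟨h1, h2⟩ := mem_powersetCard.mp he
            have := hpos 0
            refine mem_powersetCard.mpr ⟨(dropRank_subset _ _).trans h1, ?_⟩
            rw [card_dropRank (by omega), h2]; rfl
          have h3 := hy (dropRank e (pos 0)) (Set.mem_univ _)
          simp only [if_pos hT] at h3
          exact Set.mem_iInter₂.mp h3 e (mem_filter.mpr ⟨he, rfl⟩))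
      refine (this.trans_le (measure_mono ?_)).ne'
      rintro z ⟨J, hJ, hz⟩
      refine ⟨J, powersetCard_mono hI'I hJ, fun e he => ?_⟩
      have h4 := hz e he
      simp only [Set.mem_ofPred_eq] at h4
      convert h4 using 1
      ext i
      refine Fin.cases ?_ (fun i => ?_) i <;> simp
    rw [pi_succ_apply _ hDm, pos_iff_ne_zero]
    intro h0
    rw [lintegral_eq_zero_iff (measurable_pi_slice _ hDm)] at h0
    have hGz : Measure.pi ν G = 0 := measure_mono_null (fun y hy => hslice y hy) h0
    exact hG.ne' hGz

lemma map_select_pi {ι κ Ω : Type*} [Fintype ι] [Fintype κ] [MeasurableSpace Ω]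
    (ν : ι → Measure Ω) [∀ T, IsProbabilityMeasure (ν T)] (c : ι → κ) :
    (Measure.pi fun _ : κ => Measure.pi ν).map (fun ζ T => ζ (c T) T) = Measure.pi ν := by
  have hmeas : Measurable fun (ζ : κ → ι → Ω) (T : ι) => ζ (c T) T :=
    measurable_pi_iff.mpr fun T => (measurable_pi_apply T).comp (measurable_pi_apply (c T))
  refine (Measure.pi_eq fun s hs => ?_).symm
  rw [Measure.map_apply hmeas (MeasurableSet.univ_pi hs)]
  have : (fun (ζ : κ → ι → Ω) (T : ι) => ζ (c T) T) ⁻¹' Set.univ.pi s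
      = Set.univ.pi fun i : κ => Set.univ.pi fun T : ι => if c T = i then s T else Set.univ := by
    ext ζ
    simp only [Set.mem_preimage, Set.mem_pi, Set.mem_univ, true_imp_iff]
    constructor
    · intro h i T
      split_ifs with hc
      · exact hc ▸ h T
      · trivial
    · intro h T
      simpa using h (c T) T
  rw [this, Measure.pi_pi]
  simp_rw [Measure.pi_pi]
  rw [prod_comm]
  refine prod_congr rfl fun T _ => ?_
  rw [prod_eq_single (c T)]
  · simp
  · intro i _ hi
    rw [if_neg fun h => hi h.symm, measure_univ]
  · simp

/-- With positive probability all events `A e` with `e` in a copy of `layeredEdges c` hold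
simultaneously. -/
lemma exists_layered_pos {k N : ℕ} (hk : 0 < k) (c : Finset (Fin N) → Fin k) {δ : ℝ≥0∞}
    (hδ : δ ≠ 0) : ∃ M : ℕ, ∀ (R : ℕ) (I : Finset (Fin R)), M ≤ #I →
      ∀ (Ω : Type) [MeasurableSpace Ω] (ν : Finset (Fin R) → Measure Ω)
        [∀ T, IsProbabilityMeasure (ν T)] (A : Finset (Fin R) → Set (Fin k → Ω)),
        (∀ e, MeasurableSet (A e)) →
        (∀ e ∈ powersetCard k I, δ ≤ Measure.pi (fun i : Fin k => ν (dropRank e i)) (A e)) →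
        ∃ ι : Fin N ↪o Fin R, 0 < Measure.pi ν {z | ∀ e ∈ layeredEdges c,
          (fun i : Fin k => z (dropRank (e.map ι.toEmbedding) i)) ∈ A (e.map ι.toEmbedding)} := by
  obtain ⟨r, rfl⟩ := Nat.exists_eq_succ_of_ne_zero hk.ne'
  obtain ⟨M, hM⟩ := exists_copies_pos r N (r + 1) (fun i => i) (fun i => Nat.lt_succ_iff.mp i.2) hδ
  refine ⟨M, fun R I hI Ω _ ν _ A hA hAδ => ?_⟩
  have hpos := hM R I hI Ω ν A hA hAδ
  have hsplit : {ζ : Fin (r + 1) → Finset (Fin R) → Ω | ∃ I' ∈ powersetCard N I,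
      ∀ e ∈ powersetCard (r + 1) I', (fun i : Fin (r + 1) => ζ i (dropRank e i)) ∈ A e}
        = ⋃ I' ∈ powersetCard N I, {ζ | ∀ e ∈ powersetCard (r + 1) I',
          (fun i : Fin (r + 1) => ζ i (dropRank e i)) ∈ A e} := by
    ext ζ; simp
  rw [hsplit] at hpos
  have hex : ∃ I' ∈ powersetCard N I, Measure.pi (fun _ : Fin (r + 1) => Measure.pi ν)
      {ζ | ∀ e ∈ powersetCard (r + 1) I',
        (fun i : Fin (r + 1) => ζ i (dropRank e i)) ∈ A e} ≠ 0 := by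
    by_contra hcon
    push Not at hcon
    exact hpos.ne' ((measure_biUnion_null_iff (powersetCard N I).countable_toSet).mpr hcon)
  obtain ⟨I', hI', hne⟩ := hex
  have hI'c := (mem_powersetCard.mp hI').2
  let ι : Fin N ↪o Fin R := I'.orderEmbOfFin hI'c
  have hιmem : ∀ e : Finset (Fin N), e.map ι.toEmbedding ⊆ I' := fun e x hx => by
    obtain ⟨a, -, rfl⟩ := mem_map.mp hx
    exact orderEmbOfFin_mem I' hI'c a
  let c' : Finset (Fin R) → Fin (r + 1) := fun T => c (univ.filter fun i => ι i ∈ T)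
  have hc' : ∀ S : Finset (Fin N), c' (S.map ι.toEmbedding) = c S := by
    intro S
    simp only [c']
    congr 1
    ext i
    simp
  refine ⟨ι, ?_⟩
  rw [← map_select_pi ν c']
  have hmeas : Measurable fun (ζ : Fin (r + 1) → Finset (Fin R) → Ω) T => ζ (c' T) T :=
    measurable_pi_iff.mpr fun T => (measurable_pi_apply T).comp (measurable_pi_apply (c' T))
  refine ((pos_iff_ne_zero.mpr hne).trans_le (measure_mono ?_)).trans_le
    (Measure.le_map_apply hmeas.aemeasurable _)
  intro ζ hζ e he
  obtain ⟨he1, he2⟩ := mem_filter.mp he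
  have := hζ (e.map ι.toEmbedding) (mem_powersetCard.mpr
    ⟨hιmem e, by rw [card_map]; exact (mem_powersetCard.mp he1).2⟩)
  convert this using 2 with i
  have : c' (dropRank (e.map ι.toEmbedding) i) = i := by
    rw [dropRank_map, hc', he2 i]
  exact congrArg (fun a => ζ a _) this

end sliceMeasures

section counting
open Finset

section transversal
variable {R n : ℕ} {V : Fin R → Finset (Fin n)}

lemma exists_equal_disjoint_parts (R n : ℕ) (hR : R ≤ n) :
    ∃ (s : ℕ) (V : Fin R → Finset (Fin n)), 1 ≤ s ∧ (∀ i, #(V i) = s) ∧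
      (∀ i j, i ≠ j → Disjoint (V i) (V j)) ∧ (0 < R → n ≤ 2 * R * s) := by
  rcases Nat.eq_zero_or_pos R with rfl | hR0
  · exact ⟨1, fun i => i.elim0, le_rfl, fun i => i.elim0, fun i => i.elim0, fun h => by omega⟩
  have hs : 1 ≤ n / R := (Nat.one_le_div_iff hR0).mpr hR
  have hmul : R * (n / R) ≤ n := Nat.mul_div_le n R
  refine ⟨n / R, fun i => {v | (v : ℕ) / (n / R) = i}, hs, fun i => ?_, fun i j hij => ?_,
    fun _ => ?_⟩
  · have hi : ((i : ℕ) + 1) * (n / R) ≤ n :=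
      (Nat.mul_le_mul_right _ i.2).trans hmul
    have : (({v | (v : ℕ) / (n / R) = i} : Finset (Fin n)).map Fin.valEmbedding)
        = Ico (i * (n / R)) ((i + 1) * (n / R)) := by
      ext v
      simp only [mem_map, mem_filter, mem_univ, true_and, Fin.valEmbedding_apply, mem_Ico]
      constructor
      · rintro ⟨a, ha, rfl⟩
        have h1 := Nat.div_add_mod (a : ℕ) (n / R)
        have h2 := Nat.mod_lt (a : ℕ) hs
        rw [ha, mul_comm] at h1
        rw [add_one_mul]
        omega
      · rintro ⟨h1, h2⟩
        refine ⟨⟨v, by omega⟩, ?_, rfl⟩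
        exact Nat.div_eq_of_lt_le h1 h2
    rw [← card_map Fin.valEmbedding, this, Nat.card_Ico]
    rw [← Nat.sub_mul]; simp
  · refine disjoint_left.mpr fun v h1 h2 => hij (Fin.ext ?_)
    rw [mem_filter] at h1 h2
    rw [← h1.2, h2.2]
  · have := Nat.lt_mul_div_succ n hR0
    nlinarith

lemma eq_of_mem_parts (hV : ∀ i j, i ≠ j → Disjoint (V i) (V j)) {i j : Fin R} {v : Fin n}
    (hi : v ∈ V i) (hj : v ∈ V j) : i = j := by
  by_contra h
  exact disjoint_left.mp (hV i j h) hi hj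

lemma subset_of_image_subset (hV : ∀ i j, i ≠ j → Disjoint (V i) (V j)) {x y : Fin R → Fin n}
    (hx : x ∈ Fintype.piFinset V) (hy : y ∈ Fintype.piFinset V) {S T : Finset (Fin R)}
    (h : S.image x ⊆ T.image y) : S ⊆ T ∧ ∀ i ∈ S, x i = y i := by
  rw [Fintype.mem_piFinset] at hx hy
  have key : ∀ i ∈ S, i ∈ T ∧ x i = y i := by
    intro i hi
    obtain ⟨j, hj, hij⟩ := mem_image.mp (h (mem_image_of_mem x hi))
    have : i = j := eq_of_mem_parts hV (hx i) (hij ▸ hy j)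
    subst this
    exact ⟨hj, hij.symm⟩
  exact ⟨fun i hi => (key i hi).1, fun i hi => (key i hi).2⟩

lemma injective_of_mem_parts (hV : ∀ i j, i ≠ j → Disjoint (V i) (V j)) {x : Fin R → Fin n}
    (hx : x ∈ Fintype.piFinset V) : Function.Injective x := by
  rw [Fintype.mem_piFinset] at hx
  exact fun i j hij => eq_of_mem_parts hV (hx i) (hij ▸ hx j)

/-- A set meeting each part at most once is the image of a transversal. -/
lemma exists_transversal (hV : ∀ i j, i ≠ j → Disjoint (V i) (V j)) {y : Fin R → Fin n}
    (hy : y ∈ Fintype.piFinset V) (I : Finset (Fin R)) (C : Finset (Fin n))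
    (hC : ∀ c ∈ C, ∃ i ∈ I, c ∈ V i)
    (hC1 : ∀ c ∈ C, ∀ c' ∈ C, ∀ i, c ∈ V i → c' ∈ V i → c = c') :
    ∃ e ⊆ I, #e = #C ∧ ∃ x ∈ Fintype.piFinset V, (∀ i ∉ e, x i = y i) ∧ e.image x = C := by
  rcases C.eq_empty_or_nonempty with rfl | ⟨c₀, hc₀⟩
  · exact ⟨∅, empty_subset _, rfl, y, hy, fun _ _ => rfl, rfl⟩
  have : Nonempty (Fin R) := ⟨(hC c₀ hc₀).choose⟩
  choose! idx hidxI hidxV using hC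
  let x : Fin R → Fin n := fun i => if h : ∃ c ∈ C, c ∈ V i then h.choose else y i
  have hx : ∀ c ∈ C, x (idx c) = c := by
    intro c hc
    have h : ∃ c' ∈ C, c' ∈ V (idx c) := ⟨c, hc, hidxV c hc⟩
    simp only [x, dif_pos h]
    exact hC1 _ h.choose_spec.1 c hc _ h.choose_spec.2 (hidxV c hc)
  refine ⟨C.image idx, fun i hi => ?_, ?_, x, ?_, fun i hi => ?_, ?_⟩
  · obtain ⟨c, hc, rfl⟩ := mem_image.mp hi
    exact hidxI c hc
  · refine card_image_of_injOn fun a ha b hb hab => ?_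
    rw [← hx a ha, ← hx b hb, hab]
  · refine Fintype.mem_piFinset.mpr fun i => ?_
    simp only [x]
    split_ifs with h
    · exact h.choose_spec.2
    · exact Fintype.mem_piFinset.mp hy i
  · have h : ¬ ∃ c ∈ C, c ∈ V i := by
      rintro ⟨c, hc, hci⟩
      exact hi (mem_image.mpr ⟨c, hc, eq_of_mem_parts hV (hidxV c hc) hci⟩)
    simp only [x, dif_neg h]
  · rw [image_image]
    conv_rhs => rw [← image_id (s := C)]
    exact image_congr fun c hc => hx c hc

end transversal

/-- A partite form of density: for every `L`-set `I` of indices and all events `A S`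
depending on `k - 2` coordinates, a random transversal satisfying all of them spans at least
`d'` edges with indices in `I` on average, up to an error `ε`. -/
def IsPolarized (k L R n : ℕ) (d' ε : ℝ) (V : Fin R → Finset (Fin n))
    (E : Finset (Finset (Fin n))) : Prop :=
  (∀ i, (V i).Nonempty) ∧ (∀ i j, i ≠ j → Disjoint (V i) (V j)) ∧
  ∀ I ∈ powersetCard L (univ : Finset (Fin R)),
    ∀ A : Finset (Fin R) → (Fin R → Fin n) → Prop,
    (∀ S x y, (∀ i ∈ S, x i = y i) → (A S x ↔ A S y)) →
    d' * #{x ∈ Fintype.piFinset V | ∀ S ∈ powersetCard (k - 2) univ, A S x}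
        - ε * #(Fintype.piFinset V)
      ≤ ∑ e ∈ powersetCard k I,
        (#{x ∈ Fintype.piFinset V | (∀ S ∈ powersetCard (k - 2) univ, A S x) ∧
          e.image x ∈ E} : ℝ)

section large
variable {k R n : ℕ} {V : Fin R → Finset (Fin n)}

/-- The `(k - 2)`-graph whose `k`-cliques are the transversals `x` with index set `e`,
agreeing with `y` off `e` and satisfying all `A S`. -/
def linkGraph (k : ℕ) (V : Fin R → Finset (Fin n)) (e : Finset (Fin R))
    (A : Finset (Fin R) → (Fin R → Fin n) → Prop) (y : Fin R → Fin n) :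
    Finset (Finset (Fin n)) :=
  {C ∈ powersetCard (k - 2) univ | ∃ S ∈ powersetCard (k - 2) e, ∃ x ∈ Fintype.piFinset V,
    (∀ i ∉ e, x i = y i) ∧ (∀ S' ∈ powersetCard (k - 2) univ, S' ∩ e ⊆ S → A S' x) ∧
    S.image x = C}

lemma cliqueSet_linkGraph (hk : 4 ≤ k) (hV : ∀ i j, i ≠ j → Disjoint (V i) (V j))
    {e : Finset (Fin R)} (he : #e = k) {A : Finset (Fin R) → (Fin R → Fin n) → Prop}
    (hA : ∀ S x y, (∀ i ∈ S, x i = y i) → (A S x ↔ A S y)) {y : Fin R → Fin n}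
    (hy : y ∈ Fintype.piFinset V) :
    cliqueSet k (k - 2) n (linkGraph k V e A y)
      = ({x ∈ Fintype.piFinset V | (∀ i ∉ e, x i = y i) ∧
          ∀ S ∈ powersetCard (k - 2) univ, A S x} : Finset _).image fun x => e.image x := by
  ext C
  simp only [cliqueSet, mem_filter, mem_powersetCard, subset_univ, true_and, mem_image]
  constructor
  · rintro ⟨hCk, hC⟩
    have hext : ∀ D ⊆ C, #D ≤ k - 2 → ∃ D', D ⊆ D' ∧ D' ⊆ C ∧ #D' = k - 2 := fun D hD hDc =>
      exists_subsuperset_card_eq hD hDc (by omega)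
    have hG : ∀ D ⊆ C, #D = k - 2 → ∃ S ∈ powersetCard (k - 2) e, ∃ x ∈ Fintype.piFinset V,
        (∀ i ∉ e, x i = y i) ∧ (∀ S' ∈ powersetCard (k - 2) univ, S' ∩ e ⊆ S → A S' x) ∧
        S.image x = D := fun D hD hDc => (mem_filter.mp (hC D ⟨hD, hDc⟩)).2
    obtain ⟨e', he'e, he'c, x, hx, hxy, hxC⟩ := exists_transversal hV hy e C
      (fun c hc => by
        obtain ⟨D, hcD, hDC, hDc⟩ := hext {c} (by simpa using hc) (by simp; omega)
        obtain ⟨S, hS, z, hz, -, -, hzD⟩ := hG D hDC hDc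
        have : c ∈ S.image z := by rw [hzD]; exact hcD (by simp)
        obtain ⟨i, hi, rfl⟩ := mem_image.mp this
        exact ⟨i, (mem_powersetCard.mp hS).1 hi, Fintype.mem_piFinset.mp hz i⟩)
      (fun c hc c' hc' i hci hc'i => by
        obtain ⟨D, hcD, hDC, hDc⟩ := hext {c, c'}
          (by intro z hz; simp at hz; rcases hz with rfl | rfl <;> assumption)
          (card_le_two.trans (by omega))
        obtain ⟨S, hS, z, hz, -, -, hzD⟩ := hG D hDC hDc
        have h1 : c ∈ S.image z := by rw [hzD]; exact hcD (by simp)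
        have h2 : c' ∈ S.image z := by rw [hzD]; exact hcD (by simp)
        obtain ⟨a, -, rfl⟩ := mem_image.mp h1
        obtain ⟨b, -, rfl⟩ := mem_image.mp h2
        have ha := eq_of_mem_parts hV hci (Fintype.mem_piFinset.mp hz a)
        have hb := eq_of_mem_parts hV hc'i (Fintype.mem_piFinset.mp hz b)
        rw [← ha, ← hb])
    have hee : e' = e := eq_of_subset_of_card_le he'e (by rw [he'c, hCk, he])
    subst hee
    refine ⟨x, ⟨hx, hxy, fun S' hS' => ?_⟩, hxC⟩
    obtain ⟨S, hS'S, hSe, hSc⟩ := exists_subsuperset_card_eq (s := S' ∩ e') (t := e') (n := k - 2)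
      inter_subset_right ((card_le_card inter_subset_left).trans hS'.le) (by omega)
    obtain ⟨S₁, hS₁, x₁, hx₁, hx₁y, hx₁A, hx₁S⟩ := hG (S.image x)
      (by rw [← hxC]; exact image_subset_image hSe)
      (by rw [card_image_of_injective _ (injective_of_mem_parts hV hx), hSc])
    obtain ⟨hSS, hag⟩ := subset_of_image_subset hV hx hx₁ hx₁S.ge
    refine (hA S' x x₁ fun i hi => ?_).mpr (hx₁A S' (by simpa using hS') (hS'S.trans hSS))
    by_cases hie : i ∈ e'
    · exact hag i (hS'S (mem_inter.mpr ⟨hi, hie⟩))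
    · rw [hxy i hie, hx₁y i hie]
  · rintro ⟨x, ⟨hx, hxy, hxA⟩, rfl⟩
    have hinj := injective_of_mem_parts hV hx
    refine ⟨by rw [card_image_of_injective _ hinj, he], fun D ⟨hD, hDc⟩ => ?_⟩
    obtain ⟨S, hS, rfl⟩ := subset_image_iff.mp hD
    have hSc : #S = k - 2 := by rwa [card_image_of_injective _ hinj] at hDc
    refine mem_filter.mpr ⟨by simpa using hDc, S, ?_, x, hx, hxy,
      fun S' hS' _ => hxA S' (by simpa using hS'), rfl⟩
    exact mem_powersetCard.mpr ⟨hS, hSc⟩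

lemma isPolarized_of_isDense_large (hk : 4 ≤ k) {d ε μ : ℝ} {s : ℕ} (hs : 1 ≤ s)
    (hVs : ∀ i, #(V i) = s) (hV : ∀ i j, i ≠ j → Disjoint (V i) (V j))
    (hμ : 0 < R → μ * (n : ℝ) ^ k ≤ ε * (s : ℝ) ^ k) {E : Finset (Finset (Fin n))}
    (hE : IsDense k (k - 2) n d μ E) : IsPolarized k k R n d ε V E := by
  have hVne : ∀ i, (V i).Nonempty := fun i => card_pos.mp (by rw [hVs]; omega)
  refine ⟨hVne, hV, fun e he A hA => ?_⟩
  obtain ⟨-, hec⟩ := mem_powersetCard.mp he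
  have hR : 0 < R := by
    obtain ⟨i, -⟩ : e.Nonempty := card_pos.mp (by omega)
    exact i.pos
  have hpe : powersetCard k e = {e} := by rw [← hec]; exact powersetCard_self e
  rw [hpe, sum_singleton]
  choose b hb using hVne
  let ρ : (Fin R → Fin n) → (Fin R → Fin n) := fun x i => if i ∈ e then b i else x i
  let Y : Finset (Fin R → Fin n) := (Fintype.piFinset V).image ρ
  have hρ : ∀ x ∈ Fintype.piFinset V, ρ x ∈ Fintype.piFinset V := fun x hx =>
    Fintype.mem_piFinset.mpr fun i => by
      simp only [ρ]; split_ifs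
      · exact hb i
      · exact Fintype.mem_piFinset.mp hx i
  have hρeq : ∀ y ∈ Y, ∀ x, ρ x = y ↔ ∀ i ∉ e, x i = y i := by
    intro y hy x
    obtain ⟨z, -, rfl⟩ := mem_image.mp hy
    constructor
    · intro h i hi
      have := congrFun h i
      simpa [ρ, hi] using this
    · intro h
      ext i
      by_cases hi : i ∈ e
      · simp [ρ, hi]
      · simp [ρ, hi, h i hi]
  have hYV : ∀ y ∈ Y, y ∈ Fintype.piFinset V := fun y hy => by
    obtain ⟨z, hz, rfl⟩ := mem_image.mp hy
    exact hρ z hz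
  have hfib : ∀ (p : (Fin R → Fin n) → Prop) [DecidablePred p],
      (#{x ∈ Fintype.piFinset V | p x} : ℝ)
      = ∑ y ∈ Y, (#{x ∈ Fintype.piFinset V | (∀ i ∉ e, x i = y i) ∧ p x} : ℝ) := by
    intro p _
    rw [card_eq_sum_card_fiberwise (f := ρ) (t := Y)
      fun x hx => mem_image_of_mem ρ (mem_filter.mp hx).1]
    push_cast
    refine sum_congr rfl fun y hy => ?_
    congr 2
    ext x
    simp only [mem_filter, hρeq y hy x]
    tauto
  have hYcard : (#(Fintype.piFinset V) : ℝ) = #Y * (s : ℝ) ^ k := by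
    have h1 := hfib fun _ => True
    simp only [filter_true, and_true] at h1
    rw [h1, ← nsmul_eq_mul, ← sum_const]
    refine sum_congr rfl fun y hy => ?_
    have : ({x ∈ Fintype.piFinset V | ∀ i ∉ e, x i = y i} : Finset _)
        = Fintype.piFinset fun i => if i ∈ e then V i else {y i} := by
      ext x
      simp only [mem_filter, Fintype.mem_piFinset]
      constructor
      · rintro ⟨h1, h2⟩ i
        split_ifs with hi
        · exact h1 i
        · simpa using h2 i hi
      · intro h
        have hi2 : ∀ i ∉ e, x i = y i := fun i hi => by simpa [hi] using h i
        refine ⟨fun i => ?_, hi2⟩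
        by_cases hi : i ∈ e
        · simpa [hi] using h i
        · rw [hi2 i hi]; exact Fintype.mem_piFinset.mp (hYV y hy) i
    rw [this, Fintype.card_piFinset]
    have h3 : ∀ i, #(if i ∈ e then V i else {y i}) = if i ∈ e then s else 1 := fun i => by
      split_ifs
      · exact hVs i
      · simp
    simp_rw [h3]
    rw [prod_ite_mem]
    simp [hec]
  have hstep : ∀ y ∈ Y,
      d * (#{x ∈ Fintype.piFinset V | (∀ i ∉ e, x i = y i) ∧
          ∀ S ∈ powersetCard (k - 2) univ, A S x} : ℝ) - ε * (s : ℝ) ^ k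
        ≤ #{x ∈ Fintype.piFinset V | (∀ i ∉ e, x i = y i) ∧
          ((∀ S ∈ powersetCard (k - 2) univ, A S x) ∧ e.image x ∈ E)} := by
    intro y hy
    have hd := hE (linkGraph k V e A y)
      (fun C hC => (mem_powersetCard.mp (mem_filter.mp hC).1).2)
    have hclq := cliqueSet_linkGraph hk hV hec hA (hYV y hy)
    set X : Finset (Fin R → Fin n) := {x ∈ Fintype.piFinset V | (∀ i ∉ e, x i = y i) ∧
          ∀ S ∈ powersetCard (k - 2) univ, A S x} with hX
    have hinj : Set.InjOn (fun x : Fin R → Fin n => e.image x) X := by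
      intro x hx z hz hxz
      have hx' := mem_filter.mp hx
      have hz' := mem_filter.mp hz
      have := (subset_of_image_subset hV hx'.1 hz'.1 (le_of_eq hxz)).2
      ext1 i
      by_cases hi : i ∈ e
      · exact this i hi
      · rw [hx'.2.1 i hi, hz'.2.1 i hi]
    have h1 : #(cliqueSet k (k - 2) n (linkGraph k V e A y)) = #X := by
      rw [hclq, card_image_of_injOn hinj]
    have h2 : #(cliqueSet k (k - 2) n (linkGraph k V e A y) ∩ E)
        = #{x ∈ Fintype.piFinset V | (∀ i ∉ e, x i = y i) ∧
          ((∀ S ∈ powersetCard (k - 2) univ, A S x) ∧ e.image x ∈ E)} := by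
      rw [hclq]
      have : (X.image fun x => e.image x) ∩ E
          = ({x ∈ X | e.image x ∈ E} : Finset _).image fun x => e.image x := by
        ext C
        simp only [mem_inter, mem_image, mem_filter]
        constructor
        · rintro ⟨⟨x, hx, rfl⟩, hC⟩
          exact ⟨x, ⟨hx, hC⟩, rfl⟩
        · rintro ⟨x, ⟨hx, hC⟩, rfl⟩
          exact ⟨⟨x, hx, rfl⟩, hC⟩
      rw [this, card_image_of_injOn (hinj.mono (filter_subset _ _))]
      congr 1
      ext x
      simp only [hX, mem_filter]
      tauto
    rw [h1, h2] at hd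
    have := hμ hR
    linarith
  rw [hfib (fun x => ∀ S ∈ powersetCard (k - 2) univ, A S x),
    hfib (fun x => (∀ S ∈ powersetCard (k - 2) univ, A S x) ∧ e.image x ∈ E), hYcard]
  calc d * ∑ y ∈ Y, (#{x ∈ Fintype.piFinset V | (∀ i ∉ e, x i = y i) ∧
          ∀ S ∈ powersetCard (k - 2) univ, A S x} : ℝ) - ε * (#Y * (s : ℝ) ^ k)
      = ∑ y ∈ Y, (d * (#{x ∈ Fintype.piFinset V | (∀ i ∉ e, x i = y i) ∧
          ∀ S ∈ powersetCard (k - 2) univ, A S x} : ℝ) - ε * (s : ℝ) ^ k) := by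
        rw [sum_sub_distrib, ← mul_sum, sum_const, nsmul_eq_mul]; ring
    _ ≤ _ := sum_le_sum hstep

end large

section boxes
variable {R n : ℕ} {V : Fin R → Finset (Fin n)}

lemma card_filter_mem_powersetCard {α : Type*} [DecidableEq α] {P : Finset α} {a : α}
    (ha : a ∈ P) (s : ℕ) : #{Q ∈ powersetCard (s + 1) P | a ∈ Q} = (#P - 1).choose s := by
  have : ({Q ∈ powersetCard (s + 1) P | a ∈ Q} : Finset _)
      = (powersetCard s (P.erase a)).image (insert a) := by
    ext Q
    simp only [mem_filter, mem_powersetCard, mem_image]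
    constructor
    · rintro ⟨⟨h1, h2⟩, h3⟩
      exact ⟨Q.erase a, ⟨erase_subset_erase a h1, by rw [card_erase_of_mem h3, h2]; rfl⟩,
        insert_erase h3⟩
    · rintro ⟨Q', ⟨h1, h2⟩, rfl⟩
      have : a ∉ Q' := fun h => notMem_erase a P (h1 h)
      exact ⟨⟨insert_subset ha (h1.trans (erase_subset _ _)), by
        rw [card_insert_of_notMem this, h2]⟩, mem_insert_self _ _⟩
  rw [this, card_image_of_injOn, card_powersetCard, card_erase_of_mem ha]
  intro Q hQ Q' hQ' h
  have h1 : a ∉ Q := fun h => notMem_erase a P ((mem_powersetCard.mp hQ).1 h)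
  have h2 : a ∉ Q' := fun h => notMem_erase a P ((mem_powersetCard.mp hQ').1 h)
  rw [← erase_insert h1, ← erase_insert h2, h]

/-- A function whose sum over every sub-box with sides of size `s` is nonnegative has
nonnegative sum over the whole box. -/
lemma sum_piFinset_nonneg_of_subboxes {s : ℕ} (hs : 1 ≤ s) (hP : ∀ i, s ≤ #(V i))
    (g : (Fin R → Fin n) → ℝ)
    (hg : ∀ Q ∈ Fintype.piFinset fun i => powersetCard s (V i),
      0 ≤ ∑ x ∈ Fintype.piFinset Q, g x) :
    0 ≤ ∑ x ∈ Fintype.piFinset V, g x := by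
  obtain ⟨s, rfl⟩ : ∃ t, s = t + 1 := ⟨s - 1, by omega⟩
  have h1 : ∑ Q ∈ Fintype.piFinset fun i => powersetCard (s + 1) (V i),
        ∑ x ∈ Fintype.piFinset Q, g x
      = (∏ i, ((#(V i) - 1).choose s : ℝ)) * ∑ x ∈ Fintype.piFinset V, g x := by
    rw [mul_sum]
    rw [sum_comm' (t' := Fintype.piFinset V) (s' := fun x => Fintype.piFinset fun i =>
      {Q ∈ powersetCard (s + 1) (V i) | x i ∈ Q})]
    · refine sum_congr rfl fun x hx => ?_
      rw [sum_const, Fintype.card_piFinset, nsmul_eq_mul]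
      push_cast
      congr 1
      refine prod_congr rfl fun i _ => ?_
      rw [card_filter_mem_powersetCard (Fintype.mem_piFinset.mp hx i)]
    · intro Q x
      simp only [Fintype.mem_piFinset, mem_filter, mem_powersetCard]
      constructor
      · rintro ⟨h1, h2⟩
        exact ⟨fun i => ⟨h1 i, h2 i⟩, fun i => (h1 i).1 (h2 i)⟩
      · rintro ⟨h1, -⟩
        exact ⟨fun i => (h1 i).1, fun i => (h1 i).2⟩
  have h2 : 0 < ∏ i, ((#(V i) - 1).choose s : ℝ) := by
    refine prod_pos fun i _ => ?_
    exact_mod_cast Nat.choose_pos (by have := hP i; omega)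
  have h3 := sum_nonneg hg
  rw [h1] at h3
  exact nonneg_of_mul_nonneg_right h3 h2

lemma card_agree_off {s : ℕ} (hVs : ∀ i, #(V i) = s) (e : Finset (Fin R)) {y : Fin R → Fin n}
    (hy : y ∈ Fintype.piFinset V) :
    #{x ∈ Fintype.piFinset V | ∀ i ∉ e, x i = y i} = s ^ #e := by
  have : ({x ∈ Fintype.piFinset V | ∀ i ∉ e, x i = y i} : Finset _)
      = Fintype.piFinset fun i => if i ∈ e then V i else {y i} := by
    ext x
    simp only [mem_filter, Fintype.mem_piFinset]
    constructor
    · rintro ⟨h1, h2⟩ i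
      split_ifs with hi
      · exact h1 i
      · simpa using h2 i hi
    · intro h
      have hi2 : ∀ i ∉ e, x i = y i := fun i hi => by simpa [hi] using h i
      refine ⟨fun i => ?_, hi2⟩
      by_cases hi : i ∈ e
      · simpa [hi] using h i
      · rw [hi2 i hi]; exact Fintype.mem_piFinset.mp hy i
  rw [this, Fintype.card_piFinset]
  have h3 : ∀ i, #(if i ∈ e then V i else {y i}) = if i ∈ e then s else 1 := fun i => by
    split_ifs
    · exact hVs i
    · simp
  simp_rw [h3]
  rw [prod_ite_mem]
  simp

/-- Each transversal edge is the image of many transversals. -/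
lemma card_mul_le_sum_image_mem {s r : ℕ} (hVs : ∀ i, #(V i) = s)
    (hV : ∀ i j, i ≠ j → Disjoint (V i) (V j)) (I : Finset (Fin R)) (E : Finset (Finset (Fin n)))
    (T : Finset (Finset (Fin n))) (hTE : T ⊆ E) (hTr : ∀ C ∈ T, #C = r)
    (hTI : ∀ C ∈ T, ∀ c ∈ C, ∃ i ∈ I, c ∈ V i)
    (hT1 : ∀ C ∈ T, ∀ c ∈ C, ∀ c' ∈ C, ∀ i, c ∈ V i → c' ∈ V i → c = c') :
    #T * #(Fintype.piFinset V)
      ≤ (∑ e ∈ powersetCard r I, #{x ∈ Fintype.piFinset V | e.image x ∈ E}) * s ^ r := by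
  have hstep : ∀ y ∈ Fintype.piFinset V, #T ≤ ∑ e ∈ powersetCard r I,
      #{x ∈ Fintype.piFinset V | (∀ i ∉ e, x i = y i) ∧ e.image x ∈ E} := by
    intro y hy
    rw [← card_sigma]
    refine card_le_card_of_surjOn (fun p => p.1.image p.2) fun C hC => ?_
    obtain ⟨e, heI, hec, x, hx, hxy, hxC⟩ :=
      exists_transversal hV hy I C (hTI C hC) (hT1 C hC)
    refine ⟨⟨e, x⟩, ?_, hxC⟩
    simp only [coe_sigma, Set.mem_sigma_iff, mem_coe, mem_powersetCard, mem_filter]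
    exact ⟨⟨heI, hec.trans (hTr C hC)⟩, hx, hxy, hxC ▸ hTE hC⟩
  calc #T * #(Fintype.piFinset V)
      = ∑ y ∈ Fintype.piFinset V, #T := by rw [sum_const, smul_eq_mul, mul_comm]
    _ ≤ ∑ y ∈ Fintype.piFinset V, ∑ e ∈ powersetCard r I,
      #{x ∈ Fintype.piFinset V | (∀ i ∉ e, x i = y i) ∧ e.image x ∈ E} := sum_le_sum hstep
    _ = _ := by
      rw [sum_comm, sum_mul]
      refine sum_congr rfl fun e he => ?_
      rw [← (mem_powersetCard.mp he).2]
      have h1 : ∀ y ∈ Fintype.piFinset V,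
          #{x ∈ Fintype.piFinset V | (∀ i ∉ e, x i = y i) ∧ e.image x ∈ E}
          = #(bipartiteBelow (fun x y : Fin R → Fin n => ∀ i ∉ e, y i = x i)
              ({x ∈ Fintype.piFinset V | e.image x ∈ E}) y) := by
        intro y _
        congr 1
        ext x
        simp only [bipartiteBelow, mem_filter, eq_comm]
        tauto
      rw [sum_congr rfl h1, ← sum_card_bipartiteAbove_eq_sum_card_bipartiteBelow]
      rw [← smul_eq_mul, ← sum_const]
      exact sum_congr rfl fun x hx => card_agree_off hVs e (mem_filter.mp hx).1

lemma cube_le_choose_three {m : ℕ} (hm : 4 ≤ m) : (m : ℝ) ^ 3 / 24 ≤ (m.choose 3 : ℝ) := by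
  obtain ⟨t, rfl⟩ : ∃ t, m = t + 4 := ⟨m - 4, by omega⟩
  have h : (t + 4) * (t + 3) * (t + 2) = 6 * (t + 4).choose 3 := by
    have := Nat.descFactorial_eq_factorial_mul_choose (t + 4) 3
    simp [Nat.descFactorial, Nat.factorial] at this
    linarith
  have h' : ((t : ℝ) + 4) * (t + 3) * (t + 2) = 6 * ((t + 4).choose 3 : ℝ) := by exact_mod_cast h
  push_cast
  have ht : (0 : ℝ) ≤ t := t.cast_nonneg
  nlinarith [mul_nonneg ht ht, mul_nonneg (mul_nonneg ht ht) ht]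

lemma cliqueSet_one (n : ℕ) (U : Finset (Fin n)) :
    cliqueSet 3 1 n (powersetCard 1 U) = powersetCard 3 U := by
  ext C
  simp only [cliqueSet, mem_filter, mem_powersetCard, subset_univ, true_and]
  constructor
  · rintro ⟨h1, h2⟩
    refine ⟨fun c hc => ?_, h1⟩
    simpa using (h2 {c} ⟨by simpa using hc, by simp⟩).1
  · rintro ⟨h1, h2⟩
    exact ⟨h2, fun s hs => ⟨hs.1.trans h1, hs.2⟩⟩

lemma card_box_le_sum_of_isDense {d μ : ℝ} (hd : 0 < d) {L s : ℕ} (hL4 : 4 ≤ L)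
    (hL : 72 ≤ d * L) (hs : 1 ≤ s) (hVs : ∀ i, #(V i) = s)
    (hV : ∀ i j, i ≠ j → Disjoint (V i) (V j)) (hμ : μ * (n : ℝ) ^ 3 ≤ (s : ℝ) ^ 3)
    {E : Finset (Finset (Fin n))} (hE : IsDense 3 1 n d μ E) {I : Finset (Fin R)}
    (hI : #I = L) :
    (#(Fintype.piFinset V) : ℝ)
      ≤ ∑ e ∈ powersetCard 3 I, (#{x ∈ Fintype.piFinset V | e.image x ∈ E} : ℝ) := by
  set U : Finset (Fin n) := I.biUnion V with hU
  have hUc : #U = L * s := by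
    rw [hU, card_biUnion fun i _ j _ hij => hV i j hij, sum_congr rfl fun i _ => hVs i, sum_const,
      hI, smul_eq_mul]
  have hdens := hE (powersetCard 1 U) fun e he => (mem_powersetCard.mp he).2
  rw [cliqueSet_one, card_powersetCard, hUc] at hdens
  set good : Finset (Fin n) → Prop :=
    fun C => ∀ c ∈ C, ∀ c' ∈ C, ∀ i, c ∈ V i → c' ∈ V i → c = c' with hgood
  set T : Finset (Finset (Fin n)) := {C ∈ powersetCard 3 U ∩ E | good C} with hT
  have hbad : #{C ∈ powersetCard 3 U ∩ E | ¬ good C} ≤ L ^ 2 * s ^ 3 := by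
    have hsub : ({C ∈ powersetCard 3 U ∩ E | ¬ good C} : Finset _) ⊆
        I.biUnion fun i => (V i ×ˢ V i ×ˢ U).image fun p => {p.1, p.2.1, p.2.2} := by
      intro C hC
      simp only [mem_filter, mem_inter, mem_powersetCard, hgood] at hC
      obtain ⟨⟨⟨hCU, hC3⟩, -⟩, hCb⟩ := hC
      push Not at hCb
      obtain ⟨c, hc, c', hc', i, hci, hc'i, hne⟩ := hCb
      have hi : i ∈ I := by
        obtain ⟨j, hj, hcj⟩ := mem_biUnion.mp (hCU hc)
        rwa [eq_of_mem_parts hV hci hcj]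
      obtain ⟨c'', hc''⟩ : ∃ c'', (C.erase c).erase c' = {c''} := by
        rw [← card_eq_one, card_erase_of_mem (mem_erase.mpr ⟨hne.symm, hc'⟩),
          card_erase_of_mem hc, hC3]
      have hC'' : c'' ∈ C := by
        have : c'' ∈ (C.erase c).erase c' := by rw [hc'']; simp
        exact mem_of_mem_erase (mem_of_mem_erase this)
      refine mem_biUnion.mpr ⟨i, hi, mem_image.mpr ⟨(c, c', c''), ?_, ?_⟩⟩
      · simp [hci, hc'i, hCU hC'']
      · rw [← insert_erase hc, ← insert_erase (mem_erase.mpr ⟨hne.symm, hc'⟩), hc'']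
    refine (card_le_card hsub).trans (card_biUnion_le.trans ?_)
    calc ∑ i ∈ I, #((V i ×ˢ V i ×ˢ U).image fun p => ({p.1, p.2.1, p.2.2} : Finset (Fin n)))
        ≤ ∑ i ∈ I, s * (s * (L * s)) := sum_le_sum fun i _ => card_image_le.trans (by
          rw [card_product, card_product, hVs, hUc])
      _ = L ^ 2 * s ^ 3 := by rw [sum_const, hI, smul_eq_mul]; ring
  have hsplit : #T + #{C ∈ powersetCard 3 U ∩ E | ¬ good C} = #(powersetCard 3 U ∩ E) :=
    card_filter_add_card_filter_not _
  have hmain := card_mul_le_sum_image_mem (r := 3) hVs hV I E T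
    (fun C hC => (mem_inter.mp (mem_filter.mp hC).1).2)
    (fun C hC => (mem_powersetCard.mp (mem_inter.mp (mem_filter.mp hC).1).1).2)
    (fun C hC c hc => mem_biUnion.mp
      ((mem_powersetCard.mp (mem_inter.mp (mem_filter.mp hC).1).1).1 hc))
    (fun C hC => (mem_filter.mp hC).2)
  have hTs : (s : ℝ) ^ 3 ≤ #T := by
    have h1 := cube_le_choose_three (m := L * s) (by nlinarith)
    have h2 : (#T : ℝ) + (L : ℝ) ^ 2 * (s : ℝ) ^ 3 ≥ #(powersetCard 3 U ∩ E) := by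
      have : #(powersetCard 3 U ∩ E) ≤ #T + L ^ 2 * s ^ 3 := by omega
      exact_mod_cast this
    have h3 := mul_le_mul_of_nonneg_left h1 hd.le
    have hL1 : (4 : ℝ) ≤ L := by exact_mod_cast hL4
    have h4 : 3 * (L : ℝ) ^ 2 * (s : ℝ) ^ 3 ≤ d * (((L * s : ℕ) : ℝ) ^ 3 / 24) := by
      push_cast
      have : d * (((L : ℝ) * s) ^ 3 / 24) = (d * L) * ((L : ℝ) ^ 2 * (s : ℝ) ^ 3 / 24) := by ring
      rw [this]
      have := mul_le_mul_of_nonneg_right hL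
        (show (0 : ℝ) ≤ (L : ℝ) ^ 2 * (s : ℝ) ^ 3 / 24 by positivity)
      linarith
    have h5 : (s : ℝ) ^ 3 ≤ (L : ℝ) ^ 2 * (s : ℝ) ^ 3 :=
      le_mul_of_one_le_left (by positivity) (by nlinarith)
    linarith
  have hmain' : (#T : ℝ) * #(Fintype.piFinset V) ≤
      (∑ e ∈ powersetCard 3 I, (#{x ∈ Fintype.piFinset V | e.image x ∈ E} : ℝ)) * (s : ℝ) ^ 3 := by
    exact_mod_cast hmain
  have hs3 : (0 : ℝ) < (s : ℝ) ^ 3 := by positivity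
  refine le_of_mul_le_mul_right ?_ hs3
  calc (#(Fintype.piFinset V) : ℝ) * (s : ℝ) ^ 3 ≤ #T * #(Fintype.piFinset V) := by
        rw [mul_comm]; gcongr
    _ ≤ _ := hmain'

lemma sum_sum_ite_image_mem_sub_one (B : Finset (Fin R → Fin n)) (I : Finset (Finset (Fin R)))
    (E : Finset (Finset (Fin n))) :
    ∑ x ∈ B, (∑ e ∈ I, (if e.image x ∈ E then (1 : ℝ) else 0) - 1)
      = ∑ e ∈ I, (#{x ∈ B | e.image x ∈ E} : ℝ) - #B := by
  rw [sum_sub_distrib, sum_comm, sum_const, nsmul_eq_mul, mul_one]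
  congr 1
  exact sum_congr rfl fun e _ => sum_boole _ _

lemma isPolarized_three_of_isDense {d ε μ : ℝ} (hd : 0 < d) (hε : 0 < ε) {L s : ℕ}
    (hL4 : 4 ≤ L) (hL : 72 ≤ d * L) (hs : 1 ≤ s)
    (hVs : ∀ i, #(V i) = s) (hV : ∀ i j, i ≠ j → Disjoint (V i) (V j))
    (hμ : 0 < R → μ * (n : ℝ) ^ 3 ≤ (ε * s) ^ 3) {E : Finset (Finset (Fin n))}
    (hE : IsDense 3 1 n d μ E) : IsPolarized 3 L R n 1 ε V E := by
  have hVne : ∀ i, (V i).Nonempty := fun i => card_pos.mp (by rw [hVs]; omega)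
  refine ⟨hVne, hV, fun I hI A hA => ?_⟩
  obtain ⟨-, hIc⟩ := mem_powersetCard.mp hI
  have hR : 0 < R := by
    obtain ⟨i, -⟩ : I.Nonempty := card_pos.mp (by omega)
    exact i.pos
  set P : Fin R → Finset (Fin n) := fun i => {v ∈ V i | A {i} fun _ => v} with hPdef
  have hPV : ∀ i, P i ⊆ V i := fun i => filter_subset _ _
  have hmemP : ∀ x, x ∈ Fintype.piFinset P ↔
      x ∈ Fintype.piFinset V ∧ ∀ S ∈ powersetCard (3 - 2) univ, A S x := by
    intro x
    have hAi : ∀ i, A {i} x ↔ A {i} fun _ => x i := fun i => hA _ _ _ (by simp)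
    simp only [Fintype.mem_piFinset, hPdef, mem_filter, forall_and, mem_powersetCard, subset_univ,
      true_and]
    refine and_congr_right fun _ => ?_
    constructor
    · intro h S hS
      obtain ⟨i, rfl⟩ := card_eq_one.mp hS
      exact (hAi i).mpr (h i)
    · intro h i
      exact (hAi i).mp (h {i} (by simp))
  have h1 : ({x ∈ Fintype.piFinset V | ∀ S ∈ powersetCard (3 - 2) univ, A S x} : Finset _)
      = Fintype.piFinset P := by
    ext x; rw [hmemP, mem_filter]
  have h2 : ∀ e : Finset (Fin R), ({x ∈ Fintype.piFinset V |
      (∀ S ∈ powersetCard (3 - 2) univ, A S x) ∧ e.image x ∈ E} : Finset _)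
      = {x ∈ Fintype.piFinset P | e.image x ∈ E} := by
    intro e; ext x; rw [mem_filter, mem_filter, hmemP, and_assoc]
  rw [h1, sum_congr rfl fun e _ => by rw [h2 e], one_mul]
  have hs0 : (0 : ℝ) < s := by exact_mod_cast hs
  set t : ℕ := ⌈ε * s⌉₊ with ht
  have ht1 : 1 ≤ t := Nat.one_le_iff_ne_zero.mpr (Nat.ceil_pos.mpr (by positivity)).ne'
  by_cases hsmall : ∃ i, #(P i) < t
  · obtain ⟨i, hi⟩ := hsmall
    have hi' : (#(P i) : ℝ) ≤ ε * s := (Nat.lt_ceil.mp hi).le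
    have h3 : (#(Fintype.piFinset P) : ℝ) ≤ ε * #(Fintype.piFinset V) := by
      rw [Fintype.card_piFinset, Fintype.card_piFinset, ← mul_prod_erase univ _ (mem_univ i),
        ← mul_prod_erase univ (fun i => #(V i)) (mem_univ i), hVs i]
      rw [Nat.cast_mul, Nat.cast_mul, ← mul_assoc]
      refine mul_le_mul hi' ?_ (Nat.cast_nonneg _) (by positivity)
      exact_mod_cast prod_le_prod' fun j _ => card_le_card (hPV j)
    have : (0 : ℝ) ≤ ∑ e ∈ powersetCard 3 I, (#{x ∈ Fintype.piFinset P | e.image x ∈ E} : ℝ) :=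
      sum_nonneg fun _ _ => Nat.cast_nonneg _
    linarith
  · push Not at hsmall
    have key := sum_piFinset_nonneg_of_subboxes ht1 hsmall
      (fun x => ∑ e ∈ powersetCard 3 I, (if e.image x ∈ E then (1 : ℝ) else 0) - 1) ?_
    · rw [sum_sum_ite_image_mem_sub_one] at key
      have : (0 : ℝ) ≤ ε * #(Fintype.piFinset V) := mul_nonneg hε.le (Nat.cast_nonneg _)
      linarith
    · intro Q hQ
      have hQ' : ∀ i, Q i ⊆ P i ∧ #(Q i) = t := fun i =>
        mem_powersetCard.mp (Fintype.mem_piFinset.mp hQ i)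
      rw [sum_sum_ite_image_mem_sub_one]
      refine sub_nonneg.mpr (card_box_le_sum_of_isDense hd hL4 hL ht1 (fun i => (hQ' i).2)
        (fun i j hij => (hV i j hij).mono ((hQ' i).1.trans (hPV i)) ((hQ' j).1.trans (hPV j)))
        ((hμ hR).trans ?_) hE hIc)
      gcongr
      exact Nat.le_ceil _

end boxes

/-- Dense hypergraphs are polarized with respect to suitable parts. -/
lemma exists_isPolarized {k : ℕ} (hk : 3 ≤ k) {d : ℝ} (hd : 0 < d) :
    ∃ L : ℕ, k ≤ L ∧ ∃ d' : ℝ, 0 < d' ∧ ∀ (R : ℕ) (ε : ℝ), 0 < ε → ∃ μ : ℝ, 0 < μ ∧ ∃ n₀ : ℕ,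
      ∀ n, n₀ ≤ n → ∀ E : Finset (Finset (Fin n)), IsDense k (k - 2) n d μ E →
        ∃ V, IsPolarized k L R n d' ε V E := by
  rcases hk.eq_or_lt with rfl | hk
  · obtain ⟨L, hL⟩ := exists_nat_ge (72 / d)
    have hL' : 72 ≤ d * (L + 4 : ℕ) := by
      rw [div_le_iff₀ hd] at hL
      push_cast
      nlinarith
    refine ⟨L + 4, by omega, 1, one_pos, fun R ε hε => ⟨(ε / (2 * R + 1)) ^ 3, by positivity,
      max R 1, fun n hn E hE => ?_⟩⟩
    obtain ⟨s, V, hs, hVs, hV, hns⟩ := exists_equal_disjoint_parts R n (by omega)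
    refine ⟨V, isPolarized_three_of_isDense hd hε (by omega) hL' hs hVs hV (fun hR => ?_) hE⟩
    rw [← mul_pow]
    have h1 : (n : ℝ) ≤ (2 * R + 1) * s := by
      have : n ≤ (2 * R + 1) * s := (hns hR).trans (by gcongr; omega)
      exact_mod_cast this
    refine pow_le_pow_left₀ (by positivity) ?_ 3
    rw [div_mul_eq_mul_div, div_le_iff₀ (by positivity)]
    nlinarith
  · refine ⟨k, le_rfl, d, hd, fun R ε hε => ⟨ε / (2 * R + 1) ^ k, by positivity,
      max R 1, fun n hn E hE => ?_⟩⟩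
    obtain ⟨s, V, hs, hVs, hV, hns⟩ := exists_equal_disjoint_parts R n (by omega)
    refine ⟨V, isPolarized_of_isDense_large hk hs hVs hV (fun hR => ?_) hE⟩
    have h1 : (n : ℝ) ≤ (2 * R + 1) * s := by
      have : n ≤ (2 * R + 1) * s := (hns hR).trans (by gcongr; omega)
      exact_mod_cast this
    rw [div_mul_eq_mul_div, div_le_iff₀ (by positivity), mul_assoc, ← mul_pow, mul_comm (s : ℝ)]
    gcongr

end counting

section limits
open Finset MeasureTheory
open scoped ENNReal

section condExp
variable {Ω : Type*} {m m₁ m₂ m₀ : MeasurableSpace Ω} {P : Measure Ω}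

/-- Measurable functions bounded by one. -/
def IsUnitBdd {m₀ : MeasurableSpace Ω} (P : Measure Ω) (f : Ω → ℝ) : Prop :=
  AEStronglyMeasurable f P ∧ ∀ᵐ x ∂P, |f x| ≤ 1

lemma IsUnitBdd.integrable [IsProbabilityMeasure P] {f : Ω → ℝ} (hf : IsUnitBdd P f) :
    Integrable f P :=
  .of_bound hf.1 1 hf.2

lemma IsUnitBdd.mul {f g : Ω → ℝ} (hf : IsUnitBdd P f) (hg : IsUnitBdd P g) :
    IsUnitBdd P (f * g) := by
  refine ⟨hf.1.mul hg.1, ?_⟩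
  filter_upwards [hf.2, hg.2] with x h1 h2
  rw [Pi.mul_apply, abs_mul]
  exact mul_le_one₀ h1 (abs_nonneg _) h2

lemma isUnitBdd_one : IsUnitBdd P 1 := ⟨aestronglyMeasurable_const, by simp⟩

lemma isUnitBdd_prod {ι : Type*} (s : Finset ι) {f : ι → Ω → ℝ}
    (hf : ∀ i ∈ s, IsUnitBdd P (f i)) : IsUnitBdd P (∏ i ∈ s, f i) :=
  prod_induction f (IsUnitBdd P) (fun _ _ => IsUnitBdd.mul) isUnitBdd_one hf

lemma IsUnitBdd.condExp {f : Ω → ℝ} (hf : IsUnitBdd P f) (hm : m ≤ m₀) :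
    IsUnitBdd P (P[f | m]) :=
  ⟨(stronglyMeasurable_condExp.mono hm).aestronglyMeasurable,
    ae_bdd_abs_condExp_of_ae_bdd_abs hf.2⟩

lemma isUnitBdd_indicator {s : Set Ω} (hs : MeasurableSet s) :
    IsUnitBdd P (s.indicator fun _ => 1) :=
  ⟨(stronglyMeasurable_const.indicator hs).aestronglyMeasurable, .of_forall fun x => by
    by_cases h : x ∈ s <;> simp [h]⟩

lemma integral_mul_condExp [IsProbabilityMeasure P] {f g : Ω → ℝ}
    (hf : IsUnitBdd P f) (hg : IsUnitBdd P g)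
    (hm : m ≤ m₀) (hgm : StronglyMeasurable[m] g) :
    ∫ x, (f * g) x ∂P = ∫ x, (P[f | m] * g) x ∂P := by
  rw [← integral_condExp hm]
  exact integral_congr_ae
    (condExp_mul_of_stronglyMeasurable_right hgm (hf.mul hg).integrable hf.integrable)

/-- If a measure preserving map fixes `f` and pulls `m₁` back into `m₂ ≤ m₁`, then conditioning
`f` on `m₁` is the same as conditioning it on `m₂`. -/
lemma condExp_ae_eq_of_measurePreserving [IsProbabilityMeasure P] (h₂₁ : m₂ ≤ m₁)
    (h₁ : m₁ ≤ m₀) {T : Ω → Ω} (hT : MeasurePreserving T P P) (hTm : Measurable[m₂, m₁] T)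
    {f : Ω → ℝ} (hf : IsUnitBdd P f) (hfT : ∀ x, f (T x) = f x) :
    P[f | m₁] =ᵐ[P] P[f | m₂] := by
  set u : Ω → ℝ := P[f | m₁] with hu
  have hum : StronglyMeasurable[m₁] u := stronglyMeasurable_condExp
  set w : Ω → ℝ := u ∘ T with hw
  have hwm : StronglyMeasurable[m₂] w := hum.comp_measurable hTm
  have hub : IsUnitBdd P u := hf.condExp h₁
  have hwb : IsUnitBdd P w :=
    ⟨(hwm.mono (h₂₁.trans h₁)).aestronglyMeasurable, hT.quasiMeasurePreserving.ae hub.2⟩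
  have hcomp : ∀ g : Ω → ℝ, AEStronglyMeasurable g P → ∫ x, g (T x) ∂P = ∫ x, g x ∂P := by
    intro g hg
    rw [← integral_map hT.measurable.aemeasurable (by rwa [hT.map_eq]), hT.map_eq]
  have e1 : ∫ x, (w * w) x ∂P = ∫ x, (u * u) x ∂P := hcomp (u * u) (hub.mul hub).1
  have e2 : ∫ x, (f * w) x ∂P = ∫ x, (f * u) x ∂P := by
    rw [← hcomp (f * u) (hf.mul hub).1]
    simp only [Pi.mul_apply, hfT, hw, Function.comp_apply]
  have e3 : ∫ x, (f * w) x ∂P = ∫ x, (u * w) x ∂P :=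
    integral_mul_condExp hf hwb h₁ (hwm.mono h₂₁)
  have e4 : ∫ x, (f * u) x ∂P = ∫ x, (u * u) x ∂P := integral_mul_condExp hf hub h₁ hum
  have e5 : ∫ x, (u x - w x) ^ 2 ∂P = 0 := by
    have : ∀ x, (u x - w x) ^ 2 = ((u * u) x - 2 * (u * w) x) + (w * w) x := fun x => by
      simp only [Pi.mul_apply]; ring
    simp_rw [this]
    rw [integral_add (f := fun x => (u * u) x - 2 * (u * w) x)
      ((hub.mul hub).integrable.sub ((hub.mul hwb).integrable.const_mul 2))
      (hwb.mul hwb).integrable, integral_sub (hub.mul hub).integrable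
      ((hub.mul hwb).integrable.const_mul 2), integral_const_mul]
    linarith
  have huw : u =ᵐ[P] w := by
    have hsq_int : Integrable (fun x => (u x - w x) ^ 2) P := by
      have : (fun x => (u x - w x) ^ 2) = u * u - (fun x => 2 * (u * w) x) + w * w := by
        ext x; simp only [Pi.mul_apply, Pi.add_apply, Pi.sub_apply]; ring
      rw [this]
      exact ((hub.mul hub).integrable.sub ((hub.mul hwb).integrable.const_mul 2)).add
        (hwb.mul hwb).integrable
    have h0 := (integral_eq_zero_iff_of_nonneg (fun x => sq_nonneg (u x - w x)) hsq_int).mp e5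
    filter_upwards [h0] with x hx
    have : (u x - w x) ^ 2 = 0 := hx
    nlinarith [sq_nonneg (u x - w x)]
  calc u =ᵐ[P] w := huw
    _ = P[w | m₂] := (condExp_of_stronglyMeasurable (h₂₁.trans h₁) hwm hwb.integrable).symm
    _ =ᵐ[P] P[u | m₂] := condExp_congr_ae huw.symm
    _ =ᵐ[P] P[f | m₂] := condExp_condExp_of_le h₂₁ h₁

end condExp

section limitSpace
variable {R : ℕ}

/-- Configurations: truth values for all finite sets of vertices `(i, a)`, the vertex `(i, a)`
standing for the `a`-th sample from the `i`-th part. -/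
abbrev Config (R : ℕ) : Type := Finset (Fin R × ℕ) → Bool

/-- The σ-algebra on configurations generated by the coordinates in `𝒮`. -/
def coordSigma (𝒮 : Set (Finset (Fin R × ℕ))) : MeasurableSpace (Config R) :=
  ⨆ K ∈ 𝒮, MeasurableSpace.comap (fun X : Config R => X K) ⊤

lemma coordSigma_mono {𝒮 𝒯 : Set (Finset (Fin R × ℕ))} (h : 𝒮 ⊆ 𝒯) :
    coordSigma 𝒮 ≤ coordSigma 𝒯 :=
  biSup_mono fun _ hK => h hK

lemma coordSigma_le (𝒮 : Set (Finset (Fin R × ℕ))) :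
    coordSigma 𝒮 ≤ (inferInstance : MeasurableSpace (Config R)) :=
  iSup₂_le fun K _ => (measurable_pi_apply K).comap_le

lemma measurable_coord {𝒮 : Set (Finset (Fin R × ℕ))} {K : Finset (Fin R × ℕ)} (hK : K ∈ 𝒮) :
    Measurable[coordSigma 𝒮] fun X : Config R => X K :=
  Measurable.of_comap_le (le_biSup (fun K => MeasurableSpace.comap (fun X : Config R => X K) ⊤) hK)

lemma measurable_to_coordSigma {α : Type*} [MeasurableSpace α]
    {𝒮 : Set (Finset (Fin R × ℕ))} {g : α → Config R}
    (hg : ∀ K ∈ 𝒮, Measurable fun x => g x K) : Measurable[_, coordSigma 𝒮] g := by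
  rw [measurable_iff_comap_le, coordSigma, MeasurableSpace.comap_iSup]
  refine iSup_le fun K => ?_
  rw [MeasurableSpace.comap_iSup]
  refine iSup_le fun hK => ?_
  rw [MeasurableSpace.comap_comp]
  exact (hg K hK).comap_le

/-- The indices of the vertices of level `0` in `K`. -/
def mainIdx (K : Finset (Fin R × ℕ)) : Finset (Fin R) :=
  {i | (i, 0) ∈ K}

/-- The set of level-`0` vertices with index in `e`. -/
def baseSet (e : Finset (Fin R)) : Finset (Fin R × ℕ) :=
  e.image fun i => (i, 0)

lemma mem_mainIdx {K : Finset (Fin R × ℕ)} {i : Fin R} : i ∈ mainIdx K ↔ (i, 0) ∈ K := by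
  simp [mainIdx]

lemma mainIdx_baseSet (e : Finset (Fin R)) : mainIdx (baseSet e) = e := by
  ext i; simp [mem_mainIdx, baseSet]

/-- Coordinates whose main part belongs to `𝒟`. -/
def mainSigma (𝒟 : Set (Finset (Fin R))) : MeasurableSpace (Config R) :=
  coordSigma {K | mainIdx K ∈ 𝒟}

lemma mainSigma_mono {𝒟 𝒟' : Set (Finset (Fin R))} (h : 𝒟 ⊆ 𝒟') :
    mainSigma 𝒟 ≤ mainSigma 𝒟' :=
  coordSigma_mono fun _ hK => h hK

lemma mainSigma_le (𝒟 : Set (Finset (Fin R))) :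
    mainSigma 𝒟 ≤ (inferInstance : MeasurableSpace (Config R)) :=
  coordSigma_le _

/-- Coordinates with main part inside `A` and levels at most `a`. -/
def boundedCoords (A : Finset (Fin R)) (a : ℕ) : Set (Finset (Fin R × ℕ)) :=
  {K | mainIdx K ⊆ A ∧ ∀ v ∈ K, v.2 ≤ a}

/-- Renaming of vertices. -/
def renameVertices (τ : Fin R × ℕ → Fin R × ℕ) (X : Config R) : Config R := fun K => X (K.image τ)

lemma measurable_renameVertices (τ : Fin R × ℕ → Fin R × ℕ) : Measurable (renameVertices τ) :=
  measurable_pi_iff.mpr fun K => measurable_pi_apply (K.image τ)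

/-- Invariance under level-permuting renamings. -/
def IsRenameInvariant (P : Measure (Config R)) : Prop :=
  ∀ τ : Fin R × ℕ → Fin R × ℕ, Function.Injective τ → (∀ v, (τ v).1 = v.1) →
    P.map (renameVertices τ) = P

/-- The renaming that moves the main vertices with index outside `A` to level `a + 1`. -/
def pushOut (A : Finset (Fin R)) (a : ℕ) (v : Fin R × ℕ) : Fin R × ℕ :=
  if v.1 ∈ A then v else
    (v.1, if v.2 = 0 then a + 1 else if v.2 ≤ a then v.2 else v.2 + 1)

lemma pushOut_fst (A : Finset (Fin R)) (a : ℕ) (v : Fin R × ℕ) : (pushOut A a v).1 = v.1 := by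
  unfold pushOut; split_ifs <;> rfl

lemma pushOut_injective (A : Finset (Fin R)) (a : ℕ) : Function.Injective (pushOut A a) := by
  rintro ⟨i, x⟩ ⟨j, y⟩ h
  have hij : i = j := by
    have := congrArg Prod.fst h
    rwa [pushOut_fst, pushOut_fst] at this
  subst hij
  have h2 := congrArg Prod.snd h
  simp only [pushOut] at h2
  ext
  · rfl
  · simp only
    split_ifs at h2 <;> simp only at h2 <;> omega

lemma pushOut_eq_self {A : Finset (Fin R)} {a : ℕ} {K : Finset (Fin R × ℕ)}
    (hK : K ∈ boundedCoords A a) : K.image (pushOut A a) = K := by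
  conv_rhs => rw [← image_id (s := K)]
  refine image_congr fun v hv => ?_
  by_cases hA : v.1 ∈ A
  · simp [pushOut, hA]
  · have h0 : v.2 ≠ 0 := fun h => hA (hK.1 (mem_mainIdx.mpr (by rw [← h]; exact hv)))
    have ha := hK.2 v hv
    simp [pushOut, hA, h0, ha]

lemma mainIdx_image_pushOut (A : Finset (Fin R)) (a : ℕ) (K : Finset (Fin R × ℕ)) :
    mainIdx (K.image (pushOut A a)) = mainIdx K ∩ A := by
  ext i
  simp only [mem_mainIdx, mem_image, mem_inter]
  constructor
  · rintro ⟨⟨j, x⟩, hv, h⟩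
    have hj : j = i := by
      have := congrArg Prod.fst h
      rwa [pushOut_fst] at this
    subst hj
    have h2 : (pushOut A a (j, x)).2 = 0 := congrArg Prod.snd h
    by_cases hA : j ∈ A
    · simp only [pushOut, hA, if_true] at h2
      subst h2
      exact ⟨hv, hA⟩
    · simp only [pushOut, hA, if_false] at h2
      split_ifs at h2
      omega
  · rintro ⟨h1, h2⟩
    exact ⟨(i, 0), h1, by simp [pushOut, h2]⟩

lemma renameVertices_eq_of_bounded {A : Finset (Fin R)} {a : ℕ} {s : Set (Config R)}
    (hs : MeasurableSet[coordSigma (boundedCoords A a)] s) :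
    renameVertices (pushOut A a) ⁻¹' s = s := by
  have hle : coordSigma (boundedCoords A a)
      ≤ MeasurableSpace.invariants (renameVertices (R := R) (pushOut A a)) := by
    refine iSup₂_le fun K hK => ?_
    rintro t ⟨b, -, rfl⟩
    refine ⟨measurable_pi_apply K (MeasurableSet.of_discrete (s := b)), ?_⟩
    rw [← Set.preimage_comp]
    congr 1
    ext X
    simp only [Function.comp_apply, renameVertices, pushOut_eq_self hK]
  exact (hle s hs).2

/-- A bounded event over `A` sees only the main coordinates strictly inside `A`. -/
lemma condExp_indicator_eq {P : Measure (Config R)} [IsProbabilityMeasure P]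
    (hP : IsRenameInvariant P) {A : Finset (Fin R)} {a : ℕ}
    {s : Set (Config R)} (hs : MeasurableSet[coordSigma (boundedCoords A a)] s)
    {𝒟 : Set (Finset (Fin R))} (h₁ : ∀ B ∈ 𝒟, ¬ A ⊆ B) (h₂ : ∀ B, B ⊂ A → B ∈ 𝒟) :
    P[s.indicator fun _ => (1 : ℝ) | mainSigma 𝒟]
      =ᵐ[P] P[s.indicator fun _ => (1 : ℝ) | mainSigma {B | B ⊂ A}] := by
  refine condExp_ae_eq_of_measurePreserving (mainSigma_mono fun B hB => h₂ B hB) (mainSigma_le _)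
    (T := renameVertices (pushOut A a))
    ⟨measurable_renameVertices _, hP _ (pushOut_injective A a) (pushOut_fst A a)⟩ ?_
    (isUnitBdd_indicator (coordSigma_le _ s hs)) fun X => ?_
  · refine @measurable_to_coordSigma R (Config R) (mainSigma {B | B ⊂ A}) _ _ fun K hK => ?_
    refine measurable_coord ?_
    change mainIdx (K.image (pushOut A a)) ⊂ A
    rw [mainIdx_image_pushOut]
    refine (inter_subset_right).ssubset_of_ne fun h => h₁ _ hK (inter_eq_right.mp h)
  · have := congrArg (fun t => X ∈ t) (renameVertices_eq_of_bounded hs)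
    simp only [Set.mem_preimage, eq_iff_iff] at this
    by_cases h : X ∈ s
    · simp [h, this.mpr h]
    · simp [h, mt this.mp h]

end limitSpace

section limitObject
variable {R k : ℕ}

/-- The event that the level-`0` vertices indexed by `e` form an edge. -/
def edgeEvent (e : Finset (Fin R)) : Set (Config R) := {X | X (baseSet e) = true}

/-- The indicator of `edgeEvent e`. -/
def edgeFn (e : Finset (Fin R)) : Config R → ℝ := (edgeEvent e).indicator fun _ => 1

/-- The conditional probability of `edgeEvent e` given everything strictly below `e`. -/
def linkFn (P : Measure (Config R)) (e : Finset (Fin R)) : Config R → ℝ :=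
  P[edgeFn e | mainSigma {B | B ⊂ e}]

/-- The σ-algebra of coordinates with at most `k - 2` main vertices. -/
def lowSigma (R k : ℕ) : MeasurableSpace (Config R) := mainSigma {B | #B ≤ k - 2}

lemma lowSigma_le : lowSigma R k ≤ (inferInstance : MeasurableSpace (Config R)) := mainSigma_le _

lemma baseSet_mem_boundedCoords (e : Finset (Fin R)) : baseSet e ∈ boundedCoords e 0 := by
  refine ⟨(mainIdx_baseSet e).le, fun v hv => ?_⟩
  obtain ⟨i, -, rfl⟩ := mem_image.mp hv
  exact le_rfl

lemma measurableSet_coord_eq_true {𝒮 : Set (Finset (Fin R × ℕ))} {K : Finset (Fin R × ℕ)}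
    (hK : K ∈ 𝒮) : MeasurableSet[coordSigma 𝒮] {X : Config R | X K = true} :=
  measurable_coord hK (MeasurableSet.of_discrete (s := {true}))

lemma measurableSet_edgeEvent_bounded (e : Finset (Fin R)) :
    MeasurableSet[coordSigma (boundedCoords e 0)] (edgeEvent e) :=
  measurableSet_coord_eq_true (baseSet_mem_boundedCoords e)

lemma measurableSet_edgeEvent (e : Finset (Fin R)) : MeasurableSet (edgeEvent e) :=
  coordSigma_le _ _ (measurableSet_edgeEvent_bounded e)

variable {P : Measure (Config R)} [IsProbabilityMeasure P]

lemma isUnitBdd_edgeFn (P : Measure (Config R)) (e : Finset (Fin R)) : IsUnitBdd P (edgeFn e) :=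
  isUnitBdd_indicator (measurableSet_edgeEvent e)

lemma isUnitBdd_linkFn (P : Measure (Config R)) (e : Finset (Fin R)) :
    IsUnitBdd P (linkFn P e) :=
  (isUnitBdd_edgeFn P e).condExp (mainSigma_le _)

lemma linkFn_ae_eq (hP : IsRenameInvariant P) (e : Finset (Fin R)) :
    P[edgeFn e | mainSigma {B | ¬ e ⊆ B}] =ᵐ[P] linkFn P e :=
  condExp_indicator_eq hP (measurableSet_edgeEvent_bounded e) (fun _ h => h)
    fun _ h => h.2

lemma condExp_linkFn (hP : IsRenameInvariant P) (hk : 2 ≤ k) {e : Finset (Fin R)}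
    (he : #e = k) :
    P[linkFn P e | lowSigma R k] =ᵐ[P] P[edgeFn e | lowSigma R k] := by
  refine (condExp_congr_ae (linkFn_ae_eq hP e).symm).trans (condExp_condExp_of_le
    (mainSigma_mono fun B (hB : #B ≤ k - 2) h => ?_) (mainSigma_le _))
  have := card_le_card h
  omega

lemma integral_prod_edgeFn_mul (hP : IsRenameInvariant P) (𝓔 : Finset (Finset (Fin R))) :
    ∀ 𝓔' : Finset (Finset (Fin R)), (∀ e ∈ 𝓔, #e = k) → (∀ e ∈ 𝓔', #e = k) → Disjoint 𝓔 𝓔' →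
    ∫ X, ((∏ e ∈ 𝓔, edgeFn e) * ∏ e ∈ 𝓔', linkFn P e) X ∂P
      = ∫ X, (∏ e ∈ 𝓔 ∪ 𝓔', linkFn P e) X ∂P := by
  induction 𝓔 using Finset.induction_on with
  | empty => intro 𝓔' _ _ _; simp
  | insert e 𝓔 he ih =>
    intro 𝓔' h h' hd
    rw [disjoint_insert_left] at hd
    have hne : ∀ e' ∈ 𝓔 ∪ 𝓔', ¬ e ⊆ e' := by
      intro e' he' hsub
      have hc : #e' = k := (mem_union.mp he').elim (fun h1 => h e' (mem_insert_of_mem h1)) (h' e')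
      have : e = e' := eq_of_subset_of_card_le hsub (by rw [hc, h e (mem_insert_self _ _)])
      subst this
      exact (mem_union.mp he').elim he hd.1
    set G : Config R → ℝ := (∏ e ∈ 𝓔, edgeFn e) * ∏ e ∈ 𝓔', linkFn P e with hG
    have hGb : IsUnitBdd P G := (isUnitBdd_prod _ fun e _ => isUnitBdd_edgeFn P e).mul
      (isUnitBdd_prod _ fun e _ => isUnitBdd_linkFn P e)
    have hGm : StronglyMeasurable[mainSigma {B | ¬ e ⊆ B}] G := by
      refine StronglyMeasurable.mul (Finset.stronglyMeasurable_prod _ fun e' he' => ?_)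
        (Finset.stronglyMeasurable_prod _ fun e' he' => ?_)
      · refine StronglyMeasurable.indicator (@stronglyMeasurable_const _ _ (_) _ _) ?_
        refine measurableSet_coord_eq_true ?_
        change ¬ e ⊆ mainIdx (baseSet e')
        rw [mainIdx_baseSet]
        exact hne e' (mem_union_left _ he')
      · exact stronglyMeasurable_condExp.mono (mainSigma_mono fun B hB h =>
          hne e' (mem_union_right _ he') (h.trans hB.1))
    have e1 : (∏ e ∈ insert e 𝓔, edgeFn e) * ∏ e ∈ 𝓔', linkFn P e = edgeFn e * G := by
      rw [prod_insert he, mul_assoc]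
    have e2 : (∏ e ∈ 𝓔, edgeFn e) * ∏ e ∈ insert e 𝓔', linkFn P e = linkFn P e * G := by
      rw [prod_insert hd.1, hG]; ring
    rw [e1, integral_mul_condExp (isUnitBdd_edgeFn P e) hGb (mainSigma_le _) hGm]
    have e3 : ∫ X, (P[edgeFn e | mainSigma {B | ¬ e ⊆ B}] * G) X ∂P
        = ∫ X, (linkFn P e * G) X ∂P := by
      refine integral_congr_ae ?_
      filter_upwards [linkFn_ae_eq hP e] with X hX
      rw [Pi.mul_apply, Pi.mul_apply, hX]
    rw [e3, ← e2, ih (insert e 𝓔') (fun e' he' => h e' (mem_insert_of_mem he')) ?_ ?_]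
    · rw [insert_union, union_insert]
    · intro e' he'
      rcases mem_insert.mp he' with rfl | he'
      · exact h _ (mem_insert_self _ _)
      · exact h' e' he'
    · exact disjoint_insert_right.mpr ⟨he, hd.2⟩

lemma integral_prod_edgeFn (hP : IsRenameInvariant P) {𝓔 : Finset (Finset (Fin R))}
    (h : ∀ e ∈ 𝓔, #e = k) :
    ∫ X, (∏ e ∈ 𝓔, edgeFn e) X ∂P = ∫ X, (∏ e ∈ 𝓔, linkFn P e) X ∂P := by
  simpa using integral_prod_edgeFn_mul hP 𝓔 ∅ h (by simp) (by simp)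

/-- If the conditional probabilities of the edges in `𝓔` are simultaneously positive with positive
probability, then all edges of `𝓔` are simultaneously present with positive probability. -/
lemma measure_edgeEvents_pos (hP : IsRenameInvariant P) {𝓔 : Finset (Finset (Fin R))}
    (h : ∀ e ∈ 𝓔, #e = k) (hpos : 0 < P {X | ∀ e ∈ 𝓔, 0 < linkFn P e X}) :
    0 < P {X | ∀ e ∈ 𝓔, X (baseSet e) = true} := by
  have hlink : 0 < ∫ X, (∏ e ∈ 𝓔, linkFn P e) X ∂P := by
    have hnn : 0 ≤ᵐ[P] ∏ e ∈ 𝓔, linkFn P e := by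
      have : ∀ᵐ X ∂P, ∀ e ∈ 𝓔, 0 ≤ linkFn P e X := by
        rw [Filter.eventually_all_finset]
        intro e _
        exact condExp_nonneg (.of_forall fun X => Set.indicator_nonneg (fun _ _ => zero_le_one) X)
      filter_upwards [this] with X hX
      rw [prod_apply]
      exact prod_nonneg hX
    rw [integral_pos_iff_support_of_nonneg_ae hnn
      (isUnitBdd_prod _ fun e _ => isUnitBdd_linkFn P e).integrable]
    refine hpos.trans_le (measure_mono fun X hX => ?_)
    rw [Function.mem_support, prod_apply]
    exact (prod_pos hX).ne'
  rw [← integral_prod_edgeFn hP h] at hlink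
  by_contra hz
  rw [not_lt, nonpos_iff_eq_zero] at hz
  refine hlink.ne' (integral_eq_zero_of_ae ?_)
  have : ∀ᵐ X ∂P, X ∉ {X : Config R | ∀ e ∈ 𝓔, X (baseSet e) = true} :=
    measure_eq_zero_iff_ae_notMem.mp hz
  filter_upwards [this] with X hX
  push Not at hX
  obtain ⟨e, he, hXe⟩ := hX
  rw [prod_apply]
  exact prod_eq_zero he (Set.indicator_of_notMem (s := edgeEvent e) hXe _)

/-- The coordinates visible through a `(k - 1)`-set `T`, up to level `a`. -/
def sideCoords (k : ℕ) (T : Finset (Fin R)) (a : ℕ) : Set (Finset (Fin R × ℕ)) :=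
  {K | #T = k - 1 ∧ K ∈ boundedCoords T a}

lemma condExp_mul_eq_mul_of_side (hP : IsRenameInvariant P) (hk : 2 ≤ k) {a : ℕ}
    {T : Finset (Fin R)} {s : Set (Config R)} (hs : MeasurableSet[coordSigma (sideCoords k T a)] s)
    {G : Config R → ℝ} (hGb : IsUnitBdd P G)
    (hGm : #T = k - 1 → StronglyMeasurable[mainSigma {B | ¬ T ⊆ B}] G) :
    P[(s.indicator fun _ => (1 : ℝ)) * G | lowSigma R k]
      =ᵐ[P] P[s.indicator fun _ => (1 : ℝ) | lowSigma R k] * P[G | lowSigma R k] := by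
  set f : Config R → ℝ := s.indicator fun _ => (1 : ℝ) with hf
  have hfb : IsUnitBdd P f := isUnitBdd_indicator (coordSigma_le _ _ hs)
  by_cases hT : #T = k - 1
  · have hs' : MeasurableSet[coordSigma (boundedCoords T a)] s :=
      coordSigma_mono (fun K hK => hK.2) _ hs
    have hlow : ∀ B : Finset (Fin R), #B ≤ k - 2 → ¬ T ⊆ B := fun B hB h => by
      have := card_le_card h; omega
    have h1 : P[f | mainSigma {B | ¬ T ⊆ B}] =ᵐ[P] P[f | lowSigma R k] :=
      (condExp_indicator_eq hP hs' (fun _ h => h) fun _ h => h.2).trans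
        (condExp_indicator_eq hP hs' hlow fun B hB => by
          have := card_lt_card hB
          change #B ≤ k - 2
          omega).symm
    have hle : lowSigma R k ≤ mainSigma {B | ¬ T ⊆ B} := mainSigma_mono hlow
    calc P[f * G | lowSigma R k]
        =ᵐ[P] P[P[f * G | mainSigma {B | ¬ T ⊆ B}] | lowSigma R k] :=
          (condExp_condExp_of_le hle (mainSigma_le _)).symm
      _ =ᵐ[P] P[P[f | lowSigma R k] * G | lowSigma R k] := by
          refine condExp_congr_ae ((condExp_mul_of_stronglyMeasurable_right (hGm hT)
            (hfb.mul hGb).integrable hfb.integrable).trans ?_)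
          filter_upwards [h1] with X hX
          rw [Pi.mul_apply, Pi.mul_apply, hX]
      _ =ᵐ[P] P[f | lowSigma R k] * P[G | lowSigma R k] :=
          condExp_mul_of_stronglyMeasurable_left stronglyMeasurable_condExp
            ((hfb.condExp lowSigma_le).mul hGb).integrable hGb.integrable
  · have hs' : MeasurableSet[lowSigma R k] s :=
      coordSigma_mono (fun K hK => absurd hK.1 hT) _ hs
    have hfm : StronglyMeasurable[lowSigma R k] f :=
      StronglyMeasurable.indicator (@stronglyMeasurable_const _ _ (_) _ _) hs'
    rw [condExp_of_stronglyMeasurable lowSigma_le hfm hfb.integrable]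
    exact condExp_mul_of_stronglyMeasurable_left hfm (hfb.mul hGb).integrable hGb.integrable

/-- Bounded events over different `(k - 1)`-sets are conditionally independent. -/
lemma condExp_prod_side (hP : IsRenameInvariant P) (hk : 2 ≤ k) {a : ℕ}
    {s : Finset (Fin R) → Set (Config R)}
    (hs : ∀ T, MeasurableSet[coordSigma (sideCoords k T a)] (s T)) (𝒯 : Finset (Finset (Fin R))) :
    P[∏ T ∈ 𝒯, (s T).indicator fun _ => (1 : ℝ) | lowSigma R k]
      =ᵐ[P] ∏ T ∈ 𝒯, P[(s T).indicator fun _ => (1 : ℝ) | lowSigma R k] := by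
  induction 𝒯 using Finset.induction_on with
  | empty =>
    rw [prod_empty, prod_empty]
    exact .of_eq (condExp_const lowSigma_le (1 : ℝ))
  | insert T 𝒯 hT ih =>
    rw [prod_insert hT, prod_insert hT]
    refine (condExp_mul_eq_mul_of_side hP hk (hs T) (isUnitBdd_prod _ fun T' _ =>
      isUnitBdd_indicator (coordSigma_le _ _ (hs T'))) fun hTk => ?_).trans ?_
    · refine Finset.stronglyMeasurable_prod _ fun T' hT' => ?_
      refine StronglyMeasurable.indicator (@stronglyMeasurable_const _ _ (_) _ _)
        (coordSigma_mono ?_ _ (hs T'))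
      rintro K ⟨hT'k, hK, -⟩ hTK
      have : T = T' := eq_of_subset_of_card_le (Subset.trans hTK hK) (by omega)
      exact hT (this ▸ hT')
    · filter_upwards [ih] with X hX
      rw [Pi.mul_apply, Pi.mul_apply, hX]

end limitObject

section limitDensity
variable {R k : ℕ}

/-- The coordinates with at most `k - 2` main vertices and levels at most `n`. -/
def lowCoords (R k n : ℕ) : Set (Finset (Fin R × ℕ)) :=
  {K | #(mainIdx K) ≤ k - 2 ∧ ∀ v ∈ K, v.2 ≤ n}

/-- The filtration of `lowSigma` by levels. -/
def lowFiltration (R k : ℕ) : Filtration ℕ (inferInstance : MeasurableSpace (Config R)) where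
  seq n := coordSigma (lowCoords R k n)
  mono' _ _ h := coordSigma_mono fun _ hK => ⟨hK.1, fun v hv => (hK.2 v hv).trans h⟩
  le' _ := coordSigma_le _

lemma iSup_lowFiltration : ⨆ n, lowFiltration R k n = lowSigma R k := by
  refine le_antisymm (iSup_le fun n => coordSigma_mono fun K hK => hK.1) ?_
  refine iSup₂_le fun K hK => le_iSup_of_le (K.sup Prod.snd) ?_
  exact (measurable_coord (𝒮 := lowCoords R k (K.sup Prod.snd))
    ⟨hK, fun v hv => le_sup (f := Prod.snd) hv⟩).comap_le

lemma le_condExp_of_forall_le_setIntegral {Ω : Type*} {m m₀ : MeasurableSpace Ω} {P : Measure Ω}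
    [IsProbabilityMeasure P] (hm : m ≤ m₀) {f : Ω → ℝ} (hf : Integrable f P) {d : ℝ}
    (h : ∀ s, MeasurableSet[m] s → d * P.real s ≤ ∫ x in s, f x ∂P) :
    ∀ᵐ x ∂P, d ≤ P[f | m] x := by
  refine ae_of_ae_trim hm ?_
  refine ae_le_of_forall_setIntegral_le (integrable_const d)
    (integrable_condExp.trim hm stronglyMeasurable_condExp) fun s hs _ => ?_
  rw [← setIntegral_trim hm stronglyMeasurable_condExp hs, setIntegral_condExp hm hf hs]
  refine le_trans (le_of_eq ?_) (h s hs)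
  rw [setIntegral_const, smul_eq_mul, mul_comm, measureReal_def, measureReal_def,
    trim_measurableSet_eq hm hs]

variable {P : Measure (Config R)} [IsProbabilityMeasure P]

lemma ae_le_sum_condExp_edgeFn {I : Finset (Fin R)} {d : ℝ}
    (h : ∀ n, ∀ D, MeasurableSet[coordSigma (lowCoords R k n)] D →
      d * P.real D ≤ ∑ e ∈ powersetCard k I, P.real (D ∩ edgeEvent e)) :
    ∀ᵐ X ∂P, d ≤ ∑ e ∈ powersetCard k I, P[edgeFn e | lowSigma R k] X := by
  set f : Config R → ℝ := ∑ e ∈ powersetCard k I, edgeFn e with hf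
  have hfi : Integrable f P := integrable_finsetSum' _ fun e _ => (isUnitBdd_edgeFn P e).integrable
  have h1 : ∀ n, ∀ᵐ X ∂P, d ≤ P[f | lowFiltration R k n] X := fun n => by
    refine le_condExp_of_forall_le_setIntegral (coordSigma_le _) hfi fun s hs => ?_
    refine (h n s hs).trans (le_of_eq ?_)
    have hs' := coordSigma_le _ _ hs
    simp only [hf, Finset.sum_apply]
    rw [integral_finsetSum _ fun e _ => (isUnitBdd_edgeFn P e).integrable.integrableOn]
    refine sum_congr rfl fun e _ => ?_
    unfold edgeFn
    rw [setIntegral_indicator (measurableSet_edgeEvent e), setIntegral_const, smul_eq_mul, mul_one]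
  have h2 := tendsto_ae_condExp (μ := P) (ℱ := lowFiltration R k) f
  rw [iSup_lowFiltration] at h2
  have h3 : P[f | lowSigma R k] =ᵐ[P] ∑ e ∈ powersetCard k I, P[edgeFn e | lowSigma R k] :=
    condExp_finsetSum (fun e _ => (isUnitBdd_edgeFn P e).integrable) _
  filter_upwards [ae_all_iff.mpr h1, h2, h3] with X hX1 hX2 hX3
  rw [Finset.sum_apply] at hX3
  rw [← hX3]
  exact ge_of_tendsto' hX2 hX1

/-- Almost surely, the conditional edge densities are large on a large index set. -/
lemma ae_exists_dense_subset {L : ℕ} (hkL : k ≤ L) {d : ℝ} (M : ℕ) {R₀ : ℕ}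
    (hR₀ : ∀ (α : Type) (I : Finset α), R₀ ≤ #I → ∀ χ : Finset α → Prop,
      (∃ J ⊆ I, #J = M ∧ ∀ e ∈ powersetCard k J, χ e) ∨
        (∃ J ⊆ I, #J = L ∧ ∀ e ∈ powersetCard k J, ¬ χ e))
    (hR : R₀ ≤ R)
    (h : ∀ I ∈ powersetCard L (univ : Finset (Fin R)), ∀ n, ∀ D,
      MeasurableSet[coordSigma (lowCoords R k n)] D →
      d * P.real D ≤ ∑ e ∈ powersetCard k I, P.real (D ∩ edgeEvent e)) :
    ∀ᵐ X ∂P, ∃ J : Finset (Fin R), #J = M ∧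
      ∀ e ∈ powersetCard k J, d / L.choose k ≤ P[edgeFn e | lowSigma R k] X := by
  have h1 : ∀ᵐ X ∂P, ∀ I ∈ powersetCard L (univ : Finset (Fin R)),
      d ≤ ∑ e ∈ powersetCard k I, P[edgeFn e | lowSigma R k] X := by
    rw [Filter.eventually_all_finset]
    exact fun I hI => ae_le_sum_condExp_edgeFn (h I hI)
  filter_upwards [h1] with X hX
  rcases hR₀ (Fin R) univ (by rw [card_univ, Fintype.card_fin]; exact hR)
    (fun e => d / L.choose k ≤ P[edgeFn e | lowSigma R k] X) with ⟨J, -, hJ, hJe⟩ | ⟨J, -, hJ, hJe⟩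
  · exact ⟨J, hJ, hJe⟩
  · exfalso
    have hc : 0 < (L.choose k : ℝ) := by exact_mod_cast Nat.choose_pos hkL
    have hcard : #(powersetCard k J) = L.choose k := by rw [card_powersetCard, hJ]
    have hlt : ∑ e ∈ powersetCard k J, P[edgeFn e | lowSigma R k] X
        < ∑ e ∈ powersetCard k J, d / L.choose k := by
      refine sum_lt_sum_of_nonempty ?_ fun e he => not_le.mp (hJe e he)
      rw [← card_pos, hcard]
      exact Nat.choose_pos hkL
    rw [sum_const, hcard, nsmul_eq_mul, mul_div_cancel₀ _ hc.ne'] at hlt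
    exact absurd (hX J (mem_powersetCard.mpr ⟨subset_univ _, hJ⟩)) (not_le.mpr hlt)

end limitDensity

end limits

section sampling
open Finset MeasureTheory ProbabilityTheory
open scoped ENNReal

section sideView
variable {R k : ℕ}

/-- The configurations in which all coordinates from `𝒦` are true. -/
def trueCyl (𝒦 : Finset (Finset (Fin R × ℕ))) : Set (Config R) := {X | ∀ K ∈ 𝒦, X K = true}

lemma trueCyl_eq_biInter (𝒦 : Finset (Finset (Fin R × ℕ))) :
    trueCyl 𝒦 = ⋂ K ∈ 𝒦, {X : Config R | X K = true} := by
  ext X; simp [trueCyl]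

lemma measurableSet_trueCyl (𝒦 : Finset (Finset (Fin R × ℕ))) :
    MeasurableSet (trueCyl 𝒦) := by
  rw [trueCyl_eq_biInter]
  exact Finset.measurableSet_biInter _ fun K _ =>
    coordSigma_le Set.univ _ (measurableSet_coord_eq_true (Set.mem_univ K))

lemma isPiSystem_trueCyl : IsPiSystem (Set.range (trueCyl (R := R))) := by
  rintro _ ⟨𝒦, rfl⟩ _ ⟨𝒦', rfl⟩ -
  refine ⟨𝒦 ∪ 𝒦', ?_⟩
  ext X
  simp only [trueCyl, mem_union, Set.mem_ofPred_eq, Set.mem_inter_iff]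
  exact ⟨fun h => ⟨fun K hK => h K (Or.inl hK), fun K hK => h K (Or.inr hK)⟩,
    fun h K hK => hK.elim (h.1 K) (h.2 K)⟩

lemma generateFrom_trueCyl : MeasurableSpace.generateFrom (Set.range (trueCyl (R := R)))
    = (inferInstance : MeasurableSpace (Config R)) := by
  refine le_antisymm (MeasurableSpace.generateFrom_le ?_) ?_
  · rintro _ ⟨𝒦, rfl⟩
    exact measurableSet_trueCyl 𝒦
  · refine iSup_le fun K => Measurable.comap_le ?_
    refine @measurable_to_bool _ (_) _ ?_
    refine MeasurableSpace.measurableSet_generateFrom ⟨{K}, ?_⟩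
    ext X
    simp [trueCyl]

/-- What can be seen of a configuration through the `(k - 1)`-set `T`. -/
def sideView (k : ℕ) (T : Finset (Fin R)) (X : Config R) : Config R :=
  fun K => X K && decide (#T = k - 1 ∧ mainIdx K ⊆ T)

lemma measurable_sideView (T : Finset (Fin R)) : Measurable (sideView k T) := by
  refine measurable_pi_iff.mpr fun K => ?_
  exact (measurable_from_top (f := fun b : Bool => b && decide (#T = k - 1 ∧ mainIdx K ⊆ T))).comp
    (measurable_pi_apply K)

lemma measurableSet_sideView_preimage {T : Finset (Fin R)} {𝒦 : Finset (Finset (Fin R × ℕ))} {a : ℕ}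
    (h : ∀ K ∈ 𝒦, ∀ v ∈ K, v.2 ≤ a) :
    MeasurableSet[coordSigma (sideCoords k T a)] (sideView k T ⁻¹' trueCyl 𝒦) := by
  have : sideView k T ⁻¹' trueCyl 𝒦
      = ⋂ K ∈ 𝒦, {X : Config R | X K = true ∧ #T = k - 1 ∧ mainIdx K ⊆ T} := by
    ext X
    simp [trueCyl, sideView]
  rw [this]
  refine @Finset.measurableSet_biInter _ _ (_) _ 𝒦 fun K hK => ?_
  by_cases hT : #T = k - 1 ∧ mainIdx K ⊆ T
  · simp only [hT, and_true]
    exact measurableSet_coord_eq_true ⟨hT.1, hT.2, h K hK⟩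
  · simp only [hT, and_false, Set.ofPred_false]
    exact @MeasurableSet.empty _ (_)

variable {P : Measure (Config R)} [IsProbabilityMeasure P]

lemma condExpKernel_iInter_sideView (hP : IsRenameInvariant P) (hk : 2 ≤ k)
    (𝒦 : Finset (Fin R) → Finset (Finset (Fin R × ℕ))) :
    ∀ᵐ X ∂P, condExpKernel P (lowSigma R k) X (⋂ T, sideView k T ⁻¹' trueCyl (𝒦 T))
      = ∏ T, condExpKernel P (lowSigma R k) X (sideView k T ⁻¹' trueCyl (𝒦 T)) := by
  set s : Finset (Fin R) → Set (Config R) := fun T => sideView k T ⁻¹' trueCyl (𝒦 T) with hs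
  set a : ℕ := univ.sup fun T => (𝒦 T).sup fun K => K.sup Prod.snd
  have hsa : ∀ T, MeasurableSet[coordSigma (sideCoords k T a)] (s T) := fun T =>
    measurableSet_sideView_preimage fun K hK v hv =>
      (le_sup (f := Prod.snd) hv).trans ((le_sup (f := fun K => K.sup Prod.snd) hK).trans
        (le_sup (f := fun T => (𝒦 T).sup fun K => K.sup Prod.snd) (mem_univ T)))
  have hsm : ∀ T, MeasurableSet (s T) := fun T => coordSigma_le _ _ (hsa T)
  have h1 := condExpKernel_ae_eq_condExp (μ := P) (lowSigma_le (R := R) (k := k))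
    (MeasurableSet.iInter hsm)
  have h2 : ∀ᵐ X ∂P, ∀ T, (condExpKernel P (lowSigma R k) X).real (s T)
      = P[(s T).indicator fun _ => (1 : ℝ) | lowSigma R k] X :=
    ae_all_iff.mpr fun T => condExpKernel_ae_eq_condExp lowSigma_le (hsm T)
  have h3 := condExp_prod_side hP hk hsa univ
  have hind : ∏ T, (s T).indicator (fun _ => (1 : ℝ)) = (⋂ T, s T).indicator fun _ => (1 : ℝ) := by
    ext X
    rw [prod_apply]
    by_cases hX : X ∈ ⋂ T, s T
    · rw [Set.indicator_of_mem hX]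
      exact prod_eq_one fun T _ => Set.indicator_of_mem (Set.mem_iInter.mp hX T) _
    · rw [Set.indicator_of_notMem hX]
      rw [Set.mem_iInter, not_forall] at hX
      obtain ⟨T, hT⟩ := hX
      exact prod_eq_zero (mem_univ T) (Set.indicator_of_notMem hT _)
  rw [hind] at h3
  filter_upwards [h1, h2, h3] with X hX1 hX2 hX3
  rw [hX3, prod_apply, ← prod_congr rfl fun T _ => hX2 T] at hX1
  simp only [measureReal_def] at hX1
  rw [← ENNReal.toReal_prod] at hX1
  exact (ENNReal.toReal_eq_toReal_iff' (measure_ne_top _ _)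
    (ENNReal.prod_ne_top fun T _ => measure_ne_top _ _)).mp hX1

/-- Given the low σ-algebra, the views through different `(k - 1)`-sets are independent. -/
lemma ae_iIndepFun_sideView (hP : IsRenameInvariant P) (hk : 2 ≤ k) :
    ∀ᵐ X ∂P, iIndepFun (fun T => sideView (R := R) k T) (condExpKernel P (lowSigma R k) X) := by
  filter_upwards [ae_all_iff.mpr (condExpKernel_iInter_sideView hP hk)] with X hX
  rw [iIndepFun_iff_map_fun_eq_pi_map fun T => (measurable_sideView T).aemeasurable]
  have hprob : ∀ T, IsProbabilityMeasure
      ((condExpKernel P (lowSigma R k) X).map (sideView (R := R) k T)) := fun T =>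
    Measure.isProbabilityMeasure_map (measurable_sideView T).aemeasurable
  refine (Measure.pi_eq_generateFrom (C := fun _ => Set.range (trueCyl (R := R)))
    (fun _ => generateFrom_trueCyl) (fun _ => isPiSystem_trueCyl)
    (fun T => ⟨fun _ => trueCyl ∅, fun _ => ⟨∅, rfl⟩, fun _ => measure_lt_top _ _, ?_⟩) ?_).symm
  · simp [trueCyl, Set.iUnion_const]
  · intro s hs
    choose 𝒦 h𝒦 using hs
    obtain rfl : (fun T => trueCyl (𝒦 T)) = s := funext h𝒦
    rw [Measure.map_apply (measurable_pi_lambda _ fun T => measurable_sideView T)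
      (MeasurableSet.univ_pi fun T => measurableSet_trueCyl _)]
    rw [prod_congr rfl fun T _ => Measure.map_apply (measurable_sideView T)
      (measurableSet_trueCyl (𝒦 T)), ← hX 𝒦]
    congr 1
    ext Y
    simp

lemma exists_preimage_sideView_eq (P : Measure (Config R)) {e : Finset (Fin R)} (he : #e = k) :
    ∃ A : Set (Fin k → Config R), MeasurableSet A ∧
      (fun X (j : Fin k) => sideView k (dropRank e j) X) ⁻¹' A = {X | 0 < linkFn P e X} := by
  have h1 : MeasurableSet[mainSigma {B | B ⊂ e}] {X | 0 < linkFn P e X} :=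
    stronglyMeasurable_condExp.measurable measurableSet_Ioi
  have hle : mainSigma {B | B ⊂ e} ≤ MeasurableSpace.comap
      (fun (X : Config R) (j : Fin k) => sideView k (dropRank e j) X) inferInstance := by
    refine iSup₂_le fun K (hK : mainIdx K ⊂ e) => ?_
    obtain ⟨v, hve, hvK⟩ := exists_of_ssubset hK
    have hj : rankIn e v < k := he ▸ rankIn_lt_card hve
    have hsub : mainIdx K ⊆ dropRank e (rankIn e v) := by
      rw [dropRank_eq_erase hve]
      exact subset_erase.mpr ⟨hK.1, hvK⟩
    have hcard : #(dropRank e (rankIn e v)) = k - 1 := by rw [card_dropRank (he ▸ hj), he]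
    refine Measurable.comap_le ?_
    have hcomp : (fun X : Config R => X K) = (fun z : Fin k → Config R => z ⟨rankIn e v, hj⟩ K) ∘
        fun (X : Config R) (j : Fin k) => sideView k (dropRank e j) X := by
      ext X
      simp [sideView, hsub, hcard]
    rw [hcomp]
    exact Measurable.comp (by fun_prop) (comap_measurable _)
  exact hle _ h1

lemma ae_le_condExpKernel_linkFn (hP : IsRenameInvariant P) (hk : 2 ≤ k) {e : Finset (Fin R)}
    (he : #e = k) :
    ∀ᵐ X ∂P, P[edgeFn e | lowSigma R k] X
      ≤ (condExpKernel P (lowSigma R k) X).real {X | 0 < linkFn P e X} := by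
  have hm : MeasurableSet {X | 0 < linkFn P e X} :=
    mainSigma_le _ _ ((stronglyMeasurable_condExp (m := mainSigma {B | B ⊂ e}) (μ := P)
      (f := edgeFn e)).measurable measurableSet_Ioi)
  have hmono := condExp_mono (m := lowSigma R k) (isUnitBdd_linkFn P e).integrable
    (isUnitBdd_indicator hm).integrable (by
      filter_upwards [(isUnitBdd_linkFn P e).2] with X hX
      by_cases h : 0 < linkFn P e X
      · rw [Set.indicator_of_mem (s := {X | 0 < linkFn P e X}) h]
        exact (abs_le.mp hX).2
      · rw [Set.indicator_of_notMem (s := {X | 0 < linkFn P e X}) h]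
        exact not_lt.mp h)
  filter_upwards [hmono, condExp_linkFn hP hk he, condExpKernel_ae_eq_condExp lowSigma_le hm]
    with X h1 h2 h3
  rw [h3, ← h2]
  exact h1

/-- A renaming invariant measure with positive edge density relative to low events charges
every layered pattern. -/
theorem exists_layered_edges_pos {N L : ℕ} (hk : 2 ≤ k) (c : Finset (Fin N) → Fin k)
    (hkL : k ≤ L) {d : ℝ} (hd : 0 < d) :
    ∃ R : ℕ, ∀ P : Measure (Config R), IsProbabilityMeasure P → IsRenameInvariant P →
      (∀ I ∈ powersetCard L (univ : Finset (Fin R)), ∀ n, ∀ D,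
        MeasurableSet[coordSigma (lowCoords R k n)] D →
        d * P.real D ≤ ∑ e ∈ powersetCard k I, P.real (D ∩ edgeEvent e)) →
      ∃ ι : Fin N ↪o Fin R,
        0 < P {X | ∀ e ∈ layeredEdges c, X (baseSet (e.map ι.toEmbedding)) = true} := by
  have hδ : 0 < d / L.choose k := div_pos hd (by exact_mod_cast Nat.choose_pos hkL)
  obtain ⟨M, hM⟩ := exists_layered_pos (by omega : 0 < k) c (ENNReal.ofReal_pos.mpr hδ).ne'
  obtain ⟨R, hR⟩ := finset_ramsey k M L
  refine ⟨R, fun P _ hP hdens => ?_⟩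
  set good : (Fin N ↪o Fin R) → Set (Config R) := fun ι =>
    {X | ∀ e ∈ layeredEdges c, 0 < linkFn P (e.map ι.toEmbedding) X} with hgood
  suffices h : ∃ ι, 0 < P (good ι) by
    obtain ⟨ι, hι⟩ := h
    refine ⟨ι, ?_⟩
    have := measure_edgeEvents_pos (k := k) hP
      (𝓔 := (layeredEdges c).image fun e => e.map ι.toEmbedding) ?_ ?_
    · simpa only [forall_mem_image] using this
    · rw [forall_mem_image]
      intro e he
      rw [card_map]
      exact (mem_powersetCard.mp (mem_filter.mp he).1).2
    · simpa only [forall_mem_image] using hι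
  by_contra! hzero
  have hker : ∀ᵐ X ∂P, ∀ ι, condExpKernel P (lowSigma R k) X (good ι) = 0 := by
    refine ae_all_iff.mpr fun ι => ?_
    have h0 : ∀ᵐ Y ∂P, Y ∉ good ι :=
      measure_eq_zero_iff_ae_notMem.mp (nonpos_iff_eq_zero.mp (hzero ι))
    rw [← condExpKernel_comp_trim (μ := P) (lowSigma_le (R := R) (k := k))] at h0
    filter_upwards [ae_of_ae_trim lowSigma_le (Measure.ae_ae_of_ae_comp h0)] with X hX
    exact measure_eq_zero_iff_ae_notMem.mpr hX
  have hA : ∀ e : Finset (Fin R), ∃ A : Set (Fin k → Config R), MeasurableSet A ∧ (#e = k →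
      (fun X (j : Fin k) => sideView k (dropRank e j) X) ⁻¹' A = {X | 0 < linkFn P e X}) := by
    intro e
    by_cases he : #e = k
    · obtain ⟨A, h1, h2⟩ := exists_preimage_sideView_eq P he
      exact ⟨A, h1, fun _ => h2⟩
    · exact ⟨∅, MeasurableSet.empty, fun h => absurd h he⟩
  choose A hAm hA using hA
  have hlink : ∀ᵐ X ∂P, ∀ e ∈ powersetCard k (univ : Finset (Fin R)),
      P[edgeFn e | lowSigma R k] X
        ≤ (condExpKernel P (lowSigma R k) X).real {X | 0 < linkFn P e X} := by
    rw [Filter.eventually_all_finset]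
    exact fun e he => ae_le_condExpKernel_linkFn hP hk (mem_powersetCard.mp he).2
  have hfalse : ∀ᵐ X ∂P, False := by
    filter_upwards [hker, hlink, ae_iIndepFun_sideView hP hk,
      ae_exists_dense_subset hkL M hR le_rfl hdens] with X hX1 hX2 hX3 ⟨J, hJ, hJe⟩
    set κ := condExpKernel P (lowSigma R k) X
    have hprob : ∀ T, IsProbabilityMeasure (κ.map (sideView (R := R) k T)) := fun T =>
      Measure.isProbabilityMeasure_map (measurable_sideView T).aemeasurable
    have hAδ : ∀ e ∈ powersetCard k J, ENNReal.ofReal (d / L.choose k)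
        ≤ Measure.pi (fun i : Fin k => κ.map (sideView k (dropRank e i))) (A e) := by
      intro e he
      have hcard := (mem_powersetCard.mp he).2
      have hinj : Function.Injective fun i : Fin k => dropRank e i := fun i j h =>
        Fin.ext (dropRank_injOn (hcard ▸ i.2) (hcard ▸ j.2) h)
      have hmap := (iIndepFun_iff_map_fun_eq_pi_map fun i : Fin k =>
        (measurable_sideView (k := k) (dropRank e i)).aemeasurable).mp (hX3.precomp hinj)
      rw [← hmap, Measure.map_apply (measurable_pi_lambda _ fun i => measurable_sideView _) (hAm e),
        hA e hcard, ← ofReal_measureReal]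
      exact ENNReal.ofReal_le_ofReal ((hJe e he).trans
        (hX2 e (mem_powersetCard.mpr ⟨subset_univ _, hcard⟩)))
    obtain ⟨ι, hι⟩ := hM R J hJ.ge (Config R) (fun T => κ.map (sideView k T)) A hAm hAδ
    refine hι.ne' ?_
    rw [← (iIndepFun_iff_map_fun_eq_pi_map fun T =>
      (measurable_sideView T).aemeasurable).mp hX3, Measure.map_apply]
    · rw [← hX1 ι]
      congr 1
      ext Y
      refine forall₂_congr fun e he => ?_
      have hcard : #(e.map ι.toEmbedding) = k := by
        rw [card_map]
        exact (mem_powersetCard.mp (mem_filter.mp he).1).2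
      exact Set.ext_iff.mp (hA _ hcard) Y
    · exact measurable_pi_lambda _ fun T => measurable_sideView T
    · have : {z : Finset (Fin R) → Config R | ∀ e ∈ layeredEdges c,
          (fun i : Fin k => z (dropRank (e.map ι.toEmbedding) i)) ∈ A (e.map ι.toEmbedding)}
          = ⋂ e ∈ layeredEdges c, (fun (z : Finset (Fin R) → Config R) (i : Fin k) =>
            z (dropRank (e.map ι.toEmbedding) i)) ⁻¹' A (e.map ι.toEmbedding) := by
        ext z; simp
      rw [this]
      exact Finset.measurableSet_biInter _ fun e _ =>
        (measurable_pi_lambda _ fun i => measurable_pi_apply _) (hAm _)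
  exact (hfalse.exists).elim fun _ h => h

end sideView

section limitPoint
variable {R k : ℕ}

/-- `P` is a limit of the measures `Q m` on clopen sets. -/
def IsClopenLimit (U : Filter ℕ) (Q : ℕ → Measure (Config R)) (P : Measure (Config R)) : Prop :=
  ∀ s, IsClopen s → Filter.Tendsto (fun m => (Q m).real s) U (nhds (P.real s))

lemma exists_isClopenLimit (Q : ℕ → Measure (Config R)) (hQ : ∀ m, IsProbabilityMeasure (Q m)) :
    ∃ P : Measure (Config R), IsProbabilityMeasure P ∧
      IsClopenLimit (Filter.hyperfilter ℕ) Q P := by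
  let q : ℕ → ProbabilityMeasure (Config R) := fun m => ⟨Q m, hQ m⟩
  let p : ProbabilityMeasure (Config R) := ((Filter.hyperfilter ℕ).map q).lim
  have hp : Filter.Tendsto q (Filter.hyperfilter ℕ) (nhds p) :=
    Ultrafilter.le_nhds_lim ((Filter.hyperfilter ℕ).map q)
  refine ⟨p, p.2, fun s hs => ?_⟩
  have h := ProbabilityMeasure.tendsto_measure_of_null_frontier_of_tendsto' hp (E := s)
    (by rw [hs.frontier_eq, measure_empty])
  exact (ENNReal.tendsto_toReal (measure_ne_top _ _)).comp h

lemma isClopen_coord_eq (K : Finset (Fin R × ℕ)) (b : Bool) :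
    IsClopen {X : Config R | X K = b} :=
  (isClopen_discrete {b}).preimage (continuous_apply K)

lemma isClopen_trueCyl (𝒦 : Finset (Finset (Fin R × ℕ))) : IsClopen (trueCyl 𝒦) := by
  rw [trueCyl_eq_biInter]
  exact isClopen_biInter_finset fun K _ => isClopen_coord_eq K true

lemma IsClopenLimit.isRenameInvariant {U : Filter ℕ} [U.NeBot] {Q : ℕ → Measure (Config R)}
    {P : Measure (Config R)} [IsProbabilityMeasure P] (h : IsClopenLimit U Q P)
    (hQ : ∀ m, IsRenameInvariant (Q m)) : IsRenameInvariant P := by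
  intro τ hτ hτ1
  have hprob : IsProbabilityMeasure (P.map (renameVertices τ)) :=
    Measure.isProbabilityMeasure_map (measurable_renameVertices τ).aemeasurable
  refine ext_of_generate_finite _ generateFrom_trueCyl.symm isPiSystem_trueCyl ?_ (by simp)
  rintro _ ⟨𝒦, rfl⟩
  have hpre : renameVertices τ ⁻¹' trueCyl 𝒦 = trueCyl (𝒦.image fun K => K.image τ) := by
    ext X
    simp [trueCyl, renameVertices]
  rw [Measure.map_apply (measurable_renameVertices τ) (measurableSet_trueCyl 𝒦), hpre]
  have h1 := h _ (isClopen_trueCyl (𝒦.image fun K => K.image τ))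
  have h2 : ∀ m, (Q m).real (trueCyl (𝒦.image fun K => K.image τ)) = (Q m).real (trueCyl 𝒦) := by
    intro m
    rw [← hpre, measureReal_def, measureReal_def,
      ← Measure.map_apply (measurable_renameVertices τ) (measurableSet_trueCyl 𝒦), hQ m τ hτ hτ1]
  simp_rw [h2] at h1
  exact (measureReal_eq_measureReal_iff).mp (tendsto_nhds_unique h1 (h _ (isClopen_trueCyl 𝒦)))

/-- The configurations agreeing with `t` on the low coordinates of level at most `a`. -/
def lowAtom (k a : ℕ) (t : Config R) : Set (Config R) :=
  {X | ∀ K ∈ lowCoords R k a, X K = t K}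

lemma finite_lowCoords (R k a : ℕ) : (lowCoords R k a).Finite := by
  refine (((univ : Finset (Fin R)) ×ˢ range (a + 1)).powerset.finite_toSet).subset fun K hK => ?_
  rw [mem_coe, mem_powerset]
  exact fun v hv => mem_product.mpr ⟨mem_univ _, mem_range.mpr (Nat.lt_succ_of_le (hK.2 v hv))⟩

lemma isClopen_lowAtom (a : ℕ) (t : Config R) : IsClopen (lowAtom k a t) := by
  have : lowAtom k a t = ⋂ K ∈ lowCoords R k a, {X : Config R | X K = t K} := by
    ext X; simp [lowAtom]
  rw [this]
  exact (finite_lowCoords R k a).isClopen_biInter fun K _ => isClopen_coord_eq K _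

lemma isClopen_edgeEvent (e : Finset (Fin R)) : IsClopen (edgeEvent e) :=
  isClopen_coord_eq (baseSet e) true

/-- Membership in a low event depends only on the low coordinates. -/
lemma mem_iff_of_eqOn {𝒮 : Set (Finset (Fin R × ℕ))} {D : Set (Config R)}
    (hD : MeasurableSet[coordSigma 𝒮] D) {X Y : Config R} (h : ∀ K ∈ 𝒮, X K = Y K) :
    X ∈ D ↔ Y ∈ D := by
  let g : Config R → Config R := fun Z K => if K ∈ 𝒮 then Z K else false
  have hg : g ⁻¹' D = D := by
    have hle : coordSigma 𝒮 ≤ MeasurableSpace.invariants g := by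
      refine iSup₂_le fun K hK => ?_
      rintro t ⟨b, -, rfl⟩
      refine ⟨measurable_pi_apply K (MeasurableSet.of_discrete (s := b)), ?_⟩
      ext Z
      simp [g, hK]
    exact (hle D hD).2
  have hXY : g X = g Y := by
    ext K
    by_cases hK : K ∈ 𝒮 <;> simp [g, hK, h]
  have h1 : X ∈ D ↔ g X ∈ D := by rw [← Set.mem_preimage, hg]
  have h2 : Y ∈ D ↔ g Y ∈ D := by rw [← Set.mem_preimage, hg]
  rw [h1, h2, hXY]

/-- A density inequality for atoms extends to all low events. -/
lemma density_of_lowAtom {P : Measure (Config R)} [IsProbabilityMeasure P] {I : Finset (Fin R)}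
    {d : ℝ} {a : ℕ} (h : ∀ t : Config R, d * P.real (lowAtom k a t)
      ≤ ∑ e ∈ powersetCard k I, P.real (lowAtom k a t ∩ edgeEvent e))
    {D : Set (Config R)} (hD : MeasurableSet[coordSigma (lowCoords R k a)] D) :
    d * P.real D ≤ ∑ e ∈ powersetCard k I, P.real (D ∩ edgeEvent e) := by
  have hfin := (finite_lowCoords R k a).to_subtype
  have := Fintype.ofFinite (lowCoords R k a)
  let res : Config R → (lowCoords R k a → Bool) := fun X K => X K
  let ext' : (lowCoords R k a → Bool) → Config R := fun t K =>
    if hK : K ∈ lowCoords R k a then t ⟨K, hK⟩ else false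
  have hext : ∀ t (K : lowCoords R k a), ext' t K = t K := fun t K => by simp [ext', K.2]
  have hatom : ∀ t, lowAtom k a (ext' t) = res ⁻¹' {t} := by
    intro t
    ext X
    simp only [lowAtom, Set.mem_preimage, Set.mem_singleton_iff, funext_iff, res]
    exact ⟨fun hX K => (hX K K.2).trans (hext t K),
      fun hX K hK => (hX ⟨K, hK⟩).trans (hext t ⟨K, hK⟩).symm⟩
  have hsum : ∀ s : Set (Config R), MeasurableSet s → P.real (D ∩ s)
      = ∑ t with ext' t ∈ D, P.real (lowAtom k a (ext' t) ∩ s) := by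
    intro s hs
    rw [← measureReal_biUnion_finset]
    · congr 1
      ext X
      simp only [Set.mem_inter_iff, Set.mem_iUnion, mem_filter, mem_univ, true_and, hatom,
        Set.mem_preimage, Set.mem_singleton_iff, exists_prop]
      have hX : X ∈ D ↔ ext' (res X) ∈ D := mem_iff_of_eqOn hD fun K hK =>
        (hext (res X) ⟨K, hK⟩).symm
      rw [hX]
      exact ⟨fun hX => ⟨res X, hX.1, rfl, hX.2⟩, fun ⟨t, h1, h2, h3⟩ => ⟨h2 ▸ h1, h3⟩⟩
    · intro t _ t' _ htt'
      rw [Function.onFun, Set.disjoint_left]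
      rintro X ⟨hX, -⟩ ⟨hX', -⟩
      rw [hatom] at hX hX'
      exact htt' (hX.symm.trans hX')
    · exact fun t _ => (isClopen_lowAtom a _).isOpen.measurableSet.inter hs
  have hsum' := hsum Set.univ MeasurableSet.univ
  simp only [Set.inter_univ] at hsum'
  rw [hsum', mul_sum, sum_congr rfl fun e _ => hsum _ (measurableSet_edgeEvent e), sum_comm]
  exact sum_le_sum fun t _ => h _

lemma IsClopenLimit.density {U : Filter ℕ} [U.NeBot] {Q : ℕ → Measure (Config R)}
    {P : Measure (Config R)} [IsProbabilityMeasure P] (h : IsClopenLimit U Q P)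
    {I : Finset (Fin R)} {d : ℝ} {ε : ℕ → ℝ} (hε : Filter.Tendsto ε U (nhds 0))
    (hQ : ∀ m a, ∀ t : Config R, d * (Q m).real (lowAtom k a t) - ε m
      ≤ ∑ e ∈ powersetCard k I, (Q m).real (lowAtom k a t ∩ edgeEvent e))
    {a : ℕ} {D : Set (Config R)} (hD : MeasurableSet[coordSigma (lowCoords R k a)] D) :
    d * P.real D ≤ ∑ e ∈ powersetCard k I, P.real (D ∩ edgeEvent e) := by
  refine density_of_lowAtom (fun t => ?_) hD
  have h1 := ((h _ (isClopen_lowAtom (k := k) a t)).const_mul d).sub hε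
  have h2 := tendsto_finsetSum (powersetCard k I) fun e _ =>
    h _ ((isClopen_lowAtom (k := k) a t).inter (isClopen_edgeEvent e))
  rw [sub_zero] at h1
  exact le_of_tendsto_of_tendsto' h1 h2 fun m => hQ m a t

end limitPoint

section finiteModel
variable {R k n : ℕ}

lemma infinitePi_map_comp_injective {ι κ α : Type*} [MeasurableSpace α] {μ : ι → Measure α}
    [∀ i, IsProbabilityMeasure (μ i)] {g : κ → ι} (hg : Function.Injective g) :
    (Measure.infinitePi μ).map (fun x i => x (g i)) = Measure.infinitePi fun i => μ (g i) := by
  have hind := (iIndepFun_infinitePi (P := μ) (X := fun _ y => y) fun _ => measurable_id).precomp hg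
  rw [iIndepFun_iff_map_fun_eq_infinitePi_map fun i => measurable_pi_apply (g i)] at hind
  rw [hind]
  congr 1
  ext1 i
  exact Measure.infinitePi_map_eval μ (g i)

/-- The law of independent uniform samples from the parts `V i`. -/
def sampleLaw (V : Fin R → Finset (Fin n)) : Measure (Fin R × ℕ → Fin n) :=
  Measure.infinitePi fun v => uniformOn (V v.1 : Set (Fin n))

/-- The configuration of edges of `E` spanned by a sample. -/
def sampleConfig (E : Finset (Finset (Fin n))) (x : Fin R × ℕ → Fin n) : Config R :=
  fun K => decide (K.image x ∈ E)

lemma measurable_sampleConfig (E : Finset (Finset (Fin n))) :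
    Measurable (sampleConfig (R := R) E) := by
  refine measurable_pi_iff.mpr fun K => ?_
  have : (fun x : Fin R × ℕ → Fin n => sampleConfig E x K)
      = (fun y : K → Fin n => decide (univ.image y ∈ E)) ∘ K.restrict := by
    ext x
    have hK : K.image x = univ.image (K.restrict x) := by
      ext v
      simp [Finset.restrict]
    simp only [sampleConfig, Function.comp_apply, hK]
  rw [this]
  exact (measurable_of_finite _).comp (measurable_restrict K)

/-- The law of the configuration of a random sample. -/
def edgeLaw (V : Fin R → Finset (Fin n)) (E : Finset (Finset (Fin n))) : Measure (Config R) :=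
  (sampleLaw V).map (sampleConfig E)

variable {V : Fin R → Finset (Fin n)}

lemma isProbabilityMeasure_part (hV : ∀ i, (V i).Nonempty) (i : Fin R) :
    IsProbabilityMeasure (uniformOn (V i : Set (Fin n))) :=
  isProbabilityMeasure_uniformOn (finite_toSet _) (hV i)

lemma isProbabilityMeasure_sampleLaw (hV : ∀ i, (V i).Nonempty) :
    IsProbabilityMeasure (sampleLaw V) := by
  have := isProbabilityMeasure_part hV
  unfold sampleLaw
  infer_instance

lemma isProbabilityMeasure_edgeLaw (hV : ∀ i, (V i).Nonempty) (E : Finset (Finset (Fin n))) :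
    IsProbabilityMeasure (edgeLaw V E) := by
  have := isProbabilityMeasure_sampleLaw hV
  exact Measure.isProbabilityMeasure_map (measurable_sampleConfig E).aemeasurable

lemma isRenameInvariant_edgeLaw (hV : ∀ i, (V i).Nonempty) (E : Finset (Finset (Fin n))) :
    IsRenameInvariant (edgeLaw V E) := by
  intro τ hτ hτ1
  have := isProbabilityMeasure_part hV
  have hτm : Measurable fun (x : Fin R × ℕ → Fin n) v => x (τ v) :=
    measurable_pi_lambda _ fun v => measurable_pi_apply _
  have hlaw : (sampleLaw V).map (fun x v => x (τ v)) = sampleLaw V := by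
    unfold sampleLaw
    rw [infinitePi_map_comp_injective hτ]
    simp only [hτ1]
  unfold edgeLaw
  rw [Measure.map_map (measurable_renameVertices τ) (measurable_sampleConfig E)]
  conv_rhs => rw [← hlaw, Measure.map_map (measurable_sampleConfig E) hτm]
  congr 1
  ext x K
  simp only [Function.comp_apply, renameVertices, sampleConfig, image_image]
  rfl

/-- Replace the level-`0` samples of `x` by `z`. -/
def replaceMain (z : Fin R → Fin n) (x : Fin R × ℕ → Fin n) (v : Fin R × ℕ) : Fin n :=
  if v.2 = 0 then z v.1 else x v

lemma measurable_replaceMain :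
    Measurable fun p : (Fin R → Fin n) × (Fin R × ℕ → Fin n) => replaceMain p.1 p.2 := by
  refine measurable_pi_lambda _ fun v => ?_
  unfold replaceMain
  split_ifs <;> fun_prop

lemma map_replaceMain (hV : ∀ i, (V i).Nonempty) :
    ((Measure.pi fun i => uniformOn (V i : Set (Fin n))).prod (sampleLaw V)).map
      (fun p => replaceMain p.1 p.2) = sampleLaw V := by
  have := isProbabilityMeasure_part hV
  have := isProbabilityMeasure_sampleLaw hV
  refine Measure.eq_infinitePi _ fun s t ht => ?_
  set s₀ := {v ∈ s | v.2 = 0} with hs₀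
  set s₁ := {v ∈ s | ¬ v.2 = 0} with hs₁
  rw [Measure.map_apply measurable_replaceMain
    (MeasurableSet.pi s.countable_toSet fun v _ => ht v)]
  have hpre : (fun p : (Fin R → Fin n) × (Fin R × ℕ → Fin n) => replaceMain p.1 p.2) ⁻¹'
      (s : Set (Fin R × ℕ)).pi t
      = ((s₀.image Prod.fst : Finset (Fin R)) : Set (Fin R)).pi (fun i => t (i, 0)) ×ˢ
        (s₁ : Set (Fin R × ℕ)).pi t := by
    ext ⟨z, x⟩
    simp only [Set.mem_preimage, Set.mem_pi, mem_coe, Set.mem_prod, hs₀, hs₁, mem_image,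
      mem_filter, replaceMain]
    constructor
    · refine fun h => ⟨?_, ?_⟩
      · rintro i ⟨⟨j, a⟩, ⟨hv, ha⟩, rfl⟩
        simp only at ha
        subst ha
        simpa using h _ hv
      · rintro v ⟨hv, hv0⟩
        simpa [hv0] using h v hv
    · rintro ⟨h1, h2⟩ ⟨i, a⟩ hv
      by_cases ha : a = 0
      · subst ha
        simpa using h1 i ⟨(i, 0), ⟨hv, rfl⟩, rfl⟩
      · simpa [ha] using h2 (i, a) ⟨hv, ha⟩
  rw [hpre, Measure.prod_prod, ← Measure.infinitePi_eq_pi,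
    Measure.infinitePi_pi _ fun i _ => ht _, sampleLaw, Measure.infinitePi_pi _ fun i _ => ht _,
    prod_image, ← prod_filter_mul_prod_filter_not s (fun v => v.2 = 0)]
  · congr 1
    refine prod_congr rfl fun v hv => ?_
    rw [← (mem_filter.mp hv).2]
  · rintro ⟨i, a⟩ hv ⟨j, b⟩ hw h
    have h1 := (mem_filter.mp hv).2
    have h2 := (mem_filter.mp hw).2
    exact Prod.ext h (h1.trans h2.symm)

lemma pi_uniformOn_real (V : Fin R → Finset (Fin n)) (p : (Fin R → Fin n) → Prop)
    [DecidablePred p] :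
    (Measure.pi fun i => uniformOn (V i : Set (Fin n))).real {z | p z}
      = #{z ∈ Fintype.piFinset V | p z} / #(Fintype.piFinset V) := by
  rw [← uniformOn_pi, ← Fintype.coe_piFinset]
  have : {z | p z} = (({z | p z} : Finset (Fin R → Fin n)) : Set (Fin R → Fin n)) := by
    ext; simp
  rw [this, measureReal_def, uniformOn_apply_finset, ENNReal.toReal_div, ENNReal.toReal_natCast,
    ENNReal.toReal_natCast]
  congr 3
  ext z
  simp

lemma edgeLaw_real (hV : ∀ i, (V i).Nonempty) (E : Finset (Finset (Fin n)))
    {s : Set (Config R)} (hs : MeasurableSet s) :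
    (edgeLaw V E).real s = ∫ x, (Measure.pi fun i => uniformOn (V i : Set (Fin n))).real
      {z | sampleConfig E (replaceMain z x) ∈ s} ∂sampleLaw V := by
  have := isProbabilityMeasure_part hV
  have := isProbabilityMeasure_sampleLaw hV
  have hm := measurable_sampleConfig (R := R) E hs
  have hm' := measurable_replaceMain (R := R) (n := n) hm
  rw [measureReal_def, edgeLaw, Measure.map_apply (measurable_sampleConfig E) hs]
  conv_lhs => rw [← map_replaceMain hV]
  rw [Measure.map_apply measurable_replaceMain hm, Measure.prod_apply_symm hm', ← integral_toReal]
  · rfl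
  · exact (measurable_measure_prodMk_right hm').aemeasurable
  · exact .of_forall fun x => measure_lt_top _ _

lemma integrable_replaceMain (hV : ∀ i, (V i).Nonempty) (E : Finset (Finset (Fin n)))
    {s : Set (Config R)} (hs : MeasurableSet s) :
    Integrable (fun x => (Measure.pi fun i => uniformOn (V i : Set (Fin n))).real
      {z | sampleConfig E (replaceMain z x) ∈ s}) (sampleLaw V) := by
  have := isProbabilityMeasure_part hV
  have := isProbabilityMeasure_sampleLaw hV
  have hm := measurable_replaceMain (R := R) (n := n) (measurable_sampleConfig (R := R) E hs)
  refine .of_bound (measurable_measure_prodMk_right hm).ennreal_toReal.aestronglyMeasurable 1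
    (.of_forall fun x => ?_)
  rw [Real.norm_of_nonneg measureReal_nonneg]
  exact measureReal_le_one

lemma exists_mem_piFinset_of_edgeLaw_pos (hV : ∀ i, (V i).Nonempty) {E : Finset (Finset (Fin n))}
    {s : Set (Config R)} (hs : MeasurableSet s) (hpos : 0 < (edgeLaw V E).real s) :
    ∃ z ∈ Fintype.piFinset V, ∃ x, sampleConfig E (replaceMain z x) ∈ s := by
  by_contra! hno
  rw [edgeLaw_real hV E hs] at hpos
  refine hpos.ne' (integral_eq_zero_of_ae (.of_forall fun x => ?_))
  refine (pi_uniformOn_real V fun z => sampleConfig E (replaceMain z x) ∈ s).trans ?_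
  rw [filter_false_of_mem fun z hz => hno z hz x]
  simp

lemma sampleConfig_replaceMain_baseSet (E : Finset (Finset (Fin n))) (z : Fin R → Fin n)
    (x : Fin R × ℕ → Fin n) (e : Finset (Fin R)) :
    sampleConfig E (replaceMain z x) (baseSet e) = true ↔ e.image z ∈ E := by
  have : (baseSet e).image (replaceMain z x) = e.image z := by
    rw [baseSet, image_image]
    exact image_congr fun i _ => by simp [replaceMain]
  simp [sampleConfig, this]

lemma IsPolarized.density {L : ℕ} {d ε : ℝ} {E : Finset (Finset (Fin n))}
    (h : IsPolarized k L R n d ε V E) (hkL : k ≤ L) {I : Finset (Fin R)}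
    (hI : I ∈ powersetCard L (univ : Finset (Fin R))) (a : ℕ) (t : Config R) :
    d * (edgeLaw V E).real (lowAtom k a t) - ε
      ≤ ∑ e ∈ powersetCard k I, (edgeLaw V E).real (lowAtom k a t ∩ edgeEvent e) := by
  obtain ⟨hV, -, hE⟩ := h
  have := isProbabilityMeasure_sampleLaw hV
  have hRL : k ≤ #(univ : Finset (Fin R)) := by
    obtain ⟨hsub, hc⟩ := mem_powersetCard.mp hI
    exact hkL.trans (hc ▸ card_le_card hsub)
  have hatom := (isClopen_lowAtom (k := k) a t).isOpen.measurableSet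
  have hedge := fun e => hatom.inter (measurableSet_edgeEvent e)
  rw [edgeLaw_real hV E hatom, sum_congr rfl fun e _ => edgeLaw_real hV E (hedge e),
    ← integral_finsetSum _ fun e _ => integrable_replaceMain hV E (hedge e),
    ← integral_const_mul]
  set f : (Fin R × ℕ → Fin n) → ℝ := fun x => d *
    (Measure.pi fun i => uniformOn (V i : Set (Fin n))).real
      {z | sampleConfig E (replaceMain z x) ∈ lowAtom k a t} with hf
  have hfi : Integrable f (sampleLaw V) := (integrable_replaceMain hV E hatom).const_mul d
  have hsub : ∫ x, f x ∂sampleLaw V - ε = ∫ x, (f x - ε) ∂sampleLaw V := by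
    rw [integral_sub hfi (integrable_const ε)]
    simp
  rw [hsub]
  refine integral_mono (hfi.sub (integrable_const ε))
    (integrable_finsetSum _ fun e _ => integrable_replaceMain hV E (hedge e)) fun x => ?_
  let A : Finset (Fin R) → (Fin R → Fin n) → Prop := fun S z =>
    ∀ K ∈ lowCoords R k a, mainIdx K ⊆ S → sampleConfig E (replaceMain z x) K = t K
  have hA : ∀ S z w, (∀ i ∈ S, z i = w i) → (A S z ↔ A S w) := by
    intro S z w hzw
    refine forall₃_congr fun K _ hKS => ?_
    have : K.image (replaceMain z x) = K.image (replaceMain w x) := by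
      refine image_congr fun v hv => ?_
      unfold replaceMain
      split_ifs with hv0
      · exact hzw _ (hKS (mem_mainIdx.mpr (hv0 ▸ hv)))
      · rfl
    simp only [sampleConfig, this]
  have hAatom : ∀ z, (∀ S ∈ powersetCard (k - 2) univ, A S z)
      ↔ sampleConfig E (replaceMain z x) ∈ lowAtom k a t := by
    refine fun z => ⟨fun h K hK => ?_, fun h S _ K hK _ => h K hK⟩
    obtain ⟨S, hKS, -, hS⟩ := exists_subsuperset_card_eq (subset_univ (mainIdx K)) hK.1
      ((Nat.sub_le k 2).trans hRL)
    exact h S (mem_powersetCard.mpr ⟨subset_univ _, hS⟩) K hK hKS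
  have hineq := hE I hI A hA
  simp only [hAatom] at hineq
  have hpos : 0 < (#(Fintype.piFinset V) : ℝ) := by
    exact_mod_cast (Fintype.piFinset_nonempty.mpr hV).card_pos
  have hedge' : ∀ e : Finset (Fin R), {z | sampleConfig E (replaceMain z x)
      ∈ lowAtom k a t ∩ edgeEvent e} = {z | sampleConfig E (replaceMain z x) ∈ lowAtom k a t ∧
        e.image z ∈ E} := by
    intro e
    ext z
    exact and_congr_right fun _ => sampleConfig_replaceMain_baseSet E z x e
  simp only [hf, hedge', pi_uniformOn_real]
  rw [← sum_div, le_div_iff₀ hpos, sub_mul, mul_assoc, div_mul_cancel₀ _ hpos.ne']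
  exact hineq

end finiteModel

section embedding
variable {k N : ℕ}

/-- Sufficiently dense `k`-graphs contain every layered `k`-graph. -/
theorem exists_layered_copy (hk : 3 ≤ k) (c : Finset (Fin N) → Fin k) {d : ℝ} (hd : 0 < d) :
    ∃ μ : ℝ, 0 < μ ∧ ∃ n₀ : ℕ, ∀ n, n₀ ≤ n → ∀ E : Finset (Finset (Fin n)),
      IsDense k (k - 2) n d μ E → ¬ HGFree (layeredEdges c) E := by
  by_contra! hno
  obtain ⟨L, hkL, d', hd', hpol⟩ := exists_isPolarized hk hd
  obtain ⟨R, hR⟩ := exists_layered_edges_pos (by omega : 2 ≤ k) c hkL hd'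
  have hseq : ∀ m : ℕ, ∃ (n : ℕ) (V : Fin R → Finset (Fin n)) (E : Finset (Finset (Fin n))),
      IsPolarized k L R n d' (1 / ((m : ℝ) + 1)) V E ∧ HGFree (layeredEdges c) E := by
    intro m
    obtain ⟨μ, hμ, n₀, hn₀⟩ := hpol R (1 / ((m : ℝ) + 1)) Nat.one_div_pos_of_nat
    obtain ⟨n, hn, E, hE, hfree⟩ := hno μ hμ n₀
    obtain ⟨V, hV⟩ := hn₀ n hn E hE
    exact ⟨n, V, E, hV, hfree⟩
  choose n V E hVE hfree using hseq
  have hprob := fun m => isProbabilityMeasure_edgeLaw (hVE m).1 (E m)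
  obtain ⟨P, hP, hlim⟩ := exists_isClopenLimit (fun m => edgeLaw (V m) (E m)) hprob
  have hinv := hlim.isRenameInvariant fun m => isRenameInvariant_edgeLaw (hVE m).1 (E m)
  obtain ⟨ι, hι⟩ := hR P hP hinv fun I hI a D hD => hlim.density
    ((tendsto_one_div_add_atTop_nhds_zero_nat (𝕜 := ℝ)).mono_left Nat.hyperfilter_le_atTop)
    (fun m a t => (hVE m).density hkL hI a t) hD
  set 𝒦 := (layeredEdges c).image fun e => baseSet (e.map ι.toEmbedding) with h𝒦
  have hset : {X : Config R | ∀ e ∈ layeredEdges c, X (baseSet (e.map ι.toEmbedding)) = true}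
      = trueCyl 𝒦 := by
    ext X
    simp [trueCyl, h𝒦]
  rw [hset] at hι
  have hι' : 0 < P.real (trueCyl 𝒦) := ENNReal.toReal_pos hι.ne' (measure_ne_top _ _)
  obtain ⟨m, hm⟩ := ((hlim _ (isClopen_trueCyl 𝒦)).eventually (lt_mem_nhds hι')).exists
  obtain ⟨z, hz, x, hx⟩ := exists_mem_piFinset_of_edgeLaw_pos (hVE m).1
    (measurableSet_trueCyl 𝒦) hm
  refine hfree m ⟨fun i => z (ι i),
    (injective_of_mem_parts (hVE m).2.1 hz).comp ι.injective, fun e he => ?_⟩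
  have := (sampleConfig_replaceMain_baseSet (E m) z x _).mp (hx _ (mem_image_of_mem _ he))
  rwa [map_eq_image, image_image] at this

end embedding

end sampling

/-- Corollary 1.6. For every `k`-graph `F` with positive uniform
Turán density `π_{k−2}(F) > 0`, one has `π_{k−2}(F) ≥ k^{−k}`. -/
theorem stmt16 (k f : ℕ) (hk : 3 ≤ k) (F : Finset (Finset (Fin f)))
    (hF : HGIsUniform k F)
    (hpos : 0 < uniformTuranDensity k (k - 2) f F) :
    ((k : ℝ) ^ k)⁻¹ ≤ uniformTuranDensity k (k - 2) f F := by
  have hbdd : BddAbove {d : ℝ | d ∈ Set.Icc (0 : ℝ) 1 ∧ ∀ μ : ℝ, 0 < μ → ∀ n₀ : ℕ, ∃ n : ℕ,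
      n₀ ≤ n ∧ ∃ E : Finset (Finset (Fin n)), HGIsUniform k E ∧ HGFree F E ∧
        IsDense k (k - 2) n d μ E} := ⟨1, fun d hd => hd.1.2⟩
  by_cases hfree : ∀ (n : ℕ) (c : Finset (Fin n) → Fin k), HGFree F (layeredEdges c)
  · refine le_csSup hbdd ⟨⟨by positivity, ?_⟩, fun μ hμ n₀ => ?_⟩
    · exact inv_le_one_of_one_le₀ (one_le_pow₀ (by exact_mod_cast (by omega : 1 ≤ k)))
    · obtain ⟨n, hn, c, hc⟩ := exists_isDense_layered (by omega : 2 ≤ k) hμ n₀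
      exact ⟨n, hn, layeredEdges c,
        fun e he => (Finset.mem_powersetCard.mp (Finset.mem_filter.mp he).1).2, hfree n c, hc⟩
  · exfalso
    simp only [HGFree, not_forall, not_not] at hfree
    obtain ⟨N, c, g, hg, hgF⟩ := hfree
    obtain ⟨d, hd, hd0⟩ : ∃ d ∈ {d : ℝ | d ∈ Set.Icc (0 : ℝ) 1 ∧ ∀ μ : ℝ, 0 < μ → ∀ n₀ : ℕ,
        ∃ n : ℕ, n₀ ≤ n ∧ ∃ E : Finset (Finset (Fin n)), HGIsUniform k E ∧ HGFree F E ∧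
          IsDense k (k - 2) n d μ E}, 0 < d := by
      by_contra! hno
      exact hpos.not_ge (Real.sSup_nonpos hno)
    obtain ⟨μ, hμ, n₀, hn₀⟩ := exists_layered_copy hk c hd0
    obtain ⟨n, hn, E, -, hEF, hE⟩ := hd.2 μ hμ n₀
    refine hn₀ n hn E hE fun ⟨g', hg', hgE⟩ => hEF ⟨g' ∘ g, hg'.comp hg, fun e he => ?_⟩
    rw [← Finset.image_image]
    exact hgE _ (hgF e he)

end
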